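/- Let (L,d,[-,-],(-,-)) be a quasi-cyclic DG-Lie algebra of degree n ≤ 2 over a field K of characteristic 0. Assume there exists a splitting L = H ⊕ d(K) ⊕ K of the complex (L,d) such that: (1) H^i = 0 for all i < 0; (2) H^0 ⊆ L^0 is closed with respect to the bracket [-,-]; (3) H^i and K^i are H^0-submodules of L^i with respect to the adjoint action x ↦ [g,x] (g ∈ H^0) for all i > 0. Then the DG-Lie algebra (L,d,[-,-]) is formal. -/

import Mathlib

/-!
Core definitions: differential graded Lie algebras (DGLAs) over a field `K`,
their cohomology, morphisms, quasi-isomorphisms, zigzags and formality.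

A ℤ-graded vector space is encoded as a module `carrier` together with an internal
direct sum decomposition `grading : ℤ → Submodule K carrier`.
-/

/-- A differential graded Lie algebra over `K`.  The differential `d` has degree `+1`,
the bracket `br` is graded skew-symmetric, satisfies the graded Jacobi identity and
`d` is a graded derivation with respect to it. -/
structure DGLA (K : Type) [Field K] : Type 1 where
  carrier : Type
  [acg : AddCommGroup carrier]
  [mod : Module K carrier]
  grading : ℤ → Submodule K carrier
  internal : DirectSum.IsInternal grading
  d : carrier → carrier
  d_lin : IsLinearMap K d
  d_mem : ∀ i : ℤ, ∀ x ∈ grading i, d x ∈ grading (i + 1)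
  d_sq : ∀ x, d (d x) = 0
  br : carrier → carrier → carrier
  br_lin₁ : ∀ y, IsLinearMap K fun x => br x y
  br_lin₂ : ∀ x, IsLinearMap K (br x)
  br_mem : ∀ i j : ℤ, ∀ x ∈ grading i, ∀ y ∈ grading j, br x y ∈ grading (i + j)
  skew : ∀ i j : ℤ, ∀ x ∈ grading i, ∀ y ∈ grading j,
      br x y = -((-1 : K) ^ (i * j) • br y x)
  jacobi : ∀ i j : ℤ, ∀ x ∈ grading i, ∀ y ∈ grading j, ∀ z : carrier,
      br x (br y z) = br (br x y) z + (-1 : K) ^ (i * j) • br y (br x z)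
  leibniz : ∀ i : ℤ, ∀ x ∈ grading i, ∀ y : carrier,
      d (br x y) = br (d x) y + (-1 : K) ^ i • br x (d y)

attribute [instance] DGLA.acg DGLA.mod

variable {K : Type} [Field K]

/-- The differential bundled as a linear map. -/
def DGLA.dHom (A : DGLA K) : A.carrier →ₗ[K] A.carrier := IsLinearMap.mk' A.d A.d_lin

/-- Degree `i` cocycles. -/
def DGLA.cocycles (A : DGLA K) (i : ℤ) : Submodule K A.carrier :=
  A.grading i ⊓ LinearMap.ker A.dHom

/-- Degree `i` coboundaries. -/
def DGLA.coboundaries (A : DGLA K) (i : ℤ) : Submodule K A.carrier :=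
  A.grading i ⊓ LinearMap.range A.dHom

/-- Degree `i` cohomology `H^i(L)` as a quotient vector space. -/
abbrev DGLA.cohomology (A : DGLA K) (i : ℤ) :=
  A.cocycles i ⧸ ((A.coboundaries i).comap (A.cocycles i).subtype)

/-- A morphism of DGLAs. -/
structure DGLAHom (A B : DGLA K) where
  toFun : A.carrier → B.carrier
  lin : IsLinearMap K toFun
  map_grading : ∀ i : ℤ, ∀ x ∈ A.grading i, toFun x ∈ B.grading i
  map_d : ∀ x, toFun (A.d x) = B.d (toFun x)
  map_br : ∀ x y, toFun (A.br x y) = B.br (toFun x) (toFun y)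

/-- `f` is a quasi-isomorphism: it induces bijections on cohomology in every degree. -/
def DGLAHom.IsQuasiIso {A B : DGLA K} (f : DGLAHom A B) : Prop :=
  ∀ i : ℤ,
    (∀ x ∈ A.cocycles i, f.toFun x ∈ B.coboundaries i → x ∈ A.coboundaries i) ∧
    (∀ y ∈ B.cocycles i, ∃ x ∈ A.cocycles i, f.toFun x - y ∈ B.coboundaries i)

/-- There exists a quasi-isomorphism `A → B`. -/
def QIso (A B : DGLA K) : Prop := ∃ f : DGLAHom A B, f.IsQuasiIso

/-- Two DGLAs are connected by a zigzag of quasi-isomorphisms. -/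
inductive ZigzagQIso : DGLA K → DGLA K → Prop
  | of {A B : DGLA K} : QIso A B → ZigzagQIso A B
  | refl (A : DGLA K) : ZigzagQIso A A
  | symm {A B : DGLA K} : ZigzagQIso A B → ZigzagQIso B A
  | trans {A B C : DGLA K} : ZigzagQIso A B → ZigzagQIso B C → ZigzagQIso A C

/-- A DGLA is formal if it is connected by a zigzag of quasi-isomorphisms to a DGLA
with zero differential.  (This is equivalent to being connected by a zigzag of
quasi-isomorphisms to its cohomology `H^*(L)` endowed with the zero differential and
the induced bracket: any zero-differential DGLA quasi-isomorphic to `L` is isomorphic,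
as a graded Lie algebra, to `H^*(L)` with the induced bracket.) -/
def DGLA.IsFormal (A : DGLA K) : Prop :=
  ∃ M : DGLA K, (∀ x, M.d x = 0) ∧ ZigzagQIso A M

/-- A quasi-cyclic DGLA of degree `n`: a DGLA with finite dimensional cohomology
equipped with a graded symmetric bilinear form of degree `-n`, compatible with `d`
and cyclic with respect to the bracket, whose induced pairing on cohomology is
non-degenerate. -/
structure QCyclicDGLA (K : Type) [Field K] (n : ℤ) extends DGLA K where
  form : carrier → carrier → K
  form_lin₁ : ∀ y, IsLinearMap K fun x => form x y
  form_lin₂ : ∀ x, IsLinearMap K (form x)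
  findim : ∀ i : ℤ, FiniteDimensional K (toDGLA.cohomology i)
  form_degree : ∀ i j : ℤ, i + j ≠ n → ∀ x ∈ grading i, ∀ y ∈ grading j, form x y = 0
  form_symm : ∀ i j : ℤ, ∀ x ∈ grading i, ∀ y ∈ grading j,
      form x y = (-1 : K) ^ (i * j) * form y x
  form_d : ∀ i : ℤ, ∀ x ∈ grading i, ∀ y,
      form (d x) y = (-1 : K) ^ (i + 1) * form x (d y)
  form_cyclic : ∀ x y z, form (br x y) z = form x (br y z)
  nondeg : ∀ i : ℤ, ∀ x ∈ toDGLA.cocycles i,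
      (∀ y ∈ toDGLA.cocycles (n - i), form x y = 0) → x ∈ toDGLA.coboundaries i

/-- A splitting `L = H ⊕ d(K) ⊕ K` of the complex `(L, d)` into graded subspaces:
`d` vanishes on `H`, is injective on `K = Kc`, and in every degree `i` one has the
internal direct sum `L^i = H^i ⊕ d(K^{i-1}) ⊕ K^i`. -/
structure GradedSplitting (A : DGLA K) where
  H : ℤ → Submodule K A.carrier
  Kc : ℤ → Submodule K A.carrier
  H_le : ∀ i, H i ≤ A.grading i
  Kc_le : ∀ i, Kc i ≤ A.grading i
  d_H : ∀ i, ∀ x ∈ H i, A.d x = 0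
  d_Kc_inj : ∀ i, ∀ x ∈ Kc i, A.d x = 0 → x = 0
  decomp : ∀ i, H i ⊔ ((Kc (i - 1)).map A.dHom ⊔ Kc i) = A.grading i
  disj₁ : ∀ i, Disjoint (H i) ((Kc (i - 1)).map A.dHom ⊔ Kc i)
  disj₂ : ∀ i, Disjoint ((Kc (i - 1)).map A.dHom) (Kc i)

/-- The contraction data `(π, h)` determined by a splitting `L = H ⊕ d(K) ⊕ K`:
`pr` is the projection onto `H`, and `h` the degree `-1` homotopy given by projecting
onto `d(K)`, applying `-d⁻¹` and including `K` into `L`.  The listed identities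
determine `pr` and `h` uniquely. -/
structure ContractionData (A : DGLA K) (S : GradedSplitting A) where
  pr : A.carrier → A.carrier
  h : A.carrier → A.carrier
  pr_lin : IsLinearMap K pr
  h_lin : IsLinearMap K h
  pr_H : ∀ i : ℤ, ∀ x ∈ S.H i, pr x = x
  pr_dK : ∀ i : ℤ, ∀ x ∈ S.Kc i, pr (A.d x) = 0
  pr_K : ∀ i : ℤ, ∀ x ∈ S.Kc i, pr x = 0
  h_H : ∀ i : ℤ, ∀ x ∈ S.H i, h x = 0
  h_dK : ∀ i : ℤ, ∀ x ∈ S.Kc i, h (A.d x) = -x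
  h_K : ∀ i : ℤ, ∀ x ∈ S.Kc i, h x = 0

/-- A DG-Lie algebra concentrated in degrees `0, 1, 2, 3` whose differential vanishes in degree
`0`, presented by its homogeneous pieces. -/
structure FourTermLie (K : Type) [Field K] : Type 1 where
  M₀ : Type
  M₁ : Type
  M₂ : Type
  M₃ : Type
  [acg₀ : AddCommGroup M₀]
  [acg₁ : AddCommGroup M₁]
  [acg₂ : AddCommGroup M₂]
  [acg₃ : AddCommGroup M₃]
  [mod₀ : Module K M₀]
  [mod₁ : Module K M₁]
  [mod₂ : Module K M₂]
  [mod₃ : Module K M₃]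
  b₀₀ : M₀ →ₗ[K] M₀ →ₗ[K] M₀
  b₀₁ : M₀ →ₗ[K] M₁ →ₗ[K] M₁
  b₀₂ : M₀ →ₗ[K] M₂ →ₗ[K] M₂
  b₀₃ : M₀ →ₗ[K] M₃ →ₗ[K] M₃
  b₁₁ : M₁ →ₗ[K] M₁ →ₗ[K] M₂
  b₁₂ : M₁ →ₗ[K] M₂ →ₗ[K] M₃
  d₁ : M₁ →ₗ[K] M₂
  d₂ : M₂ →ₗ[K] M₃
  skew₀₀ : ∀ x y, b₀₀ x y = -b₀₀ y x
  symm₁₁ : ∀ v w, b₁₁ v w = b₁₁ w v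
  jacobi₀₀₀ : ∀ x y z, b₀₀ x (b₀₀ y z) = b₀₀ (b₀₀ x y) z + b₀₀ y (b₀₀ x z)
  jacobi₀₀₁ : ∀ x y z, b₀₁ x (b₀₁ y z) = b₀₁ (b₀₀ x y) z + b₀₁ y (b₀₁ x z)
  jacobi₀₀₂ : ∀ x y z, b₀₂ x (b₀₂ y z) = b₀₂ (b₀₀ x y) z + b₀₂ y (b₀₂ x z)
  jacobi₀₀₃ : ∀ x y z, b₀₃ x (b₀₃ y z) = b₀₃ (b₀₀ x y) z + b₀₃ y (b₀₃ x z)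
  jacobi₀₁₁ : ∀ y v w, b₀₂ y (b₁₁ v w) = b₁₁ (b₀₁ y v) w + b₁₁ v (b₀₁ y w)
  jacobi₀₁₂ : ∀ y v w, b₀₃ y (b₁₂ v w) = b₁₂ (b₀₁ y v) w + b₁₂ v (b₀₂ y w)
  jacobi₁₁₁ : ∀ u v w, b₁₂ u (b₁₁ v w) + b₁₂ v (b₁₁ u w) + b₁₂ w (b₁₁ u v) = 0
  d₁_b₀₁ : ∀ y v, d₁ (b₀₁ y v) = b₀₂ y (d₁ v)
  d₂_b₀₂ : ∀ y w, d₂ (b₀₂ y w) = b₀₃ y (d₂ w)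
  d₂_b₁₁ : ∀ v w, d₂ (b₁₁ v w) = -b₁₂ w (d₁ v) - b₁₂ v (d₁ w)
  d₂_d₁ : ∀ v, d₂ (d₁ v) = 0

attribute [instance] FourTermLie.acg₀ FourTermLie.acg₁ FourTermLie.acg₂ FourTermLie.acg₃
  FourTermLie.mod₀ FourTermLie.mod₁ FourTermLie.mod₂ FourTermLie.mod₃

namespace FourTermLie

variable (F : FourTermLie K)

/-- The total space of a four-term DG-Lie algebra. -/
abbrev Total : Type := F.M₀ × F.M₁ × F.M₂ × F.M₃

/-- The bracket on the total space. -/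
def bracket (x y : F.Total) : F.Total :=
  (F.b₀₀ x.1 y.1,
    F.b₀₁ x.1 y.2.1 - F.b₀₁ y.1 x.2.1,
    F.b₀₂ x.1 y.2.2.1 - F.b₀₂ y.1 x.2.2.1 + F.b₁₁ x.2.1 y.2.1,
    F.b₀₃ x.1 y.2.2.2 - F.b₀₃ y.1 x.2.2.2 + F.b₁₂ x.2.1 y.2.2.1 - F.b₁₂ y.2.1 x.2.2.1)

/-- The differential on the total space. -/
def diff (x : F.Total) : F.Total := (0, 0, F.d₁ x.2.1, F.d₂ x.2.2.1)

/-- The homogeneous pieces of the total space. -/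
def piece (i : ℤ) : Submodule K F.Total where
  carrier := {x | (i ≠ 0 → x.1 = 0) ∧ (i ≠ 1 → x.2.1 = 0) ∧ (i ≠ 2 → x.2.2.1 = 0) ∧
    (i ≠ 3 → x.2.2.2 = 0)}
  add_mem' := by
    rintro x y ⟨h0, h1, h2, h3⟩ ⟨k0, k1, k2, k3⟩
    refine ⟨fun h => ?_, fun h => ?_, fun h => ?_, fun h => ?_⟩
    · simp [h0 h, k0 h]
    · simp [h1 h, k1 h]
    · simp [h2 h, k2 h]
    · simp [h3 h, k3 h]
  zero_mem' := by simp
  smul_mem' := by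
    rintro c x ⟨h0, h1, h2, h3⟩
    refine ⟨fun h => ?_, fun h => ?_, fun h => ?_, fun h => ?_⟩
    · simp [h0 h]
    · simp [h1 h]
    · simp [h2 h]
    · simp [h3 h]

variable {F}

theorem mem_piece {i : ℤ} {x : F.Total} : x ∈ F.piece i ↔
    (i ≠ 0 → x.1 = 0) ∧ (i ≠ 1 → x.2.1 = 0) ∧ (i ≠ 2 → x.2.2.1 = 0) ∧ (i ≠ 3 → x.2.2.2 = 0) :=
  Iff.rfl

theorem piece_cases {p : ℤ → F.Total → Prop} (h0 : ∀ i, p i 0) (hp0 : ∀ y, p 0 (y, 0, 0, 0))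
    (hp1 : ∀ v, p 1 (0, v, 0, 0)) (hp2 : ∀ w, p 2 (0, 0, w, 0)) (hp3 : ∀ b, p 3 (0, 0, 0, b))
    (i : ℤ) (x : F.Total) (hx : x ∈ F.piece i) : p i x := by
  obtain ⟨y, v, w, b⟩ := x
  obtain ⟨k0, k1, k2, k3⟩ := mem_piece.1 hx
  dsimp only at k0 k1 k2 k3
  by_cases e0 : i = 0
  · subst e0
    rw [k1 (by decide), k2 (by decide), k3 (by decide)]
    exact hp0 y
  by_cases e1 : i = 1
  · subst e1
    rw [k0 (by decide), k2 (by decide), k3 (by decide)]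
    exact hp1 v
  by_cases e2 : i = 2
  · subst e2
    rw [k0 (by decide), k1 (by decide), k3 (by decide)]
    exact hp2 w
  by_cases e3 : i = 3
  · subst e3
    rw [k0 (by decide), k1 (by decide), k2 (by decide)]
    exact hp3 b
  rw [k0 e0, k1 e1, k2 e2, k3 e3]
  exact h0 i

theorem piece_zero_mem (y : F.M₀) : ((y, 0, 0, 0) : F.Total) ∈ F.piece 0 := by simp [mem_piece]
theorem piece_one_mem (v : F.M₁) : ((0, v, 0, 0) : F.Total) ∈ F.piece 1 := by simp [mem_piece]
theorem piece_two_mem (w : F.M₂) : ((0, 0, w, 0) : F.Total) ∈ F.piece 2 := by simp [mem_piece]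
theorem piece_three_mem (b : F.M₃) : ((0, 0, 0, b) : F.Total) ∈ F.piece 3 := by simp [mem_piece]

variable (F)

/-- The sum of all homogeneous pieces of degree different from `i`. -/
def copiece (i : ℤ) : Submodule K F.Total where
  carrier := {x | (i = 0 → x.1 = 0) ∧ (i = 1 → x.2.1 = 0) ∧ (i = 2 → x.2.2.1 = 0) ∧
    (i = 3 → x.2.2.2 = 0)}
  add_mem' := by
    rintro x y ⟨h0, h1, h2, h3⟩ ⟨k0, k1, k2, k3⟩
    refine ⟨fun h => ?_, fun h => ?_, fun h => ?_, fun h => ?_⟩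
    · simp [h0 h, k0 h]
    · simp [h1 h, k1 h]
    · simp [h2 h, k2 h]
    · simp [h3 h, k3 h]
  zero_mem' := by simp
  smul_mem' := by
    rintro c x ⟨h0, h1, h2, h3⟩
    refine ⟨fun h => ?_, fun h => ?_, fun h => ?_, fun h => ?_⟩
    · simp [h0 h]
    · simp [h1 h]
    · simp [h2 h]
    · simp [h3 h]

variable {F} in
theorem mem_copiece {i : ℤ} {x : F.Total} : x ∈ F.copiece i ↔
    (i = 0 → x.1 = 0) ∧ (i = 1 → x.2.1 = 0) ∧ (i = 2 → x.2.2.1 = 0) ∧ (i = 3 → x.2.2.2 = 0) :=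
  Iff.rfl

theorem piece_isInternal : DirectSum.IsInternal F.piece := by
  rw [DirectSum.isInternal_submodule_iff_iSupIndep_and_iSup_eq_top]
  constructor
  · rw [iSupIndep_def]
    intro i
    have hq : (⨆ j, ⨆ (_ : j ≠ i), F.piece j) ≤ F.copiece i := by
      refine iSup₂_le fun j hj x hx => ?_
      obtain ⟨k0, k1, k2, k3⟩ := mem_piece.1 hx
      exact mem_copiece.2 ⟨fun h => k0 fun e => hj (e.trans h.symm),
        fun h => k1 fun e => hj (e.trans h.symm), fun h => k2 fun e => hj (e.trans h.symm),
        fun h => k3 fun e => hj (e.trans h.symm)⟩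
    rw [Submodule.disjoint_def]
    intro x hx hx'
    obtain ⟨k0, k1, k2, k3⟩ := mem_piece.1 hx
    obtain ⟨h0, h1, h2, h3⟩ := mem_copiece.1 (hq hx')
    have e0 : x.1 = 0 := by by_cases h : i = 0 <;> tauto
    have e1 : x.2.1 = 0 := by by_cases h : i = 1 <;> tauto
    have e2 : x.2.2.1 = 0 := by by_cases h : i = 2 <;> tauto
    have e3 : x.2.2.2 = 0 := by by_cases h : i = 3 <;> tauto
    exact Prod.ext e0 (Prod.ext e1 (Prod.ext e2 e3))
  · rw [eq_top_iff]
    rintro ⟨y, v, w, b⟩ -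
    have : ((y, v, w, b) : F.Total) =
        (y, 0, 0, 0) + (0, v, 0, 0) + (0, 0, w, 0) + (0, 0, 0, b) := by
      simp
    rw [this]
    exact add_mem (add_mem (add_mem (Submodule.mem_iSup_of_mem 0 (piece_zero_mem y))
      (Submodule.mem_iSup_of_mem 1 (piece_one_mem v)))
      (Submodule.mem_iSup_of_mem 2 (piece_two_mem w)))
      (Submodule.mem_iSup_of_mem 3 (piece_three_mem b))

/-- The DG-Lie algebra given by a four-term presentation. -/
def toDGLA : DGLA K where
  carrier := F.Total
  grading := F.piece
  internal := F.piece_isInternal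
  d := F.diff
  d_lin := ⟨fun x y => by simp [diff], fun c x => by simp [diff]⟩
  d_mem := by
    refine piece_cases ?_ ?_ ?_ ?_ ?_
    · intro i; simp [diff, mem_piece]
    all_goals intro y; simp [diff, mem_piece]
  d_sq x := by simp [diff, F.d₂_d₁]
  br := F.bracket
  br_lin₁ y := ⟨fun x x' => by simp [bracket]; refine ⟨?_, ?_, ?_⟩ <;> abel,
    fun c x => by simp [bracket, smul_sub]⟩
  br_lin₂ y := ⟨fun x x' => by simp [bracket]; refine ⟨?_, ?_, ?_⟩ <;> abel,
    fun c x => by simp [bracket, smul_sub]⟩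
  br_mem := by
    intro i j x hx y hy
    revert j y
    revert i x
    refine piece_cases ?_ ?_ ?_ ?_ ?_
    · intro i j y hy; simp [bracket, mem_piece]
    all_goals
      intro x
      refine piece_cases ?_ ?_ ?_ ?_ ?_
      · intro i; simp [bracket, mem_piece]
      all_goals intro y; simp [bracket, mem_piece]
  skew := by
    intro i j x hx y hy
    revert j y
    revert i x
    refine piece_cases ?_ ?_ ?_ ?_ ?_
    · intro i j y hy; simp [bracket]
    all_goals
      intro x
      refine piece_cases ?_ ?_ ?_ ?_ ?_
      · intro i; simp [bracket]
      all_goals intro y; simp [bracket]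
    · exact F.skew₀₀ _ _
    · exact F.symm₁₁ _ _
  jacobi := by
    intro i j x hx y hy
    revert j y
    revert i x
    refine piece_cases ?_ ?_ ?_ ?_ ?_
    · intro i j y hy z; simp [bracket]
    all_goals
      intro x
      refine piece_cases ?_ ?_ ?_ ?_ ?_
      · intro i z; simp [bracket]
      all_goals rintro y ⟨z0, z1, z2, z3⟩; simp [bracket]
    · exact ⟨F.jacobi₀₀₀ _ _ _, F.jacobi₀₀₁ _ _ _, F.jacobi₀₀₂ _ _ _, F.jacobi₀₀₃ _ _ _⟩
    · refine ⟨?_, F.jacobi₀₁₁ _ _ _, F.jacobi₀₁₂ _ _ _⟩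
      rw [F.jacobi₀₀₁ x z0 y]; abel
    · rw [F.jacobi₀₀₂ x z0 y, F.jacobi₀₁₂ x z1 y]; constructor <;> abel
    · rw [F.jacobi₀₀₃ x z0 y]; abel
    · rw [F.jacobi₀₀₁ y z0 x, F.jacobi₀₁₁ y x z1, F.jacobi₀₁₂ y x z2]
      refine ⟨?_, ?_, ?_⟩ <;> abel
    · rw [F.jacobi₀₁₁ z0 x y, F.symm₁₁ y (F.b₀₁ z0 x)]
      refine ⟨by abel, ?_⟩
      linear_combination (norm := abel) F.jacobi₁₁₁ x y z1
    · rw [F.jacobi₀₁₂ z0 x y]; abel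
    · rw [F.jacobi₀₀₂ y z0 x, F.jacobi₀₁₂ y z1 x]; constructor <;> abel
    · rw [F.jacobi₀₁₂ z0 y x]; abel
    · rw [F.jacobi₀₀₃ y z0 x]; abel
  leibniz := by
    refine piece_cases ?_ ?_ ?_ ?_ ?_
    · intro i y; simp [bracket, diff]
    all_goals rintro x ⟨z0, z1, z2, z3⟩; simp [bracket, diff]
    · exact ⟨F.d₁_b₀₁ _ _, F.d₂_b₀₂ _ _⟩
    · refine ⟨F.d₁_b₀₁ _ _, ?_⟩
      rw [F.d₂_b₁₁]; abel
    · exact F.d₂_b₀₂ _ _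

/-- Morphisms of four-term presentations, given by their components. -/
structure Hom (F G : FourTermLie K) where
  f₀ : F.M₀ →ₗ[K] G.M₀
  f₁ : F.M₁ →ₗ[K] G.M₁
  f₂ : F.M₂ →ₗ[K] G.M₂
  f₃ : F.M₃ →ₗ[K] G.M₃
  map_b₀₀ : ∀ x y, f₀ (F.b₀₀ x y) = G.b₀₀ (f₀ x) (f₀ y)
  map_b₀₁ : ∀ x y, f₁ (F.b₀₁ x y) = G.b₀₁ (f₀ x) (f₁ y)
  map_b₀₂ : ∀ x y, f₂ (F.b₀₂ x y) = G.b₀₂ (f₀ x) (f₂ y)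
  map_b₀₃ : ∀ x y, f₃ (F.b₀₃ x y) = G.b₀₃ (f₀ x) (f₃ y)
  map_b₁₁ : ∀ x y, f₂ (F.b₁₁ x y) = G.b₁₁ (f₁ x) (f₁ y)
  map_b₁₂ : ∀ x y, f₃ (F.b₁₂ x y) = G.b₁₂ (f₁ x) (f₂ y)
  map_d₁ : ∀ x, f₂ (F.d₁ x) = G.d₁ (f₁ x)
  map_d₂ : ∀ x, f₃ (F.d₂ x) = G.d₂ (f₂ x)

variable {F} {G : FourTermLie K}

/-- The morphism of DG-Lie algebras with given components. -/
def Hom.toDGLAHom (f : Hom F G) : DGLAHom F.toDGLA G.toDGLA where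
  toFun := fun x : F.Total => ((f.f₀ x.1, f.f₁ x.2.1, f.f₂ x.2.2.1, f.f₃ x.2.2.2) : G.Total)
  lin := ⟨fun x y => by
    change F.Total at x y
    exact Prod.ext (map_add _ _ _) (Prod.ext (map_add _ _ _)
      (Prod.ext (map_add _ _ _) (map_add _ _ _))), fun c x => by
    change F.Total at x
    exact Prod.ext (map_smul _ _ _) (Prod.ext (map_smul _ _ _)
      (Prod.ext (map_smul _ _ _) (map_smul _ _ _)))⟩
  map_grading := by
    intro i x hx
    obtain ⟨h0, h1, h2, h3⟩ := mem_piece.1 hx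
    refine mem_piece.2 ⟨fun h => ?_, fun h => ?_, fun h => ?_, fun h => ?_⟩
    · simp [h0 h]
    · simp [h1 h]
    · simp [h2 h]
    · simp [h3 h]
  map_d := by
    intro x
    change F.Total at x
    simp [toDGLA, diff, f.map_d₁, f.map_d₂]
  map_br := by
    intro x y
    change F.Total at x y
    simp [toDGLA, bracket, f.map_b₀₀, f.map_b₀₁, f.map_b₀₂, f.map_b₀₃, f.map_b₁₁, f.map_b₁₂]

theorem mem_cocycles {i : ℤ} {x : F.Total} : x ∈ F.toDGLA.cocycles i ↔
    x ∈ F.piece i ∧ F.d₁ x.2.1 = 0 ∧ F.d₂ x.2.2.1 = 0 := by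
  refine and_congr Iff.rfl ?_
  change ((0, 0, F.d₁ x.2.1, F.d₂ x.2.2.1) : F.Total) = 0 ↔ _
  simp

theorem mem_coboundaries {i : ℤ} {x : F.Total} : x ∈ F.toDGLA.coboundaries i ↔
    x ∈ F.piece i ∧ x.1 = 0 ∧ x.2.1 = 0 ∧ x.2.2.1 ∈ LinearMap.range F.d₁ ∧
      x.2.2.2 ∈ LinearMap.range F.d₂ := by
  refine and_congr Iff.rfl ?_
  constructor
  · rintro ⟨y, rfl⟩
    change F.Total at y
    exact ⟨rfl, rfl, ⟨y.2.1, rfl⟩, ⟨y.2.2.1, rfl⟩⟩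
  · rintro ⟨h0, h1, ⟨v, h2⟩, ⟨w, h3⟩⟩
    refine ⟨((0, v, w, 0) : F.Total), ?_⟩
    exact Prod.ext h0.symm (Prod.ext h1.symm (Prod.ext h2 h3))

/-- A criterion for a map of four-term presentations to be a quasi-isomorphism. -/
theorem Hom.isQuasiIso (f : Hom F G) (h₀ : Function.Bijective f.f₀)
    (inj₁ : ∀ v, F.d₁ v = 0 → f.f₁ v = 0 → v = 0)
    (surj₁ : ∀ v, G.d₁ v = 0 → ∃ v', F.d₁ v' = 0 ∧ f.f₁ v' = v)
    (inj₂ : ∀ w, F.d₂ w = 0 → f.f₂ w ∈ LinearMap.range G.d₁ → w ∈ LinearMap.range F.d₁)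
    (surj₂ : ∀ w, G.d₂ w = 0 → ∃ w', F.d₂ w' = 0 ∧ f.f₂ w' - w ∈ LinearMap.range G.d₁)
    (inj₃ : ∀ b, f.f₃ b ∈ LinearMap.range G.d₂ → b ∈ LinearMap.range F.d₂)
    (surj₃ : ∀ b, ∃ b', f.f₃ b' - b ∈ LinearMap.range G.d₂) :
    QIso F.toDGLA G.toDGLA := by
  refine ⟨f.toDGLAHom, fun i => ⟨?_, ?_⟩⟩
  · intro x hx hfx
    change F.Total at x
    obtain ⟨hx, d1, d2⟩ := mem_cocycles.1 hx
    obtain ⟨-, k0, k1, k2, k3⟩ := mem_coboundaries.1 hfx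
    exact mem_coboundaries.2 ⟨hx, h₀.1 (k0.trans (map_zero _).symm), inj₁ _ d1 k1, inj₂ _ d2 k2,
      inj₃ _ k3⟩
  · intro y hy'
    change G.Total at y
    obtain ⟨hy, d1, d2⟩ := mem_cocycles.1 hy'
    clear hy'
    suffices h : ∃ x : F.Total, x ∈ F.piece i ∧ F.d₁ x.2.1 = 0 ∧ F.d₂ x.2.2.1 = 0 ∧
        f.f₀ x.1 = y.1 ∧ f.f₁ x.2.1 = y.2.1 ∧ f.f₂ x.2.2.1 - y.2.2.1 ∈ LinearMap.range G.d₁ ∧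
        f.f₃ x.2.2.2 - y.2.2.2 ∈ LinearMap.range G.d₂ by
      obtain ⟨x, hx, e1, e2, k0, k1, k2, k3⟩ := h
      have hx' : x ∈ F.toDGLA.cocycles i := mem_cocycles.2 ⟨hx, e1, e2⟩
      refine ⟨x, hx', mem_coboundaries.2 ⟨?_, sub_eq_zero.2 k0, sub_eq_zero.2 k1, k2, k3⟩⟩
      exact sub_mem (f.toDGLAHom.map_grading i x hx) hy
    revert d1 d2
    revert i y
    refine piece_cases (F := G) ?_ ?_ ?_ ?_ ?_
    · intro i _ _
      exact ⟨0, zero_mem _, by simp, by simp, by simp, by simp, by simp, by simp⟩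
    · intro y _ _
      obtain ⟨x, hx⟩ := h₀.2 y
      exact ⟨(x, 0, 0, 0), piece_zero_mem x, by simp, by simp, hx, by simp, by simp, by simp⟩
    · intro v hv _
      obtain ⟨x, hx, hx'⟩ := surj₁ v hv
      exact ⟨(0, x, 0, 0), piece_one_mem x, hx, by simp, by simp, hx', by simp, by simp⟩
    · intro w _ hw
      obtain ⟨x, hx, hx'⟩ := surj₂ w hw
      exact ⟨(0, 0, x, 0), piece_two_mem x, by simp, hx, by simp, by simp, hx', by simp⟩
    · intro b _ _
      obtain ⟨x, hx⟩ := surj₃ b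
      exact ⟨(0, 0, 0, x), piece_three_mem x, by simp, by simp, by simp, by simp, by simp, hx⟩

end FourTermLie

/-- Formal series on a vector space with basis indexed by `ι` and values in `V`, encoded by their
iterated partial derivatives at the origin. -/
abbrev Ser (ι V : Type) : Type := List ι → V

namespace Ser

variable {ι V' W' U' X U V W : Type}

/-- The partial derivative in the direction of a basis vector. -/
def shift (i : ι) (v : Ser ι V) : Ser ι V := fun l => v (i :: l)

@[simp] theorem shift_apply (i : ι) (v : Ser ι V) (l : List ι) : shift i v l = v (i :: l) := rfl

/-- Two series agree on all coefficients of order less than `n`. -/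
def Agree (n : ℕ) (v w : Ser ι V) : Prop := ∀ l : List ι, l.length < n → v l = w l

theorem Agree.shift {n : ℕ} {v w : Ser ι V} (h : Agree (n + 1) v w) (i : ι) :
    Agree n (shift i v) (shift i w) :=
  fun l hl => h (i :: l) (by simpa using hl)

theorem Agree.mono {m n : ℕ} {v w : Ser ι V} (h : Agree n v w) (hmn : m ≤ n) : Agree m v w :=
  fun l hl => h l (hl.trans_le hmn)

theorem Agree.trans {n : ℕ} {u v w : Ser ι V} (huv : Agree n u v) (hvw : Agree n v w) :
    Agree n u w :=
  fun l hl => (huv l hl).trans (hvw l hl)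

/-- A series is symmetric if its coefficients do not depend on the order of differentiation. -/
def Sym (v : Ser ι V) : Prop := ∀ l l' : List ι, l.Perm l' → v l = v l'

theorem Sym.shift {v : Ser ι V} (h : Sym v) (i : ι) : Sym (shift i v) :=
  fun _ _ hl => h _ _ (hl.cons i)

theorem Sym.shift_comm {v : Ser ι V} (h : Sym v) (i j : ι) :
    Ser.shift i (Ser.shift j v) = Ser.shift j (Ser.shift i v) :=
  funext fun l => h _ _ (List.Perm.swap i j l)

variable [AddCommGroup V'] [Module K V'] [AddCommGroup W'] [Module K W'] [AddCommGroup U']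
  [Module K U'] [AddCommGroup X] [Module K X] [AddCommGroup U] [Module K U]
  [AddCommGroup V] [Module K V] [AddCommGroup W] [Module K W]

/-- The constant series. -/
def const (c : V) : Ser ι V
  | [] => c
  | _ :: _ => 0

@[simp] theorem const_nil (c : V) : const (ι := ι) c [] = c := rfl
@[simp] theorem const_cons (c : V) (i : ι) (l : List ι) : const c (i :: l) = 0 := rfl
@[simp] theorem shift_const (i : ι) (c : V) : shift i (const c) = 0 := rfl
@[simp] theorem shift_add (i : ι) (v w : Ser ι V) : shift i (v + w) = shift i v + shift i w := rfl
@[simp] theorem shift_smul (i : ι) (c : K) (v : Ser ι V) : shift i (c • v) = c • shift i v := rfl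

theorem const_add (c c' : V) : const (ι := ι) (c + c') = const c + const c' := by
  funext l; cases l <;> simp

theorem const_smul (a : K) (c : V) : const (ι := ι) (a • c) = a • const c := by
  funext l; cases l <;> simp

/-- The constant series, linearly in the constant. -/
@[simps] def constL : V →ₗ[K] Ser ι V where
  toFun := const
  map_add' := const_add
  map_smul' := const_smul

/-- The coefficients of the product of two series with respect to a bilinear map, defined through
the Leibniz rule. -/
def convAux (β : V →ₗ[K] W →ₗ[K] U) : List ι → Ser ι V → Ser ι W → U
  | [], v, w => β (v []) (w [])
  | i :: l, v, w => convAux β l (shift i v) w + convAux β l v (shift i w)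

theorem convAux_add_left (β : V →ₗ[K] W →ₗ[K] U) (l : List ι) (v v' : Ser ι V) (w : Ser ι W) :
    convAux β l (v + v') w = convAux β l v w + convAux β l v' w := by
  induction l generalizing v v' w with
  | nil => simp [convAux]
  | cons i l ih => simp only [convAux, shift_add, ih]; abel

theorem convAux_add_right (β : V →ₗ[K] W →ₗ[K] U) (l : List ι) (v : Ser ι V) (w w' : Ser ι W) :
    convAux β l v (w + w') = convAux β l v w + convAux β l v w' := by
  induction l generalizing v w w' with
  | nil => simp [convAux]
  | cons i l ih => simp only [convAux, shift_add, ih]; abel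

theorem convAux_smul_left (β : V →ₗ[K] W →ₗ[K] U) (l : List ι) (c : K) (v : Ser ι V)
    (w : Ser ι W) : convAux β l (c • v) w = c • convAux β l v w := by
  induction l generalizing v w with
  | nil => simp [convAux]
  | cons i l ih => simp only [convAux, shift_smul, ih, smul_add]

theorem convAux_smul_right (β : V →ₗ[K] W →ₗ[K] U) (l : List ι) (c : K) (v : Ser ι V)
    (w : Ser ι W) : convAux β l v (c • w) = c • convAux β l v w := by
  induction l generalizing v w with
  | nil => simp [convAux]
  | cons i l ih => simp only [convAux, shift_smul, ih, smul_add]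

/-- The product of two series with respect to a bilinear map. -/
def conv (β : V →ₗ[K] W →ₗ[K] U) : Ser ι V →ₗ[K] Ser ι W →ₗ[K] Ser ι U :=
  LinearMap.mk₂ K (fun v w l => convAux β l v w)
    (fun v v' w => funext fun l => convAux_add_left β l v v' w)
    (fun c v w => funext fun l => convAux_smul_left β l c v w)
    (fun v w w' => funext fun l => convAux_add_right β l v w w')
    (fun c v w => funext fun l => convAux_smul_right β l c v w)

@[simp] theorem conv_nil (β : V →ₗ[K] W →ₗ[K] U) (v : Ser ι V) (w : Ser ι W) :
    conv β v w [] = β (v []) (w []) := rfl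

theorem conv_cons (β : V →ₗ[K] W →ₗ[K] U) (v : Ser ι V) (w : Ser ι W) (i : ι) (l : List ι) :
    conv β v w (i :: l) = conv β (shift i v) w l + conv β v (shift i w) l := rfl

theorem shift_conv (β : V →ₗ[K] W →ₗ[K] U) (v : Ser ι V) (w : Ser ι W) (i : ι) :
    shift i (conv β v w) = conv β (shift i v) w + conv β v (shift i w) := rfl

theorem conv_map {β : V →ₗ[K] W →ₗ[K] U} {β' : V' →ₗ[K] W' →ₗ[K] U'} (φ : U →ₗ[K] U')
    (S : V →ₗ[K] V') (T : W →ₗ[K] W') (h : ∀ v w, φ (β v w) = β' (S v) (T w)) (v : Ser ι V)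
    (w : Ser ι W) (l : List ι) :
    φ (conv β v w l) = conv β' (fun m => S (v m)) (fun m => T (w m)) l := by
  induction l generalizing v w with
  | nil => simp [h]
  | cons i l ih => rw [conv_cons, conv_cons, map_add, ih, ih]; rfl

theorem conv_flip {β : V →ₗ[K] W →ₗ[K] U} {β' : W →ₗ[K] V →ₗ[K] U} (c : K)
    (h : ∀ v w, β v w = c • β' w v) (v : Ser ι V) (w : Ser ι W) :
    conv β v w = c • conv β' w v := by
  funext l
  induction l generalizing v w with
  | nil => simp [h]
  | cons i l ih =>
    rw [conv_cons, ih, ih, Pi.smul_apply, Pi.smul_apply, Pi.smul_apply, conv_cons, smul_add,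
      add_comm]

theorem conv_const_right (β : V →ₗ[K] W →ₗ[K] U) (v : Ser ι V) (c : W) (l : List ι) :
    conv β v (const c) l = β (v l) c := by
  induction l generalizing v with
  | nil => simp
  | cons i l ih => rw [conv_cons, ih]; simp

theorem conv_const_const (β : V →ₗ[K] W →ₗ[K] U) (c : V) (c' : W) :
    conv β (const (ι := ι) c) (const c') = const (β c c') := by
  funext l
  rw [conv_const_right]
  cases l <;> simp

theorem Agree.conv_zero {β : V →ₗ[K] W →ₗ[K] U} {m n : ℕ} {v : Ser ι V} {w : Ser ι W}
    (hv : Agree m v 0) (hw : Agree n w 0) : Agree (m + n) (conv β v w) 0 := by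
  intro l hl
  induction l generalizing m n v w with
  | nil =>
    obtain h | h : 0 < m ∨ 0 < n := by simp at hl; omega
    · simp [hv [] h]
    · simp [hw [] h]
  | cons i l ih =>
    rw [List.length_cons] at hl
    have h1 : conv β (Ser.shift i v) w l = 0 := by
      obtain _ | m := m
      · exact ih (m := 0) (n := n) (fun k hk => absurd hk (by simp)) hw (by omega)
      · exact ih (hv.shift i) hw (by omega)
    have h2 : conv β v (Ser.shift i w) l = 0 := by
      obtain _ | n := n
      · exact ih (m := m) (n := 0) hv (fun k hk => absurd hk (by simp)) (by omega)
      · exact ih hv (hw.shift i) (by omega)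
    rw [conv_cons, h1, h2]
    simp

theorem Sym.add {v w : Ser ι V} (hv : Sym v) (hw : Sym w) : Sym (v + w) :=
  fun l l' h => congrArg₂ (· + ·) (hv l l' h) (hw l l' h)

theorem Sym.conv {β : V →ₗ[K] W →ₗ[K] U} {v : Ser ι V} {w : Ser ι W} (hv : Sym v) (hw : Sym w) :
    Sym (conv β v w) := by
  intro l l' h
  induction h generalizing v w with
  | nil => rfl
  | cons i _ ih => rw [conv_cons, conv_cons, ih (hv.shift i) hw, ih hv (hw.shift i)]
  | swap i j l =>
    simp only [conv_cons]
    rw [hv.shift_comm i j, hw.shift_comm i j]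
    abel
  | trans _ _ ih ih' => rw [ih hv hw, ih' hv hw]

section Deriv

variable [Fintype ι] (b : Module.Basis ι K X)

/-- The directional derivative. -/
noncomputable def pd (x : X) (v : Ser ι V) : Ser ι V := ∑ i, b.repr x i • shift i v

theorem pd_basis (i : ι) (v : Ser ι V) : pd b (b i) v = shift i v := by
  classical
  simp [pd, Finsupp.single_apply]

theorem pd_add_left (x x' : X) (v : Ser ι V) : pd b (x + x') v = pd b x v + pd b x' v := by
  simp [pd, add_smul, Finset.sum_add_distrib]

theorem pd_smul_left (c : K) (x : X) (v : Ser ι V) : pd b (c • x) v = c • pd b x v := by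
  simp [pd, mul_smul, Finset.smul_sum]

theorem pd_add (x : X) (v w : Ser ι V) : pd b x (v + w) = pd b x v + pd b x w := by
  simp [pd, Finset.sum_add_distrib]

theorem pd_smul (x : X) (c : K) (v : Ser ι V) : pd b x (c • v) = c • pd b x v := by
  simp [pd, Finset.smul_sum, smul_comm c]

/-- The directional derivative as a bilinear map. -/
noncomputable def pdL : X →ₗ[K] Ser ι V →ₗ[K] Ser ι V :=
  LinearMap.mk₂ K (pd b) (pd_add_left b) (pd_smul_left b) (pd_add b)
    fun c x v => pd_smul b x c v

@[simp] theorem pdL_apply (x : X) (v : Ser ι V) : pdL b x v = pd b x v := rfl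

@[simp] theorem pd_zero (x : X) : pd b x (0 : Ser ι V) = 0 := map_zero (pdL b x)

theorem pd_apply (x : X) (v : Ser ι V) (l : List ι) :
    pd b x v l = ∑ i, b.repr x i • v (i :: l) := by
  simp [pd]

@[simp] theorem pd_const (x : X) (c : V) : pd b x (const c) = 0 := by
  simp [pd]

theorem pd_conv (β : V →ₗ[K] W →ₗ[K] U) (x : X) (v : Ser ι V) (w : Ser ι W) :
    pd b x (conv β v w) = conv β (pd b x v) w + conv β v (pd b x w) := by
  simp only [pd, shift_conv, map_sum, LinearMap.sum_apply, map_smul, LinearMap.smul_apply,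
    smul_add, Finset.sum_add_distrib]

theorem pd_map (T : V →ₗ[K] W) (x : X) (v : Ser ι V) :
    pd b x (fun l => T (v l)) = fun l => T (pd b x v l) := by
  funext l
  simp [pd_apply]

theorem Sym.pd {v : Ser ι V} (h : Sym v) (x : X) : Sym (pd b x v) := fun l l' hl => by
  simp only [pd_apply]
  exact Finset.sum_congr rfl fun i _ => by rw [h _ _ (hl.cons i)]

theorem Agree.pd {n : ℕ} {v w : Ser ι V} (h : Agree (n + 1) v w) (x : X) :
    Agree n (pd b x v) (pd b x w) := fun l hl => by
  simp only [pd_apply]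
  exact Finset.sum_congr rfl fun i _ => by rw [h (i :: l) (by simpa using hl)]

/-- The coefficients of the action of a pair of endomorphisms of `V` and `X` on series. -/
noncomputable def actAux (ρ : V →ₗ[K] V) (r : X →ₗ[K] X) : List ι → Ser ι V → V
  | [], v => ρ (v [])
  | i :: l, v => actAux ρ r l (shift i v) - pd b (r (b i)) v l

/-- The action of a pair of endomorphisms of `V` and `X` on series, combining the action on
coefficients with minus the Lie derivative along the linear vector field on `X`. -/
noncomputable def act (ρ : V →ₗ[K] V) (r : X →ₗ[K] X) : Ser ι V →ₗ[K] Ser ι V where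
  toFun v l := actAux b ρ r l v
  map_add' v w := by
    funext l
    simp only [Pi.add_apply]
    induction l generalizing v w with
    | nil => simp [actAux]
    | cons i l ih => simp only [actAux, shift_add, ih, pd_add, Pi.add_apply]; abel
  map_smul' c v := by
    funext l
    simp only [Pi.smul_apply, RingHom.id_apply]
    induction l generalizing v with
    | nil => simp [actAux]
    | cons i l ih => simp only [actAux, shift_smul, ih, pd_smul, Pi.smul_apply, smul_sub]

@[simp] theorem act_nil (ρ : V →ₗ[K] V) (r : X →ₗ[K] X) (v : Ser ι V) :
    act b ρ r v [] = ρ (v []) := rfl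

theorem act_cons (ρ : V →ₗ[K] V) (r : X →ₗ[K] X) (v : Ser ι V) (i : ι) (l : List ι) :
    act b ρ r v (i :: l) = act b ρ r (shift i v) l - pd b (r (b i)) v l := rfl

theorem shift_act (ρ : V →ₗ[K] V) (r : X →ₗ[K] X) (v : Ser ι V) (i : ι) :
    shift i (act b ρ r v) = act b ρ r (shift i v) - pd b (r (b i)) v := rfl

theorem act_pd (ρ : V →ₗ[K] V) (r : X →ₗ[K] X) (x : X) (v : Ser ι V) :
    act b ρ r (pd b x v) = pd b x (act b ρ r v) + pd b (r x) v := by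
  have h (i : ι) : act b ρ r (shift i v) = shift i (act b ρ r v) + pd b (r (b i)) v := by
    rw [shift_act]; abel
  have hx : r x = ∑ i, b.repr x i • r (b i) := by
    conv_lhs => rw [← b.sum_repr x, map_sum]
    simp only [map_smul]
  conv_lhs => rw [pd]
  simp only [map_sum, map_smul, h, smul_add, Finset.sum_add_distrib]
  rw [hx, ← pdL_apply b (∑ i, _), map_sum]
  simp [pd]

theorem act_lie (ρ ρ' ρ'' : V →ₗ[K] V) (r r' r'' : X →ₗ[K] X)
    (hρ : ∀ v, ρ (ρ' v) = ρ'' v + ρ' (ρ v)) (hr : ∀ x, r (r' x) = r'' x + r' (r x)) (v : Ser ι V) :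
    act b ρ r (act b ρ' r' v) = act b ρ'' r'' v + act b ρ' r' (act b ρ r v) := by
  funext l
  rw [Pi.add_apply]
  induction l generalizing v with
  | nil => simp [hρ]
  | cons i l ih =>
    simp only [act_cons, shift_act, map_sub, Pi.sub_apply, ih, act_pd, Pi.add_apply]
    have h := congrFun (congrArg (fun x => pd b x v) (hr (b i))) l
    simp only [pd_add_left, Pi.add_apply] at h
    rw [h]
    abel

theorem act_conv {β : V →ₗ[K] W →ₗ[K] U} {ρ : U →ₗ[K] U} {ρ' : V →ₗ[K] V} {ρ'' : W →ₗ[K] W}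
    (r : X →ₗ[K] X) (h : ∀ v w, ρ (β v w) = β (ρ' v) w + β v (ρ'' w)) (v : Ser ι V) (w : Ser ι W) :
    act b ρ r (conv β v w) = conv β (act b ρ' r v) w + conv β v (act b ρ'' r w) := by
  funext l
  rw [Pi.add_apply]
  induction l generalizing v w with
  | nil => simp [h]
  | cons i l ih =>
    simp only [act_cons, shift_conv, map_add, Pi.add_apply, ih, pd_conv, conv_cons, shift_act,
      map_sub, Pi.sub_apply, LinearMap.sub_apply]
    abel

theorem act_map {ρ : V →ₗ[K] V} {ρ' : W →ₗ[K] W} (r : X →ₗ[K] X) (T : V →ₗ[K] W)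
    (h : ∀ v, T (ρ v) = ρ' (T v)) (v : Ser ι V) (l : List ι) :
    act b ρ' r (fun m => T (v m)) l = T (act b ρ r v l) := by
  induction l generalizing v with
  | nil => simp [h]
  | cons i l ih =>
    rw [act_cons, act_cons, map_sub, pd_map, ← ih]
    rfl

theorem act_const (ρ : V →ₗ[K] V) (r : X →ₗ[K] X) (c : V) :
    act b ρ r (const c) = const (ρ c) := by
  funext l
  cases l with
  | nil => simp
  | cons i l => simp [act_cons]

theorem Agree.act {n : ℕ} {v w : Ser ι V} (h : Agree n v w) (ρ : V →ₗ[K] V) (r : X →ₗ[K] X) :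
    Agree n (act b ρ r v) (act b ρ r w) := by
  intro l hl
  induction l generalizing n v w with
  | nil => simp [h [] hl]
  | cons i l ih =>
    obtain _ | n := n
    · simp at hl
    · have hl' : l.length < n := by simpa using hl
      rw [act_cons, act_cons, ih (h.shift i) hl', h.pd b _ l hl']

/-- The coefficients of the contraction of a family of series with a linear vector field. -/
noncomputable def ctrAux (r : X →ₗ[K] X) : List ι → (ι → Ser ι V) → V
  | [], _ => 0
  | j :: l, A => ∑ i, b.repr (r (b j)) i • A i l + ctrAux r l fun i => shift j (A i)

/-- The contraction of a family of series with the linear vector field on `X` defined by an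
endomorphism `r`. -/
noncomputable def ctr (r : X →ₗ[K] X) : (ι → Ser ι V) →ₗ[K] Ser ι V where
  toFun A l := ctrAux b r l A
  map_add' A B := by
    funext l
    simp only [Pi.add_apply]
    induction l generalizing A B with
    | nil => simp [ctrAux]
    | cons j l ih =>
      have := ih (fun i => shift j (A i)) (fun i => shift j (B i))
      simp only [ctrAux, Pi.add_apply, smul_add, Finset.sum_add_distrib]
      rw [add_add_add_comm, ← this]
      rfl
  map_smul' c A := by
    funext l
    simp only [Pi.smul_apply, RingHom.id_apply]
    induction l generalizing A with
    | nil => simp [ctrAux]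
    | cons j l ih =>
      have := ih (fun i => shift j (A i))
      simp only [ctrAux, Pi.smul_apply, smul_add, Finset.smul_sum, smul_comm c]
      rw [← this]
      rfl

@[simp] theorem ctr_nil (r : X →ₗ[K] X) (A : ι → Ser ι V) : ctr b r A [] = 0 := rfl

theorem ctr_cons (r : X →ₗ[K] X) (A : ι → Ser ι V) (j : ι) (l : List ι) : ctr b r A (j :: l) =
    ∑ i, b.repr (r (b j)) i • A i l + ctr b r (fun i => shift j (A i)) l := rfl

theorem shift_ctr (r : X →ₗ[K] X) (A : ι → Ser ι V) (j : ι) : shift j (ctr b r A) =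
    ∑ i, b.repr (r (b j)) i • A i + ctr b r fun i => shift j (A i) := by
  funext l
  simp [ctr_cons]

theorem ctr_conv (β : V →ₗ[K] W →ₗ[K] U) (r : X →ₗ[K] X) (v : Ser ι V) (A : ι → Ser ι W) :
    ctr b r (fun i => conv β v (A i)) = conv β v (ctr b r A) := by
  funext l
  induction l generalizing v A with
  | nil => simp
  | cons j l ih =>
    rw [ctr_cons, conv_cons, shift_ctr, map_add, map_sum]
    have : (fun i => shift j (conv β v (A i))) =
      (fun i => conv β (shift j v) (A i)) + fun i => conv β v (shift j (A i)) := rfl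
    rw [this, map_add]
    simp only [Pi.add_apply, ih, Finset.sum_apply, map_smul, Pi.smul_apply]
    abel

theorem ctr_shift {v : Ser ι V} (hv : Sym v) (ρ : V →ₗ[K] V) (r : X →ₗ[K] X) (l : List ι) :
    ctr b r (fun i => shift i v) l = ρ (v l) - act b ρ r v l := by
  induction l generalizing v with
  | nil => simp
  | cons j l ih =>
    rw [ctr_cons, act_cons]
    simp only [hv.shift_comm j]
    rw [ih (hv.shift j), pd_apply]
    simp only [shift_apply]
    abel

end Deriv

/-- A contracting map on a class of series stable under limits has a fixed point. -/
theorem exists_fixedPoint (C : Set (Ser ι V)) (Ψ : Ser ι V → Ser ι V) (h0 : 0 ∈ C)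
    (hC : ∀ v ∈ C, Ψ v ∈ C)
    (hlim : ∀ v, (∀ n, ∃ w ∈ C, Agree n v w) → v ∈ C)
    (hΨ : ∀ n, ∀ v ∈ C, ∀ w ∈ C, Agree n v w → Agree (n + 1) (Ψ v) (Ψ w)) :
    ∃ v ∈ C, Ψ v = v := by
  have hmem (n : ℕ) : Ψ^[n] 0 ∈ C := by
    induction n with
    | zero => exact h0
    | succ n ih => rw [Function.iterate_succ_apply']; exact hC _ ih
  have hstep (n : ℕ) : Agree n (Ψ^[n + 1] 0) (Ψ^[n] 0) := by
    induction n with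
    | zero => exact fun l hl => absurd hl (by simp)
    | succ n ih =>
      have := hΨ n _ (hmem (n + 1)) _ (hmem n) ih
      rwa [← Function.iterate_succ_apply' Ψ, ← Function.iterate_succ_apply' Ψ] at this
  have hstable (n k : ℕ) : Agree n (Ψ^[n + k] 0) (Ψ^[n] 0) := by
    induction k with
    | zero => exact fun l _ => rfl
    | succ k ih => exact ((hstep (n + k)).mono (by omega)).trans ih
  let g : Ser ι V := fun l => Ψ^[l.length + 1] 0 l
  have hg (n : ℕ) : Agree n g (Ψ^[n] 0) := by
    intro l hl
    obtain ⟨k, rfl⟩ := Nat.exists_eq_add_of_lt hl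
    rw [add_right_comm]
    exact (hstable (l.length + 1) k l (by omega)).symm
  have hgC : g ∈ C := hlim g fun n => ⟨_, hmem n, hg n⟩
  refine ⟨g, hgC, funext fun l => ?_⟩
  rw [hΨ l.length g hgC _ (hmem _) (hg _) l (by omega), hg (l.length + 1) l (by omega),
    Function.iterate_succ_apply']

end Ser

/-- The data of a Lie algebra `g` acting on a finite dimensional symplectic space `X` and on a
space `E` with an invariant skew-symmetric form, together with an invariant symmetric bilinear map
`γ` on `X × E` with values in `E`. -/
structure SymplecticModel (K : Type) [Field K] : Type 1 where
  g : Type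
  X : Type
  E : Type
  [acg_g : AddCommGroup g]
  [acg_X : AddCommGroup X]
  [acg_E : AddCommGroup E]
  [mod_g : Module K g]
  [mod_X : Module K X]
  [mod_E : Module K E]
  brg : g →ₗ[K] g →ₗ[K] g
  ρX : g →ₗ[K] X →ₗ[K] X
  ρE : g →ₗ[K] E →ₗ[K] E
  ωX : X →ₗ[K] X →ₗ[K] K
  ωE : E →ₗ[K] E →ₗ[K] K
  γ : (X × E) →ₗ[K] (X × E) →ₗ[K] E
  brg_skew : ∀ x y, brg x y = -brg y x
  brg_jacobi : ∀ x y z, brg x (brg y z) = brg (brg x y) z + brg y (brg x z)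
  ρX_lie : ∀ x y z, ρX x (ρX y z) = ρX (brg x y) z + ρX y (ρX x z)
  ρE_lie : ∀ x y z, ρE x (ρE y z) = ρE (brg x y) z + ρE y (ρE x z)
  ωX_skew : ∀ x y, ωX x y = -ωX y x
  ωE_skew : ∀ x y, ωE x y = -ωE y x
  ωX_inv : ∀ y v w, ωX (ρX y v) w + ωX v (ρX y w) = 0
  ωE_inv : ∀ y v w, ωE (ρE y v) w + ωE v (ρE y w) = 0
  ωX_bij : Function.Bijective ωX
  γ_symm : ∀ v w, γ v w = γ w v
  γ_inv : ∀ y v w, ρE y (γ v w) =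
    γ (ρX y v.1, ρE y v.2) w + γ v (ρX y w.1, ρE y w.2)

attribute [instance] SymplecticModel.acg_g SymplecticModel.acg_X SymplecticModel.acg_E
  SymplecticModel.mod_g SymplecticModel.mod_X SymplecticModel.mod_E

namespace SymplecticModel

variable (M : SymplecticModel K)

/-- The action of `g` on `X × E`. -/
def ρ : M.g →ₗ[K] (M.X × M.E) →ₗ[K] (M.X × M.E) :=
  LinearMap.mk₂ K (fun y v => (M.ρX y v.1, M.ρE y v.2)) (by simp) (by simp) (by simp) (by simp)

@[simp] theorem ρ_apply (y : M.g) (v : M.X × M.E) : M.ρ y v = (M.ρX y v.1, M.ρE y v.2) := rfl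

/-- The skew-symmetric form on `X × E`. -/
def Ω : (M.X × M.E) →ₗ[K] (M.X × M.E) →ₗ[K] K :=
  LinearMap.mk₂ K (fun v w => M.ωX v.1 w.1 + M.ωE v.2 w.2)
    (by intros; simp; ring) (by intros; simp; ring) (by intros; simp; ring) (by intros; simp; ring)

@[simp] theorem Ω_apply (v w : M.X × M.E) : M.Ω v w = M.ωX v.1 w.1 + M.ωE v.2 w.2 := rfl

theorem Ω_skew (v w : M.X × M.E) : M.Ω v w = -M.Ω w v := by
  rw [Ω_apply, Ω_apply, M.ωX_skew, M.ωE_skew]; ring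

theorem Ω_inv (y : M.g) (v w : M.X × M.E) : M.Ω (M.ρ y v) w + M.Ω v (M.ρ y w) = 0 := by
  have h1 := M.ωX_inv y v.1 w.1
  have h2 := M.ωE_inv y v.2 w.2
  simp only [Ω_apply, ρ_apply]
  linear_combination h1 + h2

theorem ρ_lie (x y : M.g) (v : M.X × M.E) :
    M.ρ x (M.ρ y v) = M.ρ (M.brg x y) v + M.ρ y (M.ρ x v) :=
  Prod.ext (M.ρX_lie _ _ _) (M.ρE_lie _ _ _)

/-- The coadjoint action. -/
def coad : M.g →ₗ[K] Module.Dual K M.g →ₗ[K] Module.Dual K M.g :=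
  LinearMap.mk₂ K (fun y u => -(u ∘ₗ M.brg y))
    (by intros; ext; simp; ring) (by intros; ext; simp) (by intros; ext; simp; ring)
    (by intros; ext; simp)

@[simp] theorem coad_apply (y : M.g) (u : Module.Dual K M.g) (z : M.g) :
    M.coad y u z = -u (M.brg y z) := rfl

theorem coad_lie (x y : M.g) (u : Module.Dual K M.g) :
    M.coad x (M.coad y u) = M.coad (M.brg x y) u + M.coad y (M.coad x u) := by
  ext z
  simp [M.brg_jacobi x y z]

/-- The (polarized) moment map of `X × E`. -/
def mom : (M.X × M.E) →ₗ[K] (M.X × M.E) →ₗ[K] Module.Dual K M.g :=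
  LinearMap.mk₂ K (fun v w => -(M.Ω v ∘ₗ M.ρ.flip w))
    (by intros; ext; simp; ring) (by intros; ext; simp) (by intros; ext; simp; ring)
    (by intros; ext; simp; ring)

theorem mom_apply (v w : M.X × M.E) (y : M.g) : M.mom v w y = -M.Ω v (M.ρ y w) := rfl

theorem mom_symm (v w : M.X × M.E) : M.mom v w = M.mom w v := by
  ext y
  rw [mom_apply, mom_apply, M.Ω_skew v]
  linear_combination M.Ω_inv y w v

theorem mom_inv (y : M.g) (v w : M.X × M.E) :
    M.coad y (M.mom v w) = M.mom (M.ρ y v) w + M.mom v (M.ρ y w) := by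
  ext z
  rw [coad_apply, LinearMap.add_apply, mom_apply, mom_apply, mom_apply]
  have h1 := M.Ω_inv y v (M.ρ z w)
  have h2 := congrArg (M.Ω v) (M.ρ_lie y z w)
  rw [map_add] at h2
  linear_combination h1 - h2

/-- The bracket on degree one elements of the model. -/
def β : (M.X × M.E) →ₗ[K] (M.X × M.E) →ₗ[K] (Module.Dual K M.g × M.E) :=
  LinearMap.mk₂ K (fun v w => (M.mom v w, M.γ v w)) (by simp) (by simp) (by simp) (by simp)

@[simp] theorem β_apply (v w : M.X × M.E) : M.β v w = (M.mom v w, M.γ v w) := rfl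

/-- The action on degree two elements of the model. -/
def ρ₂ : M.g →ₗ[K] (Module.Dual K M.g × M.E) →ₗ[K] (Module.Dual K M.g × M.E) :=
  LinearMap.mk₂ K (fun y v => (M.coad y v.1, M.ρE y v.2)) (by simp) (by simp) (by simp) (by simp)

@[simp] theorem ρ₂_apply (y : M.g) (v : Module.Dual K M.g × M.E) :
    M.ρ₂ y v = (M.coad y v.1, M.ρE y v.2) := rfl

theorem ρ₂_lie (x y : M.g) (v : Module.Dual K M.g × M.E) :
    M.ρ₂ x (M.ρ₂ y v) = M.ρ₂ (M.brg x y) v + M.ρ₂ y (M.ρ₂ x v) :=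
  Prod.ext (M.coad_lie _ _ _) (M.ρE_lie _ _ _)

theorem β_symm (v w : M.X × M.E) : M.β v w = M.β w v :=
  Prod.ext (M.mom_symm v w) (M.γ_symm v w)

theorem β_inv (y : M.g) (v w : M.X × M.E) :
    M.ρ₂ y (M.β v w) = M.β (M.ρ y v) w + M.β v (M.ρ y w) :=
  Prod.ext (M.mom_inv y v w) (M.γ_inv y v w)

/-- The differential of the model. -/
def δ : (M.X × M.E) →ₗ[K] (Module.Dual K M.g × M.E) :=
  LinearMap.prod 0 (LinearMap.snd K M.X M.E)

@[simp] theorem δ_apply (v : M.X × M.E) : M.δ v = (0, v.2) := rfl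

/-- The four-term DG-Lie algebra with pieces `g`, `X × E`, `g* × E`. -/
def model : FourTermLie K where
  M₀ := M.g
  M₁ := M.X × M.E
  M₂ := Module.Dual K M.g × M.E
  M₃ := PUnit
  b₀₀ := M.brg
  b₀₁ := M.ρ
  b₀₂ := M.ρ₂
  b₀₃ := 0
  b₁₁ := M.β
  b₁₂ := 0
  d₁ := M.δ
  d₂ := 0
  skew₀₀ := M.brg_skew
  symm₁₁ := M.β_symm
  jacobi₀₀₀ := M.brg_jacobi
  jacobi₀₀₁ := M.ρ_lie
  jacobi₀₀₂ := M.ρ₂_lie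
  jacobi₀₀₃ _ _ _ := rfl
  jacobi₀₁₁ := M.β_inv
  jacobi₀₁₂ _ _ _ := rfl
  jacobi₁₁₁ _ _ _ := rfl
  d₁_b₀₁ _ _ := by simp
  d₂_b₀₂ _ _ := rfl
  d₂_b₁₁ _ _ := rfl
  d₂_d₁ _ := rfl

/-- The bracket on `X` with values in `g*`. -/
def brX : M.X →ₗ[K] M.X →ₗ[K] Module.Dual K M.g :=
  M.mom.compl₁₂ (LinearMap.inl K M.X M.E) (LinearMap.inl K M.X M.E)

theorem brX_apply (x x' : M.X) : M.brX x x' = M.mom (x, 0) (x', 0) := rfl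

theorem brX_symm (x x' : M.X) : M.brX x x' = M.brX x' x := M.mom_symm _ _

theorem brX_inv (y : M.g) (x x' : M.X) :
    M.coad y (M.brX x x') = M.brX (M.ρX y x) x' + M.brX x (M.ρX y x') := by
  rw [brX_apply, mom_inv]
  simp [brX_apply]

open Ser

variable {ι : Type} (b : Module.Basis ι K M.X)

/-- The tautological linear series on `X`. -/
noncomputable def ids : Ser ι (M.X × M.E)
  | [] => 0
  | [i] => (b i, 0)
  | _ :: _ :: _ => 0

theorem shift_ids (i : ι) : shift i (M.ids b) = const (b i, 0) := by
  funext l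
  cases l <;> rfl

theorem sym_ids : Sym (M.ids b) := by
  intro l l' h
  match l, l', h.length_eq, h with
  | [], [], _, _ => rfl
  | [i], [j], _, h => rw [List.perm_singleton.1 h]
  | _ :: _ :: _, _ :: _ :: _, _, _ => rfl

theorem agree_ids : Agree 1 (M.ids b) 0 := fun l hl => by
  obtain rfl : l = [] := List.length_eq_zero_iff.1 (by omega)
  rfl

theorem agree_ids_add {G : Ser ι (M.X × M.E)} (hG : Agree 2 G 0) : Agree 1 (M.ids b + G) 0 :=
  fun l hl => by
    rw [Pi.add_apply, M.agree_ids b l hl, hG l (by omega)]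
    simp

variable [Fintype ι]

theorem pd_ids (x : M.X) : pd b x (M.ids b) = const (x, 0) := by
  have h (i : ι) : b.repr x i • const (ι := ι) ((b i, 0) : M.X × M.E) =
      constL (K := K) (ι := ι) (LinearMap.inl K M.X M.E (b.repr x i • b i)) := by
    rw [map_smul, map_smul]; rfl
  rw [pd]
  simp only [shift_ids, h]
  rw [← map_sum, ← map_sum, b.sum_repr]
  rfl

theorem act_ids (y : M.g) : act b (M.ρ y) (M.ρX y) (M.ids b) = 0 := by
  funext l
  cases l with
  | nil => exact map_zero (M.ρ y)
  | cons i l =>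
    rw [act_cons, shift_ids, act_const, pd_ids]
    simp

/-- The functional whose symplectic gradient defines the `X`-component of the normal form map. -/
noncomputable def potential (G : Ser ι (M.X × M.E)) (l : List ι) : Module.Dual K M.X :=
  -(2 : K)⁻¹ • (LinearMap.proj l ∘ₗ conv M.Ω G ∘ₗ (pdL b).flip G)

theorem potential_apply (G : Ser ι (M.X × M.E)) (l : List ι) (x : M.X) :
    M.potential b G l x = -(2 : K)⁻¹ * conv M.Ω G (pd b x G) l := rfl

/-- The operator whose fixed point is the nonlinear part of the normal form map. -/
noncomputable def step (G : Ser ι (M.X × M.E)) : Ser ι (M.X × M.E) := fun l =>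
  ((LinearEquiv.ofBijective M.ωX M.ωX_bij).symm (M.potential b G l),
    -(2 : K)⁻¹ • conv M.γ (M.ids b + G) (M.ids b + G) l)

theorem ωX_step (G : Ser ι (M.X × M.E)) (l : List ι) (x : M.X) :
    M.ωX (M.step b G l).1 x = -(2 : K)⁻¹ * conv M.Ω G (pd b x G) l := by
  rw [← potential_apply]
  exact congrArg (fun u : Module.Dual K M.X => u x)
    ((LinearEquiv.ofBijective M.ωX M.ωX_bij).apply_symm_apply (M.potential b G l))

theorem step_snd (G : Ser ι (M.X × M.E)) (l : List ι) :
    (M.step b G l).2 = -(2 : K)⁻¹ • conv M.γ (M.ids b + G) (M.ids b + G) l := rfl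

theorem ωX_injective {x x' : M.X} (h : ∀ z, M.ωX x z = M.ωX x' z) : x = x' :=
  M.ωX_bij.1 (LinearMap.ext h)

/-- The class of admissible nonlinear parts: symmetric invariant series of order at least two. -/
def admissible : Set (Ser ι (M.X × M.E)) :=
  {G | Agree 2 G 0 ∧ Sym G ∧ ∀ y, act b (M.ρ y) (M.ρX y) G = 0}

theorem agree_pd_zero {G : Ser ι (M.X × M.E)} {m : ℕ} (hG : Agree (m + 1) G 0) (x : M.X) :
    Agree m (pd b x G) 0 := by
  have := hG.pd b x
  rwa [pd_zero] at this

theorem agree_step {n : ℕ} {G G' : Ser ι (M.X × M.E)} (hG : Agree 2 G 0) (hG' : Agree 2 G' 0)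
    (h : Agree n G G') : Agree (n + 1) (M.step b G) (M.step b G') := by
  have hsub : Agree n (G - G') 0 := fun l hl => sub_eq_zero.2 (h l hl)
  intro l hl
  refine Prod.ext (M.ωX_injective fun x => ?_) ?_
  · rw [ωX_step, ωX_step]
    congr 1
    have h1 : conv M.Ω (G - G') (pd b x G) l = 0 :=
      (hsub.conv_zero (M.agree_pd_zero b (m := 1) hG x)) l hl
    have h2 : conv M.Ω G' (pd b x (G - G')) l = 0 := by
      obtain _ | n := n
      · exact (hG'.conv_zero (n := 0) (fun k hk => absurd hk (by simp))) l (by omega)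
      · exact (hG'.conv_zero (M.agree_pd_zero b hsub x)) l (by omega)
    rw [← pdL_apply, map_sub, pdL_apply, pdL_apply, map_sub] at h2
    rw [map_sub] at h1
    have h3 := congrArg₂ (· + ·) h1 h2
    simp only [LinearMap.sub_apply, Pi.sub_apply] at h3
    linear_combination h3
  · rw [step_snd, step_snd]
    congr 1
    have h1 : conv M.γ (G - G') (M.ids b + G) l = 0 := (hsub.conv_zero (M.agree_ids_add b hG)) l hl
    have h2 : conv M.γ (M.ids b + G') (G - G') l = 0 :=
      ((M.agree_ids_add b hG').conv_zero hsub) l (by omega)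
    have h3 : conv M.γ (M.ids b + G) (M.ids b + G) = conv M.γ (M.ids b + G') (M.ids b + G') +
        (conv M.γ (G - G') (M.ids b + G) + conv M.γ (M.ids b + G') (G - G')) := by
      simp only [map_sub, map_add, LinearMap.sub_apply, LinearMap.add_apply]
      abel
    rw [h3, Pi.add_apply, Pi.add_apply, h1, h2, add_zero, add_zero]

theorem conv_ωX_step (G : Ser ι (M.X × M.E)) (x : M.X) :
    conv M.ωX (fun l => (M.step b G l).1) (const x) = -(2 : K)⁻¹ • conv M.Ω G (pd b x G) := by
  funext l
  rw [conv_const_right, ωX_step]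
  rfl

theorem act_step {G : Ser ι (M.X × M.E)} {y : M.g} (hG : act b (M.ρ y) (M.ρX y) G = 0) :
    act b (M.ρ y) (M.ρX y) (M.step b G) = 0 := by
  have hΩ (v w : M.X × M.E) : (0 : K →ₗ[K] K) (M.Ω v w) = M.Ω (M.ρ y v) w + M.Ω v (M.ρ y w) :=
    (M.Ω_inv y v w).symm
  have hω (v w : M.X) : (0 : K →ₗ[K] K) (M.ωX v w) = M.ωX (M.ρX y v) w + M.ωX v (M.ρX y w) :=
    (M.ωX_inv y v w).symm
  funext l
  refine Prod.ext ?_ ?_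
  · have h1 : (act b (M.ρ y) (M.ρX y) (M.step b G) l).1 =
        act b (M.ρX y) (M.ρX y) (fun l => (M.step b G l).1) l :=
      (act_map b (M.ρX y) (LinearMap.fst K M.X M.E) (fun _ => rfl) (M.step b G) l).symm
    rw [h1]
    refine M.ωX_injective fun x => ?_
    have h2 := act_conv b (M.ρX y) hω (fun l => (M.step b G l).1) (const x)
    rw [act_const, conv_ωX_step, conv_ωX_step, map_smul, act_conv b (M.ρX y) hΩ, hG, act_pd, hG,
      pd_zero, map_zero, LinearMap.zero_apply, zero_add, zero_add] at h2
    have h3 := congrFun h2 l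
    rw [Pi.add_apply, conv_const_right] at h3
    rw [Pi.zero_apply, Prod.fst_zero, map_zero, LinearMap.zero_apply]
    linear_combination -h3
  · have h1 : (act b (M.ρ y) (M.ρX y) (M.step b G) l).2 =
        act b (M.ρE y) (M.ρX y) (fun l => (M.step b G l).2) l :=
      (act_map b (M.ρX y) (LinearMap.snd K M.X M.E) (fun _ => rfl) (M.step b G) l).symm
    have h2 : (fun l => (M.step b G l).2) =
        -(2 : K)⁻¹ • conv M.γ (M.ids b + G) (M.ids b + G) := rfl
    have h3 : act b (M.ρ y) (M.ρX y) (M.ids b + G) = 0 := by rw [map_add, act_ids, hG, add_zero]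
    rw [h1, h2, map_smul, act_conv b (M.ρX y) (M.γ_inv y) (ρ' := M.ρ y) (ρ'' := M.ρ y), h3]
    simp

theorem step_mem_admissible {G : Ser ι (M.X × M.E)} (hG : G ∈ M.admissible b) :
    M.step b G ∈ M.admissible b := by
  obtain ⟨h1, h2, h3⟩ := hG
  refine ⟨?_, ?_, fun y => M.act_step b (h3 y)⟩
  · intro l hl
    refine Prod.ext (M.ωX_injective fun x => ?_) ?_
    · rw [ωX_step, (h1.conv_zero (M.agree_pd_zero b h1 x)) l (by omega)]
      simp
    · rw [step_snd, ((M.agree_ids_add b h1).conv_zero (M.agree_ids_add b h1)) l hl]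
      simp
  · intro l l' hl
    refine Prod.ext (M.ωX_injective fun x => ?_) ?_
    · rw [ωX_step, ωX_step, (h2.conv (h2.pd b x)) l l' hl]
    · rw [step_snd, step_snd, (((M.sym_ids b).add h2).conv ((M.sym_ids b).add h2)) l l' hl]

/-- The nonlinear part of the normal form map exists. -/
theorem exists_step_fixedPoint : ∃ G ∈ M.admissible b, M.step b G = G := by
  refine exists_fixedPoint (M.admissible b) (M.step b) ⟨fun _ _ => rfl, fun _ _ _ => rfl,
    fun y => map_zero _⟩ (fun v hv => M.step_mem_admissible b hv) ?_
    (fun n v hv w hw h => M.agree_step b hv.1 hw.1 h)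
  intro v hv
  refine ⟨?_, ?_, ?_⟩
  · obtain ⟨w, hw, h⟩ := hv 2
    exact h.trans hw.1
  · intro l l' hl
    obtain ⟨w, hw, h⟩ := hv (l.length + 1)
    rw [h l (by omega), h l' (by rw [hl.length_eq]; omega), hw.2.1 l l' hl]
  · intro y
    funext l
    obtain ⟨w, hw, h⟩ := hv (l.length + 1)
    rw [h.act b _ _ l (by omega), hw.2.2 y]

theorem conv_ids_add {G : Ser ι (M.X × M.E)} (hG : M.step b G = G) [CharZero K] (x : M.X) :
    conv M.Ω (M.ids b + G) (pd b x (M.ids b + G)) =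
      conv M.Ω (M.ids b) (pd b x (M.ids b)) + pd b x (conv M.Ω (M.ids b) G) := by
  have h1 : conv M.Ω G (const (x, 0)) = -(2 : K)⁻¹ • conv M.Ω G (pd b x G) := by
    rw [← conv_ωX_step, hG]
    funext l
    rw [conv_const_right, conv_const_right]
    simp
  have h2 : conv M.Ω (const (x, 0)) G = (-1 : K) • conv M.Ω G (const (x, 0)) :=
    conv_flip (-1) (fun v w => by rw [M.Ω_skew]; simp) _ _
  rw [pd_conv, pd_add, pd_ids, map_add (conv M.Ω), map_add, LinearMap.add_apply,
    LinearMap.add_apply, h2, h1]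
  module

theorem conv_ids_add_ρ {G : Ser ι (M.X × M.E)} (hG : M.step b G = G) (hG' : G ∈ M.admissible b)
    [CharZero K] (y : M.g) :
    conv M.Ω (M.ids b + G) (fun l => M.ρ y ((M.ids b + G) l)) =
      conv M.Ω (M.ids b) (fun l => M.ρ y (M.ids b l)) := by
  have hids := M.sym_ids b
  have hΩ (v w : M.X × M.E) : (0 : K →ₗ[K] K) (M.Ω v w) = M.Ω (M.ρ y v) w + M.Ω v (M.ρ y w) :=
    (M.Ω_inv y v w).symm
  have hctr {f : Ser ι (M.X × M.E)} (hf : Sym f) (hf' : act b (M.ρ y) (M.ρX y) f = 0) :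
      ctr b (M.ρX y) (fun i => shift i f) = fun l => M.ρ y (f l) := by
    funext l
    rw [ctr_shift b hf (M.ρ y), hf']
    simp
  have h1 : ctr b (M.ρX y) (fun i => shift i (conv M.Ω (M.ids b) G)) = 0 := by
    funext l
    rw [ctr_shift b (hids.conv hG'.2.1) 0, act_conv b (M.ρX y) hΩ, M.act_ids, hG'.2.2 y]
    simp
  rw [← hctr (hids.add hG'.2.1) (by rw [map_add, M.act_ids, hG'.2.2 y, add_zero]),
    ← hctr hids (M.act_ids b y), ← ctr_conv, ← ctr_conv]
  have h2 : (fun i => conv M.Ω (M.ids b + G) (shift i (M.ids b + G))) =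
      (fun i => conv M.Ω (M.ids b) (shift i (M.ids b))) +
        fun i => shift i (conv M.Ω (M.ids b) G) := by
    funext i
    have h := M.conv_ids_add b hG (b i)
    rwa [pd_basis, pd_basis, pd_basis] at h
  rw [h2, map_add, h1, add_zero]

/-- The normal form map: a series `f` tangent to the inclusion of `X` that is invariant and
solves the Maurer-Cartan equation up to the quadratic moment map of `X`. -/
theorem exists_normalForm [CharZero K] : ∃ f : Ser ι (M.X × M.E), f [] = 0 ∧
    (∀ x, pd b x f [] = (x, 0)) ∧ (∀ y, act b (M.ρ y) (M.ρX y) f = 0) ∧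
    ∀ x x', pd b x ((fun l => M.δ (pd b x' f l)) + conv M.β f (pd b x' f)) =
      const (M.brX x x', 0) := by
  obtain ⟨G, hG', hG⟩ := M.exists_step_fixedPoint b
  set f := M.ids b + G with hf
  refine ⟨f, ?_, fun x => ?_, fun y => ?_, fun x x' => ?_⟩
  · exact M.agree_ids_add b hG'.1 [] (by simp)
  · rw [hf, pd_add, pd_ids, Pi.add_apply, M.agree_pd_zero b (m := 1) hG'.1 x [] (by simp)]
    simp
  · rw [hf, map_add, M.act_ids, hG'.2.2 y, add_zero]
  · have hmom : conv M.mom f f = conv M.mom (M.ids b) (M.ids b) := by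
      funext l
      ext y
      have key (w : Ser ι (M.X × M.E)) : conv M.mom w w l y =
          -conv M.Ω w (fun m => M.ρ y (w m)) l := by
        have := conv_map (β := M.mom) (β' := M.Ω) (-LinearMap.applyₗ y) LinearMap.id (M.ρ y)
          (fun v w => by simp [mom_apply]) w w l
        rw [eq_neg_iff_add_eq_zero, ← sub_eq_zero.2 this.symm]
        simp [add_comm]
      rw [key, key, M.conv_ids_add_ρ b hG hG' y]
    have hsnd (l : List ι) : (f l).2 = -(2 : K)⁻¹ • conv M.γ f f l := by
      have h1 : (M.ids b l).2 = 0 := by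
        match l with
        | [] => rfl
        | [i] => rfl
        | _ :: _ :: _ => rfl
      rw [← step_snd, hG, hf, Pi.add_apply, Prod.snd_add, h1, zero_add]
    have hβ (l : List ι) : conv M.β f f l = (conv M.mom f f l, conv M.γ f f l) :=
      Prod.ext
        (conv_map (β := M.β) (β' := M.mom) (LinearMap.fst K _ _) LinearMap.id LinearMap.id
          (fun _ _ => rfl) f f l)
        (conv_map (β := M.β) (β' := M.γ) (LinearMap.snd K _ _) LinearMap.id LinearMap.id
          (fun _ _ => rfl) f f l)
    have master : (fun l => M.δ (f l)) + (2 : K)⁻¹ • conv M.β f f =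
        (2 : K)⁻¹ • fun l => LinearMap.inl K _ M.E (conv M.mom (M.ids b) (M.ids b) l) := by
      funext l
      rw [Pi.add_apply, Pi.smul_apply, Pi.smul_apply, hβ, hmom, δ_apply, hsnd]
      refine Prod.ext ?_ ?_
      · simp
      · simp
    have hD : (fun l => M.δ (pd b x' f l)) + conv M.β f (pd b x' f) =
        fun l => LinearMap.inl K _ M.E (conv M.mom (M.ids b) (const (x', 0)) l) := by
      have h := congrArg (pd b x') master
      have hmomflip : conv M.mom (const (x', 0)) (M.ids b) =
          (1 : K) • conv M.mom (M.ids b) (const (x', 0)) :=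
        conv_flip 1 (fun v w => by rw [M.mom_symm, one_smul]) _ _
      have hβflip : conv M.β (pd b x' f) f = (1 : K) • conv M.β f (pd b x' f) :=
        conv_flip 1 (fun v w => by rw [M.β_symm, one_smul]) _ _
      rw [pd_add, pd_smul, pd_smul, pd_map, pd_map, pd_conv, pd_conv, pd_ids, hmomflip, hβflip,
        one_smul, one_smul, ← two_smul K, ← two_smul K, inv_smul_smul₀ two_ne_zero] at h
      rw [h]
      funext l
      rw [Pi.smul_apply, Pi.smul_apply, map_smul, inv_smul_smul₀ two_ne_zero]
    rw [hD, pd_map, pd_conv, pd_ids, pd_const, map_zero, add_zero, conv_const_const]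
    funext l
    cases l with
    | nil => rfl
    | cons i l => exact map_zero (LinearMap.inl K _ M.E)

end SymplecticModel

/-- The linear operator `p ↦ (X p)'` on polynomials. -/
noncomputable def polyScale (K : Type) [Field K] : Polynomial K →ₗ[K] Polynomial K :=
  Polynomial.derivative ∘ₗ LinearMap.mulLeft K Polynomial.X

theorem polyScale_apply (p : Polynomial K) :
    polyScale K p = Polynomial.derivative (Polynomial.X * p) := rfl

theorem polyScale_one : polyScale K 1 = 1 := by simp [polyScale_apply]

theorem polyScale_X : polyScale K Polynomial.X = (2 : K) • Polynomial.X := by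
  simp only [polyScale_apply, Polynomial.derivative_mul, Polynomial.derivative_X, two_smul]
  ring

theorem polyScale_mul (p q : Polynomial K) : polyScale K (Polynomial.X * (p * q)) =
    Polynomial.X * (polyScale K p * q + p * polyScale K q) := by
  simp only [polyScale_apply, Polynomial.derivative_mul, Polynomial.derivative_X]
  ring

theorem polyScale_bijective [CharZero K] : Function.Bijective (polyScale K) := by
  have hc (p : Polynomial K) (n : ℕ) : (polyScale K p).coeff n = p.coeff n * (n + 1) := by
    rw [polyScale_apply, Polynomial.coeff_derivative, Polynomial.coeff_X_mul]
  have hn (n : ℕ) : (n + 1 : K) ≠ 0 := by exact_mod_cast n.succ_ne_zero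
  refine ⟨fun p q h => ?_, fun p => ?_⟩
  · ext n
    have := congrArg (fun r => Polynomial.coeff r n) h
    simp only [hc] at this
    exact mul_right_cancel₀ (hn n) this
  · induction p using Polynomial.induction_on' with
    | add p q hp hq =>
      obtain ⟨p', rfl⟩ := hp
      obtain ⟨q', rfl⟩ := hq
      exact ⟨p' + q', map_add _ _ _⟩
    | monomial n a =>
      refine ⟨Polynomial.monomial n (a / (n + 1)), ?_⟩
      ext m
      rw [hc, Polynomial.coeff_monomial, Polynomial.coeff_monomial]
      split_ifs with h
      · subst h
        exact div_mul_cancel₀ _ (hn n)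
      · simp

namespace PolyTensor

open TensorProduct Polynomial

/-- Polynomials with coefficients in a vector space. -/
abbrev Poly (K V : Type) [Field K] [AddCommGroup V] [Module K V] : Type := K[X] ⊗[K] V

variable {V' W' X U V W : Type}
  [AddCommGroup V'] [Module K V'] [AddCommGroup W'] [Module K W'] [AddCommGroup X] [Module K X]
  [AddCommGroup U] [Module K U] [AddCommGroup V] [Module K V] [AddCommGroup W] [Module K W]

/-- The constant polynomial. -/
noncomputable def cst : V →ₗ[K] Poly K V := TensorProduct.mk K K[X] V 1

/-- Coefficientwise application of a family of linear maps. -/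
noncomputable def coeffs (T : U →ₗ[K] V →ₗ[K] W) : U →ₗ[K] Poly K V →ₗ[K] Poly K W :=
  LinearMap.lTensorHom K[X] ∘ₗ T

/-- Multiplication by the variable. -/
noncomputable def mulT : Poly K V →ₗ[K] Poly K V :=
  LinearMap.rTensor V (LinearMap.mulLeft K (Polynomial.X : K[X]))

/-- The operator sending `p` to the derivative of `t p`. -/
noncomputable def scale : Poly K V →ₗ[K] Poly K V := LinearMap.rTensor V (polyScale K)

/-- Evaluation at `1`. -/
noncomputable def evalOne : Poly K V →ₗ[K] V :=
  (TensorProduct.lid K V).toLinearMap ∘ₗ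
    LinearMap.rTensor V (Polynomial.aeval (1 : K)).toLinearMap

/-- The extension of a bilinear map to polynomials. -/
noncomputable def mul₂ (β : V →ₗ[K] W →ₗ[K] U) : Poly K V →ₗ[K] Poly K W →ₗ[K] Poly K U :=
  TensorProduct.map₂ (LinearMap.mul K K[X]) β

theorem cst_apply (v : V) : cst v = (1 : K[X]) ⊗ₜ[K] v := rfl

@[simp] theorem coeffs_tmul (T : U →ₗ[K] V →ₗ[K] W) (u : U) (p : K[X]) (v : V) :
    coeffs T u (p ⊗ₜ v) = p ⊗ₜ T u v := rfl

@[simp] theorem mulT_tmul (p : K[X]) (v : V) :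
    mulT (p ⊗ₜ[K] v) = (Polynomial.X * p) ⊗ₜ v := rfl

@[simp] theorem scale_tmul (p : K[X]) (v : V) : scale (p ⊗ₜ[K] v) = polyScale K p ⊗ₜ v := rfl

@[simp] theorem evalOne_tmul (p : K[X]) (v : V) : evalOne (p ⊗ₜ[K] v) = p.eval 1 • v := by
  simp [evalOne]

@[simp] theorem mul₂_tmul (β : V →ₗ[K] W →ₗ[K] U) (p q : K[X]) (v : V) (w : W) :
    mul₂ β (p ⊗ₜ v) (q ⊗ₜ w) = (p * q) ⊗ₜ β v w := rfl

@[simp] theorem coeffs_cst (T : U →ₗ[K] V →ₗ[K] W) (u : U) (v : V) :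
    coeffs T u (cst v) = cst (T u v) := rfl

@[simp] theorem scale_cst (v : V) : scale (cst v) = (cst v : Poly K V) := by
  rw [cst_apply, scale_tmul, polyScale_one]

@[simp] theorem evalOne_cst (v : V) : evalOne (cst v : Poly K V) = v := by
  simp [cst_apply]

theorem coeffs_mulT (T : U →ₗ[K] V →ₗ[K] W) (u : U) (v : Poly K V) :
    coeffs T u (mulT v) = mulT (coeffs T u v) := by
  induction v using TensorProduct.induction_on with
  | zero => simp
  | tmul p v => rfl
  | add v v' h h' => simp only [map_add, h, h']

theorem coeffs_scale (T : U →ₗ[K] V →ₗ[K] W) (u : U) (v : Poly K V) :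
    coeffs T u (scale v) = scale (coeffs T u v) := by
  induction v using TensorProduct.induction_on with
  | zero => simp
  | tmul p v => rfl
  | add v v' h h' => simp only [map_add, h, h']

theorem evalOne_coeffs (T : U →ₗ[K] V →ₗ[K] W) (u : U) (v : Poly K V) :
    evalOne (coeffs T u v) = T u (evalOne v) := by
  induction v using TensorProduct.induction_on with
  | zero => simp
  | tmul p v => simp
  | add v v' h h' => simp only [map_add, h, h']

@[simp] theorem evalOne_mulT (v : Poly K V) : evalOne (mulT v) = evalOne v := by
  induction v using TensorProduct.induction_on with
  | zero => simp
  | tmul p v => simp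
  | add v v' h h' => simp only [map_add, h, h']

theorem evalOne_mul₂ (β : V →ₗ[K] W →ₗ[K] U) (v : Poly K V) (w : Poly K W) :
    evalOne (mul₂ β v w) = β (evalOne v) (evalOne w) := by
  induction v using TensorProduct.induction_on with
  | zero => simp
  | add v v' h h' => simp only [map_add, LinearMap.add_apply, h, h']
  | tmul p v =>
    induction w using TensorProduct.induction_on with
    | zero => simp
    | add w w' h h' => simp only [map_add, h, h']
    | tmul q w => simp [mul_smul, smul_comm (Polynomial.eval 1 q)]

theorem mul₂_symm {β : V →ₗ[K] V →ₗ[K] U} (h : ∀ v w, β v w = β w v) (v w : Poly K V) :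
    mul₂ β v w = mul₂ β w v := by
  induction v using TensorProduct.induction_on with
  | zero => simp
  | add v v' h h' => simp only [map_add, LinearMap.add_apply, h, h']
  | tmul p v =>
    induction w using TensorProduct.induction_on with
    | zero => simp
    | add w w' h h' => simp only [map_add, LinearMap.add_apply, h, h']
    | tmul q w => simp [h v w, mul_comm p q]

theorem mul₂_mulT_right (β : V →ₗ[K] W →ₗ[K] U) (v : Poly K V) (w : Poly K W) :
    mul₂ β v (mulT w) = mulT (mul₂ β v w) := by
  induction v using TensorProduct.induction_on with
  | zero => simp
  | add v v' h h' => simp only [map_add, LinearMap.add_apply, h, h']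
  | tmul p v =>
    induction w using TensorProduct.induction_on with
    | zero => simp
    | add w w' h h' => simp only [map_add, h, h']
    | tmul q w => simp [mul_left_comm p]

theorem scale_mulT_mul₂ (β : V →ₗ[K] W →ₗ[K] U) (v : Poly K V) (w : Poly K W) :
    scale (mulT (mul₂ β v w)) = mulT (mul₂ β (scale v) w) + mulT (mul₂ β v (scale w)) := by
  induction v using TensorProduct.induction_on with
  | zero => simp
  | add v v' h h' => simp only [map_add, LinearMap.add_apply, h, h']; abel
  | tmul p v =>
    induction w using TensorProduct.induction_on with
    | zero => simp
    | add w w' h h' => simp only [map_add, h, h']; abel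
    | tmul q w => simp [polyScale_mul, mul_add, TensorProduct.add_tmul]

theorem coeffs_mul₂ {X' : Type} [AddCommGroup X'] [Module K X'] {β : V →ₗ[K] W →ₗ[K] U}
    {S : X' →ₗ[K] U →ₗ[K] U} {S' : X' →ₗ[K] V →ₗ[K] V} {S'' : X' →ₗ[K] W →ₗ[K] W} {x : X'}
    (h : ∀ v w, S x (β v w) = β (S' x v) w + β v (S'' x w)) (v : Poly K V) (w : Poly K W) :
    coeffs S x (mul₂ β v w) = mul₂ β (coeffs S' x v) w + mul₂ β v (coeffs S'' x w) := by
  induction v using TensorProduct.induction_on with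
  | zero => simp
  | add v v' h h' => simp only [map_add, LinearMap.add_apply, h, h']; abel
  | tmul p v =>
    induction w using TensorProduct.induction_on with
    | zero => simp
    | add w w' h h' => simp only [map_add, h, h']; abel
    | tmul q w => simp [h, TensorProduct.tmul_add]

theorem coeffs_lie {V : Type} [AddCommGroup V] [Module K V] {a : X →ₗ[K] V →ₗ[K] V} {x y z : X}
    (h : ∀ v, a x (a y v) = a z v + a y (a x v)) (v : Poly K V) :
    coeffs a x (coeffs a y v) = coeffs a z v + coeffs a y (coeffs a x v) := by
  induction v using TensorProduct.induction_on with
  | zero => simp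
  | add v v' h h' => simp only [map_add, h, h']; abel
  | tmul p v => simp [h, TensorProduct.tmul_add]

theorem scale_bijective [CharZero K] : Function.Bijective (scale : Poly K V →ₗ[K] Poly K V) :=
  (LinearEquiv.rTensor V (LinearEquiv.ofBijective _ (polyScale_bijective (K := K)))).bijective

end PolyTensor

/-- The data from which the DG-Lie algebra interpolating between a model and its minimal model
is built. -/
structure Thickening (K : Type) [Field K] : Type 1 where
  g : Type
  X : Type
  U : Type
  V : Type
  W : Type
  [acg_g : AddCommGroup g]
  [acg_X : AddCommGroup X]
  [acg_U : AddCommGroup U]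
  [acg_V : AddCommGroup V]
  [acg_W : AddCommGroup W]
  [mod_g : Module K g]
  [mod_X : Module K X]
  [mod_U : Module K U]
  [mod_V : Module K V]
  [mod_W : Module K W]
  brg : g →ₗ[K] g →ₗ[K] g
  aX : g →ₗ[K] X →ₗ[K] X
  aU : g →ₗ[K] U →ₗ[K] U
  aV : g →ₗ[K] V →ₗ[K] V
  aW : g →ₗ[K] W →ₗ[K] W
  brX : X →ₗ[K] X →ₗ[K] U
  β : V →ₗ[K] V →ₗ[K] W
  pV : X →ₗ[K] V →ₗ[K] V
  pW : X →ₗ[K] W →ₗ[K] W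
  D : V →ₗ[K] W
  φ : X →ₗ[K] V
  κ : U →ₗ[K] W
  brg_skew : ∀ x y, brg x y = -brg y x
  brg_jacobi : ∀ x y z, brg x (brg y z) = brg (brg x y) z + brg y (brg x z)
  aX_lie : ∀ x y z, aX x (aX y z) = aX (brg x y) z + aX y (aX x z)
  aU_lie : ∀ x y z, aU x (aU y z) = aU (brg x y) z + aU y (aU x z)
  aV_lie : ∀ x y z, aV x (aV y z) = aV (brg x y) z + aV y (aV x z)
  aW_lie : ∀ x y z, aW x (aW y z) = aW (brg x y) z + aW y (aW x z)
  brX_symm : ∀ x x', brX x x' = brX x' x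
  brX_inv : ∀ y x x', aU y (brX x x') = brX (aX y x) x' + brX x (aX y x')
  β_symm : ∀ v w, β v w = β w v
  β_inv : ∀ y v w, aW y (β v w) = β (aV y v) w + β v (aV y w)
  pW_β : ∀ x v w, pW x (β v w) = β (pV x v) w + β v (pV x w)
  aV_pV : ∀ y x v, aV y (pV x v) = pV (aX y x) v + pV x (aV y v)
  aW_pW : ∀ y x w, aW y (pW x w) = pW (aX y x) w + pW x (aW y w)
  aW_D : ∀ y v, aW y (D v) = D (aV y v)
  aV_φ : ∀ y x, aV y (φ x) = φ (aX y x)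
  aW_κ : ∀ y u, aW y (κ u) = κ (aU y u)
  pW_D : ∀ x v, pW x (D v) = D (pV x v) + β (φ x) v
  pW_D_φ : ∀ x x', pW x (D (φ x')) = κ (brX x x')

attribute [instance] Thickening.acg_g Thickening.acg_X Thickening.acg_U Thickening.acg_V
  Thickening.acg_W Thickening.mod_g Thickening.mod_X Thickening.mod_U Thickening.mod_V
  Thickening.mod_W

namespace Thickening

open PolyTensor

variable (T : Thickening K)

/-- The operator `D`, extended to polynomials. -/
noncomputable def polyD : Poly K T.V →ₗ[K] Poly K T.W := LinearMap.lTensor _ T.D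

theorem polyD_eq (v : Poly K T.V) :
    T.polyD v = coeffs ((LinearMap.lsmul K (T.V →ₗ[K] T.W)).flip T.D) (1 : K) v := by
  induction v using TensorProduct.induction_on with
  | zero => simp
  | add v v' h h' => simp only [map_add, h, h']
  | tmul p v => simp [polyD]

@[simp] theorem polyD_cst (v : T.V) : T.polyD (cst v) = cst (T.D v) := rfl

theorem polyD_mulT (v : Poly K T.V) : T.polyD (mulT v) = mulT (T.polyD v) := by
  rw [polyD_eq, polyD_eq, coeffs_mulT]

theorem polyD_scale (v : Poly K T.V) : T.polyD (scale v) = scale (T.polyD v) := by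
  rw [polyD_eq, polyD_eq, coeffs_scale]

theorem evalOne_polyD (v : Poly K T.V) : evalOne (T.polyD v) = T.D (evalOne v) := by
  rw [polyD_eq, evalOne_coeffs]
  simp

theorem aW_polyD (y : T.g) (v : Poly K T.V) :
    coeffs T.aW y (T.polyD v) = T.polyD (coeffs T.aV y v) := by
  induction v using TensorProduct.induction_on with
  | zero => simp
  | add v v' h h' => simp only [map_add, h, h']
  | tmul p v => simp [polyD, T.aW_D]

theorem pW_polyD (x : T.X) (v : Poly K T.V) : coeffs T.pW x (T.polyD v) =
    T.polyD (coeffs T.pV x v) + mul₂ T.β (cst (T.φ x)) v := by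
  induction v using TensorProduct.induction_on with
  | zero => simp
  | add v v' h h' => simp only [map_add, h, h']; abel
  | tmul p v => simp [polyD, T.pW_D, cst_apply, TensorProduct.tmul_add]

theorem polyDer_lie {Y : Type} [AddCommGroup Y] [Module K Y] {a : T.g →ₗ[K] Y →ₗ[K] Y}
    {p : T.X →ₗ[K] Y →ₗ[K] Y} (h : ∀ y x v, a y (p x v) = p (T.aX y x) v + p x (a y v))
    (y : T.g) (x : T.X) (v : Poly K Y) :
    coeffs a y (coeffs p x v) = coeffs p (T.aX y x) v + coeffs p x (coeffs a y v) := by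
  induction v using TensorProduct.induction_on with
  | zero => simp
  | add v v' h h' => simp only [map_add, h, h']; abel
  | tmul q v => simp [h, TensorProduct.tmul_add]

/-- The degree one piece of the thickening. -/
abbrev R₁ : Type := T.X × Poly K T.V

/-- The degree two piece of the thickening. -/
abbrev R₂ : Type := T.U × Poly K T.W × Poly K T.V

/-- The action on the degree one piece. -/
noncomputable def act₁ : T.g →ₗ[K] T.R₁ →ₗ[K] T.R₁ :=
  LinearMap.mk₂ K (fun y v => (T.aX y v.1, coeffs T.aV y v.2))
    (by simp) (by simp) (by simp) (by simp)

/-- The action on the degree two piece. -/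
noncomputable def act₂ : T.g →ₗ[K] T.R₂ →ₗ[K] T.R₂ :=
  LinearMap.mk₂ K (fun y w => (T.aU y w.1, coeffs T.aW y w.2.1, coeffs T.aV y w.2.2))
    (by simp) (by simp) (by simp) (by simp)

/-- The bracket of two degree one elements. -/
noncomputable def br₁₁ : T.R₁ →ₗ[K] T.R₁ →ₗ[K] T.R₂ :=
  LinearMap.mk₂ K (fun v w => (T.brX v.1 w.1, mulT (mul₂ T.β v.2 w.2),
      mulT (coeffs T.pV v.1 w.2) + mulT (coeffs T.pV w.1 v.2)))
    (by intros; simp; abel) (by intros; simp) (by intros; simp; abel) (by intros; simp)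

/-- The bracket of a degree one and a degree two element. -/
noncomputable def br₁₂ : T.R₁ →ₗ[K] T.R₂ →ₗ[K] Poly K T.W :=
  LinearMap.mk₂ K (fun v w => mulT (coeffs T.pW v.1 w.2.1) - mulT (mul₂ T.β v.2 w.2.2))
    (by intros; simp; abel) (by intros; simp [smul_sub]) (by intros; simp; abel)
    (by intros; simp [smul_sub])

/-- The differential on the degree one piece. -/
noncomputable def diff₁ : T.R₁ →ₗ[K] T.R₂ where
  toFun v := (0, cst (T.D (T.φ v.1)) + T.polyD v.2, cst (T.φ v.1) + scale v.2)
  map_add' _ _ := by simp; constructor <;> abel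
  map_smul' _ _ := by simp

/-- The differential on the degree two piece. -/
noncomputable def diff₂ : T.R₂ →ₗ[K] Poly K T.W where
  toFun w := scale w.2.1 - T.polyD w.2.2 - (2 : K) • mulT (cst (T.κ w.1))
  map_add' _ _ := by simp; abel
  map_smul' _ _ := by simp [smul_sub, smul_comm (2 : K)]

theorem act₁_apply (y : T.g) (v : T.R₁) : T.act₁ y v = (T.aX y v.1, coeffs T.aV y v.2) := rfl

theorem act₂_apply (y : T.g) (w : T.R₂) :
    T.act₂ y w = (T.aU y w.1, coeffs T.aW y w.2.1, coeffs T.aV y w.2.2) := rfl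

theorem br₁₁_apply (v w : T.R₁) : T.br₁₁ v w = (T.brX v.1 w.1, mulT (mul₂ T.β v.2 w.2),
    mulT (coeffs T.pV v.1 w.2) + mulT (coeffs T.pV w.1 v.2)) := rfl

theorem br₁₂_apply (v : T.R₁) (w : T.R₂) :
    T.br₁₂ v w = mulT (coeffs T.pW v.1 w.2.1) - mulT (mul₂ T.β v.2 w.2.2) := rfl

theorem diff₁_apply (v : T.R₁) :
    T.diff₁ v = (0, cst (T.D (T.φ v.1)) + T.polyD v.2, cst (T.φ v.1) + scale v.2) := rfl

theorem diff₂_apply (w : T.R₂) :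
    T.diff₂ w = scale w.2.1 - T.polyD w.2.2 - (2 : K) • mulT (cst (T.κ w.1)) := rfl

theorem br₁₁_symm (v w : T.R₁) : T.br₁₁ v w = T.br₁₁ w v := by
  rw [br₁₁_apply, br₁₁_apply, T.brX_symm, mul₂_symm T.β_symm, add_comm (mulT (coeffs T.pV v.1 _))]

theorem act₂_br₁₁ (y : T.g) (v w : T.R₁) :
    T.act₂ y (T.br₁₁ v w) = T.br₁₁ (T.act₁ y v) w + T.br₁₁ v (T.act₁ y w) := by
  simp only [act₂_apply, act₁_apply, br₁₁_apply, Prod.mk_add_mk, T.brX_inv, coeffs_mulT,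
    coeffs_mul₂ (T.β_inv y), map_add, T.polyDer_lie T.aV_pV]
  refine Prod.ext rfl (Prod.ext rfl ?_)
  dsimp only
  abel

theorem act_br₁₂ (y : T.g) (v : T.R₁) (w : T.R₂) :
    coeffs T.aW y (T.br₁₂ v w) = T.br₁₂ (T.act₁ y v) w + T.br₁₂ v (T.act₂ y w) := by
  simp only [act₂_apply, act₁_apply, br₁₂_apply, coeffs_mulT, coeffs_mul₂ (T.β_inv y), map_add,
    map_sub, T.polyDer_lie T.aW_pW]
  abel

theorem jacobi₁₁₁ (u v w : T.R₁) :
    T.br₁₂ u (T.br₁₁ v w) + T.br₁₂ v (T.br₁₁ u w) + T.br₁₂ w (T.br₁₁ u v) = 0 := by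
  simp only [br₁₂_apply, br₁₁_apply, coeffs_mulT, coeffs_mul₂ (T.pW_β _), map_add,
    mul₂_mulT_right]
  rw [mul₂_symm T.β_symm (coeffs T.pV u.1 v.2), mul₂_symm T.β_symm (coeffs T.pV v.1 u.2),
    mul₂_symm T.β_symm (coeffs T.pV w.1 u.2)]
  abel

theorem diff₁_act₁ (y : T.g) (v : T.R₁) : T.diff₁ (T.act₁ y v) = T.act₂ y (T.diff₁ v) := by
  simp only [diff₁_apply, act₁_apply, act₂_apply, map_zero, map_add, coeffs_cst, T.aW_polyD,
    coeffs_scale, T.aW_D, T.aV_φ]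

theorem diff₂_act₂ (y : T.g) (w : T.R₂) :
    T.diff₂ (T.act₂ y w) = coeffs T.aW y (T.diff₂ w) := by
  simp only [diff₂_apply, act₂_apply, map_sub, map_smul, coeffs_mulT, coeffs_cst, T.aW_polyD,
    coeffs_scale, T.aW_κ]

theorem diff₂_br₁₁ (v w : T.R₁) :
    T.diff₂ (T.br₁₁ v w) = -T.br₁₂ w (T.diff₁ v) - T.br₁₂ v (T.diff₁ w) := by
  simp only [diff₂_apply, br₁₁_apply, br₁₂_apply, diff₁_apply, scale_mulT_mul₂, map_add,
    coeffs_cst, T.pW_polyD, T.polyD_mulT, T.pW_D_φ]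
  rw [T.brX_symm w.1, mul₂_symm T.β_symm (cst _) v.2, mul₂_symm T.β_symm (cst _) w.2,
    mul₂_symm T.β_symm (scale _), two_smul]
  abel

theorem diff₂_diff₁ (v : T.R₁) : T.diff₂ (T.diff₁ v) = 0 := by
  simp [diff₂_apply, diff₁_apply, polyD_scale]

/-- The thickened DG-Lie algebra. -/
noncomputable def thick : FourTermLie K where
  M₀ := T.g
  M₁ := T.R₁
  M₂ := T.R₂
  M₃ := Poly K T.W
  b₀₀ := T.brg
  b₀₁ := T.act₁
  b₀₂ := T.act₂
  b₀₃ := coeffs T.aW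
  b₁₁ := T.br₁₁
  b₁₂ := T.br₁₂
  d₁ := T.diff₁
  d₂ := T.diff₂
  skew₀₀ := T.brg_skew
  symm₁₁ := T.br₁₁_symm
  jacobi₀₀₀ := T.brg_jacobi
  jacobi₀₀₁ x y _ := Prod.ext (T.aX_lie _ _ _) (coeffs_lie (T.aV_lie x y) _)
  jacobi₀₀₂ x y _ := Prod.ext (T.aU_lie _ _ _)
    (Prod.ext (coeffs_lie (T.aW_lie x y) _) (coeffs_lie (T.aV_lie x y) _))
  jacobi₀₀₃ x y _ := coeffs_lie (T.aW_lie x y) _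
  jacobi₀₁₁ := T.act₂_br₁₁
  jacobi₀₁₂ := T.act_br₁₂
  jacobi₁₁₁ := T.jacobi₁₁₁
  d₁_b₀₁ := T.diff₁_act₁
  d₂_b₀₂ := T.diff₂_act₂
  d₂_b₁₁ := T.diff₂_br₁₁
  d₂_d₁ := T.diff₂_diff₁

/-- The minimal model of the thickened DG-Lie algebra. -/
def minimal : FourTermLie K where
  M₀ := T.g
  M₁ := T.X
  M₂ := T.U
  M₃ := PUnit
  b₀₀ := T.brg
  b₀₁ := T.aX
  b₀₂ := T.aU
  b₀₃ := 0
  b₁₁ := T.brX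
  b₁₂ := 0
  d₁ := 0
  d₂ := 0
  skew₀₀ := T.brg_skew
  symm₁₁ := T.brX_symm
  jacobi₀₀₀ := T.brg_jacobi
  jacobi₀₀₁ := T.aX_lie
  jacobi₀₀₂ := T.aU_lie
  jacobi₀₀₃ _ _ _ := rfl
  jacobi₀₁₁ := T.brX_inv
  jacobi₀₁₂ _ _ _ := rfl
  jacobi₁₁₁ _ _ _ := rfl
  d₁_b₀₁ _ _ := by simp
  d₂_b₀₂ _ _ := rfl
  d₂_b₁₁ _ _ := rfl
  d₂_d₁ _ := rfl

theorem minimal_d (x : T.minimal.toDGLA.carrier) : T.minimal.toDGLA.d x = 0 := rfl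

theorem diff₁_cst (x : T.X) : T.diff₁ (x, -cst (T.φ x)) = 0 := by
  simp [diff₁_apply]

theorem diff₂_mulT_cst (u : T.U) : T.diff₂ (u, mulT (cst (T.κ u)), 0) = 0 := by
  simp [diff₂_apply, cst_apply, polyScale_X, TensorProduct.smul_tmul']

variable [CharZero K]

theorem diff₁_eq_zero {v : T.R₁} (h : T.diff₁ v = 0) : v.2 = -cst (T.φ v.1) := by
  have h2 := congrArg (fun w : T.R₂ => w.2.2) h
  simp only [diff₁_apply, Prod.snd_zero] at h2
  refine scale_bijective.1 ?_
  rw [map_neg, scale_cst, eq_neg_iff_add_eq_zero, add_comm, h2]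

theorem exists_of_diff₂_eq_zero {w : T.R₂} (h : T.diff₂ w = 0) :
    ∃ v, w = T.diff₁ (0, v) + (w.1, mulT (cst (T.κ w.1)), 0) := by
  obtain ⟨v, hv⟩ := scale_bijective.2 w.2.2
  refine ⟨v, ?_⟩
  have h' : T.diff₂ (w - (T.diff₁ (0, v) + (w.1, mulT (cst (T.κ w.1)), 0))) = 0 := by
    rw [map_sub, map_add, h, diff₂_diff₁, diff₂_mulT_cst]
    simp
  have h0 : (w - (T.diff₁ (0, v) + (w.1, mulT (cst (T.κ w.1)), 0))).1 = 0 := by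
    simp [diff₁_apply]
  have h2 : (w - (T.diff₁ (0, v) + (w.1, mulT (cst (T.κ w.1)), 0))).2.2 = 0 := by
    simp [diff₁_apply, hv]
  have h1 : (w - (T.diff₁ (0, v) + (w.1, mulT (cst (T.κ w.1)), 0))).2.1 = 0 := by
    rw [diff₂_apply, h0, h2] at h'
    simp only [map_zero, sub_zero, smul_zero] at h'
    exact scale_bijective.1 (h'.trans (map_zero _).symm)
  exact sub_eq_zero.1 (Prod.ext h0 (Prod.ext h1 h2))

theorem mem_range_diff₁ {w : T.R₂} (h : T.diff₂ w = 0) (h0 : w.1 = 0) :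
    w ∈ LinearMap.range T.diff₁ := by
  obtain ⟨v, hv⟩ := T.exists_of_diff₂_eq_zero h
  rw [h0, map_zero, map_zero, map_zero] at hv
  exact ⟨(0, v), (hv.trans (add_zero _)).symm⟩

theorem diff₂_surjective : Function.Surjective T.diff₂ := by
  intro w
  obtain ⟨w', rfl⟩ := scale_bijective.2 w
  exact ⟨(0, w', 0), by simp [diff₂_apply]⟩

/-- The projection of the thickening to its minimal model. -/
noncomputable def toMinimal : FourTermLie.Hom T.thick T.minimal where
  f₀ := LinearMap.id
  f₁ := LinearMap.fst K T.X (Poly K T.V)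
  f₂ := LinearMap.fst K T.U (Poly K T.W × Poly K T.V)
  f₃ := 0
  map_b₀₀ _ _ := rfl
  map_b₀₁ _ _ := rfl
  map_b₀₂ _ _ := rfl
  map_b₀₃ _ _ := rfl
  map_b₁₁ _ _ := rfl
  map_b₁₂ _ _ := rfl
  map_d₁ _ := rfl
  map_d₂ _ := rfl

theorem qIso_minimal : QIso T.thick.toDGLA T.minimal.toDGLA := by
  refine T.toMinimal.isQuasiIso Function.bijective_id ?_ ?_ ?_ ?_ ?_ ?_
  · intro v hv h
    have h0 : v.1 = 0 := h
    refine Prod.ext h0 ((T.diff₁_eq_zero hv).trans ?_)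
    rw [h0, map_zero, map_zero, neg_zero]
    rfl
  · exact fun x _ => ⟨(x, -cst (T.φ x)), T.diff₁_cst x, rfl⟩
  · rintro w hw ⟨v', h⟩
    exact T.mem_range_diff₁ hw h.symm
  · exact fun u _ => ⟨(u, mulT (cst (T.κ u)), 0), T.diff₂_mulT_cst u, 0, (sub_self u).symm⟩
  · exact fun b _ => T.diff₂_surjective b
  · exact fun b => ⟨0, 0, rfl⟩

end Thickening

namespace Ser

variable {ι X V : Type} [AddCommGroup X] [Module K X] [AddCommGroup V] [Module K V]
  [Fintype ι] (b : Module.Basis ι K X)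

theorem act_add (ρ ρ' : V →ₗ[K] V) (r r' : X →ₗ[K] X) (v : Ser ι V) :
    act b (ρ + ρ') (r + r') v = act b ρ r v + act b ρ' r' v := by
  funext l
  rw [Pi.add_apply]
  induction l generalizing v with
  | nil => simp
  | cons i l ih =>
    simp only [act_cons, ih, LinearMap.add_apply, pd_add_left, Pi.add_apply]
    abel

theorem act_smul (c : K) (ρ : V →ₗ[K] V) (r : X →ₗ[K] X) (v : Ser ι V) :
    act b (c • ρ) (c • r) v = c • act b ρ r v := by
  funext l
  rw [Pi.smul_apply]
  induction l generalizing v with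
  | nil => simp
  | cons i l ih =>
    simp only [act_cons, ih, LinearMap.smul_apply, pd_smul_left, Pi.smul_apply, smul_sub]

/-- The action on series of a space acting on `V` and `X`. -/
noncomputable def actL {g : Type} [AddCommGroup g] [Module K g]
    (ρ : g →ₗ[K] V →ₗ[K] V) (r : g →ₗ[K] X →ₗ[K] X) : g →ₗ[K] Ser ι V →ₗ[K] Ser ι V where
  toFun y := act b (ρ y) (r y)
  map_add' y y' := LinearMap.ext fun v => by
    rw [map_add, map_add, act_add]
    rfl
  map_smul' c y := LinearMap.ext fun v => by
    rw [map_smul, map_smul, act_smul]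
    rfl

@[simp] theorem actL_apply {g : Type} [AddCommGroup g] [Module K g]
    (ρ : g →ₗ[K] V →ₗ[K] V) (r : g →ₗ[K] X →ₗ[K] X) (y : g) (v : Ser ι V) :
    actL b ρ r y v = act b (ρ y) (r y) v := rfl

end Ser

namespace SymplecticModel

open Ser PolyTensor

variable (M : SymplecticModel K)

theorem ρ₂_δ (y : M.g) (v : M.X × M.E) : M.δ (M.ρ y v) = M.ρ₂ y (M.δ v) := by
  simp

section

variable {ι : Type} (f : Ser ι (M.X × M.E))

/-- The twisted differential on series defined by a normal form map. -/
def twist : Ser ι (M.X × M.E) →ₗ[K] Ser ι (Module.Dual K M.g × M.E) :=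
  (M.δ.compLeft (List ι)) + conv M.β f

theorem twist_apply (v : Ser ι (M.X × M.E)) :
    M.twist f v = (fun l => M.δ (v l)) + conv M.β f v := rfl

theorem twist_nil {f : Ser ι (M.X × M.E)} (h0 : f [] = 0) (v : Ser ι (M.X × M.E)) :
    M.twist f v [] = M.δ (v []) := by
  rw [twist_apply, Pi.add_apply, conv_nil, h0, map_zero, LinearMap.zero_apply, add_zero]

/-- The constant series with values in the dual of `g`. -/
def dualConst : Module.Dual K M.g →ₗ[K] Ser ι (Module.Dual K M.g × M.E) :=
  constL ∘ₗ LinearMap.inl K _ M.E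

theorem dualConst_apply (u : Module.Dual K M.g) :
    M.dualConst (ι := ι) u = const (u, 0) := rfl

/-- Evaluation of polynomials at `1` and of series at the origin. -/
noncomputable def originAtOne (V : Type) [AddCommGroup V] [Module K V] :
    Poly K (Ser ι V) →ₗ[K] V :=
  LinearMap.proj (R := K) (φ := fun _ : List ι => V) [] ∘ₗ evalOne

theorem originAtOne_apply {V : Type} [AddCommGroup V] [Module K V] (v : Poly K (Ser ι V)) :
    originAtOne V v = evalOne v [] := rfl

theorem originAtOne_dualConst (u : Module.Dual K M.g) : originAtOne (K := K) (ι := ι)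
    (Module.Dual K M.g × M.E) (mulT (cst (M.dualConst u))) = (u, 0) := by
  rw [originAtOne_apply, evalOne_mulT, evalOne_cst]
  rfl

variable [Fintype ι] (b : Module.Basis ι K M.X) {f}

theorem act_twist (hact : ∀ y, act b (M.ρ y) (M.ρX y) f = 0) (y : M.g) (v : Ser ι (M.X × M.E)) :
    act b (M.ρ₂ y) (M.ρX y) (M.twist f v) = M.twist f (act b (M.ρ y) (M.ρX y) v) := by
  rw [twist_apply, twist_apply, map_add, act_conv b (M.ρX y) (M.β_inv y), hact, map_zero,
    LinearMap.zero_apply, zero_add]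
  congr 1
  funext l
  exact act_map b (M.ρX y) M.δ (M.ρ₂_δ y) v l

variable (hact : ∀ y, act b (M.ρ y) (M.ρX y) f = 0)
  (hf : ∀ x z, pd b x (M.twist f (pd b z f)) = const (M.brX x z, 0))

/-- The thickening of a model associated to a normal form map. -/
noncomputable def thickening : Thickening K where
  g := M.g
  X := M.X
  U := Module.Dual K M.g
  V := Ser ι (M.X × M.E)
  W := Ser ι (Module.Dual K M.g × M.E)
  brg := M.brg
  aX := M.ρX
  aU := M.coad
  aV := actL b M.ρ M.ρX
  aW := actL b M.ρ₂ M.ρX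
  brX := M.brX
  β := conv M.β
  pV := pdL b
  pW := pdL b
  D := M.twist f
  φ := (pdL b).flip f
  κ := M.dualConst
  brg_skew := M.brg_skew
  brg_jacobi := M.brg_jacobi
  aX_lie := M.ρX_lie
  aU_lie := M.coad_lie
  aV_lie x y v := act_lie b _ _ _ _ _ _ (M.ρ_lie x y) (M.ρX_lie x y) v
  aW_lie x y v := act_lie b _ _ _ _ _ _ (M.ρ₂_lie x y) (M.ρX_lie x y) v
  brX_symm := M.brX_symm
  brX_inv := M.brX_inv
  β_symm v w := by
    rw [conv_flip 1 (fun v w => by rw [M.β_symm, one_smul]), one_smul]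
  β_inv y v w := act_conv b _ (M.β_inv y) v w
  pW_β x v w := pd_conv b M.β x v w
  aV_pV y x v := by
    simp only [actL_apply, pdL_apply]
    rw [act_pd, add_comm]
  aW_pW y x v := by
    simp only [actL_apply, pdL_apply]
    rw [act_pd, add_comm]
  aW_D y v := M.act_twist b hact y v
  aV_φ y x := by
    simp only [actL_apply, LinearMap.flip_apply, pdL_apply]
    rw [act_pd, hact, pd_zero, zero_add]
  aW_κ y u := by
    simp only [actL_apply, dualConst_apply]
    rw [act_const]
    simp
  pW_D x v := by
    simp only [LinearMap.flip_apply, pdL_apply, twist_apply]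
    rw [pd_add, pd_map, pd_conv]
    abel
  pW_D_φ := hf

/-- Evaluation of polynomials at `1` and of series at the origin, as a morphism from the
thickening to the model. -/
noncomputable def thickeningToModel (h0 : f [] = 0) (h1 : ∀ x, pd b x f [] = (x, 0)) :
    FourTermLie.Hom (M.thickening b hact hf).thick M.model where
  f₀ := LinearMap.id
  f₁ := originAtOne (M.X × M.E) ∘ₗ LinearMap.snd K M.X (Poly K (Ser ι (M.X × M.E)))
  f₂ := originAtOne (Module.Dual K M.g × M.E) ∘ₗ
    LinearMap.fst K (Poly K (Ser ι (Module.Dual K M.g × M.E))) (Poly K (Ser ι (M.X × M.E))) ∘ₗ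
    LinearMap.snd K (Module.Dual K M.g)
      (Poly K (Ser ι (Module.Dual K M.g × M.E)) × Poly K (Ser ι (M.X × M.E)))
  f₃ := 0
  map_b₀₀ _ _ := rfl
  map_b₀₁ y v := congrFun (evalOne_coeffs (actL b M.ρ M.ρX) y v.2) []
  map_b₀₂ y w := congrFun (evalOne_coeffs (actL b M.ρ₂ M.ρX) y w.2.1) []
  map_b₀₃ _ _ := rfl
  map_b₁₁ v w := by
    refine (congrFun (evalOne_mulT (mul₂ (conv M.β) v.2 w.2)) []).trans ?_
    exact congrFun (evalOne_mul₂ (conv M.β) v.2 w.2) []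
  map_b₁₂ _ _ := rfl
  map_d₁ v := by
    obtain ⟨x, v⟩ := v
    change M.X at x
    change Poly K (Ser ι (M.X × M.E)) at v
    have h : evalOne (cst (M.twist f (pd b x f)) + LinearMap.lTensor _ (M.twist f) v) =
        M.twist f (pd b x f) + M.twist f (evalOne v) := by
      rw [map_add, evalOne_cst]
      exact congrArg (_ + ·) ((M.thickening b hact hf).evalOne_polyD v)
    refine (congrFun h []).trans ?_
    rw [Pi.add_apply, M.twist_nil h0, M.twist_nil h0, h1, δ_apply, Prod.mk_zero_zero, zero_add]
    rfl
  map_d₂ _ := rfl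

theorem qIso_thickening [CharZero K] (h0 : f [] = 0) (h1 : ∀ x, pd b x f [] = (x, 0)) :
    QIso (M.thickening b hact hf).thick.toDGLA M.model.toDGLA := by
  let T := M.thickening b hact hf
  have hcst (x : M.X) : originAtOne (K := K) (M.X × M.E) (cst (pd b x f)) = (x, 0) := by
    rw [originAtOne_apply, evalOne_cst]
    exact h1 x
  refine (M.thickeningToModel b hact hf h0 h1).isQuasiIso Function.bijective_id ?_ ?_ ?_ ?_ ?_ ?_
  · rintro ⟨x, v⟩ hv h
    change M.X at x
    change Poly K (Ser ι (M.X × M.E)) at v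
    change originAtOne (M.X × M.E) v = 0 at h
    have h2 : v = -cst (pd b x f) := T.diff₁_eq_zero hv
    rw [h2, map_neg, hcst, neg_eq_zero] at h
    have h1 : x = 0 := congrArg Prod.fst h
    subst h1
    rw [h2, ← pdL_apply, map_zero, LinearMap.zero_apply, map_zero, neg_zero]
    rfl
  · rintro ⟨x, e⟩ hv
    have h2 : e = 0 := congrArg Prod.snd hv
    subst h2
    refine ⟨(-x, -cst (T.φ (-x))), T.diff₁_cst _, ?_⟩
    refine (map_neg (originAtOne (K := K) (M.X × M.E)) (cst (pd b (-x) f))).trans ?_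
    rw [hcst]
    exact Prod.ext (neg_neg _) neg_zero
  · rintro w hw ⟨v', h⟩
    obtain ⟨v, hv⟩ := T.exists_of_diff₂_eq_zero hw
    obtain ⟨u, w, a⟩ := w
    change Module.Dual K M.g at u
    change Poly K (Ser ι (Module.Dual K M.g × M.E)) at w
    change Poly K (Ser ι (M.X × M.E)) at v
    obtain ⟨z, hz⟩ : ∃ z : Poly K (Ser ι (Module.Dual K M.g × M.E)), z = (T.diff₁ (0, v)).2.1 :=
      ⟨_, rfl⟩
    have h3 : originAtOne (Module.Dual K M.g × M.E) z = M.δ (originAtOne (M.X × M.E) v) :=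
      hz ▸ (M.thickeningToModel b hact hf h0 h1).map_d₁ (0, v)
    have h4 : w = z + mulT (cst (M.dualConst u)) :=
      hz ▸ congrArg (fun w => w.2.1) hv
    have h5 := congrArg (originAtOne (Module.Dual K M.g × M.E)) h4
    rw [map_add, originAtOne_dualConst] at h5
    have h6 : M.δ v' = M.δ (originAtOne (M.X × M.E) v) + (u, 0) :=
      h.trans (h5.trans (congrArg (· + _) h3))
    exact T.mem_range_diff₁ hw ((congrArg Prod.fst h6).trans (zero_add u)).symm
  · rintro ⟨u, e⟩ _
    refine ⟨(u, mulT (cst (T.κ u)), 0), T.diff₂_mulT_cst u, (0, -e), ?_⟩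
    change M.δ (0, -e) = originAtOne (K := K) (ι := ι) _ (mulT (cst (M.dualConst u))) - (u, e)
    rw [originAtOne_dualConst]
    exact Prod.ext (sub_self _).symm (zero_sub _).symm
  · exact fun c _ => T.diff₂_surjective c
  · exact fun c => ⟨0, 0, rfl⟩

end

theorem isFormal_model [CharZero K] [FiniteDimensional K M.X] : M.model.toDGLA.IsFormal := by
  obtain ⟨f, h0, h1, hact, hf⟩ := M.exists_normalForm (Module.finBasis K M.X)
  exact ⟨_, (M.thickening _ hact hf).minimal_d,
    .trans (.symm (.of (M.qIso_thickening _ hact hf h0 h1))) (.of (Thickening.qIso_minimal _))⟩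

end SymplecticModel

namespace DGLA

variable (A : DGLA K)

/-- The bracket bundled as a bilinear map. -/
def brHom : A.carrier →ₗ[K] A.carrier →ₗ[K] A.carrier :=
  LinearMap.mk₂ K A.br (fun x x' y => (A.br_lin₁ y).map_add x x')
    (fun c x y => (A.br_lin₁ y).map_smul c x) (fun x => (A.br_lin₂ x).map_add)
    fun c x y => (A.br_lin₂ x).map_smul c y

@[simp] theorem d_zero : A.d 0 = 0 := A.d_lin.map_zero

@[simp] theorem br_zero_left (y : A.carrier) : A.br 0 y = 0 := (A.br_lin₁ y).map_zero

@[simp] theorem br_zero_right (x : A.carrier) : A.br x 0 = 0 := (A.br_lin₂ x).map_zero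

theorem iSupIndep_grading : iSupIndep A.grading := A.internal.submodule_iSupIndep

theorem iSup_grading : ⨆ i, A.grading i = ⊤ := A.internal.submodule_iSup_eq_top

variable {A} in
/-- The homogeneous component of degree `j`. -/
noncomputable def component (j : ℤ) : A.carrier →ₗ[K] A.grading j :=
  DirectSum.component K ℤ (fun i => A.grading i) j ∘ₗ
    (LinearEquiv.ofBijective (DirectSum.coeLinearMap A.grading) A.internal).symm.toLinearMap

theorem ofBijective_symm_apply {i : ℤ} (x : A.grading i) :
    (LinearEquiv.ofBijective (DirectSum.coeLinearMap A.grading) A.internal).symm (x : A.carrier) =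
      DirectSum.lof K ℤ (fun i => A.grading i) i x := by
  rw [LinearEquiv.symm_apply_eq]
  exact (DirectSum.coeLinearMap_lof A.grading i x).symm

@[simp] theorem component_same {j : ℤ} (x : A.grading j) : A.component j x = x := by
  simp only [component, LinearMap.comp_apply, LinearEquiv.coe_coe, ofBijective_symm_apply]
  exact DirectSum.component.lof_self K (M := fun i => A.grading i) j x

theorem component_of_ne {i j : ℤ} (hij : i ≠ j) {x : A.carrier} (hx : x ∈ A.grading i) :
    A.component j x = 0 := by
  lift x to A.grading i using hx
  simp only [component, LinearMap.comp_apply, LinearEquiv.coe_coe, ofBijective_symm_apply]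
  rw [DirectSum.component.of, dif_neg hij]

theorem component_d (j : ℤ) (x : A.carrier) :
    (A.component (j + 1) (A.d x) : A.carrier) = A.d (A.component j x) := by
  have hx : x ∈ ⨆ i, A.grading i := A.iSup_grading ▸ Submodule.mem_top
  induction hx using Submodule.iSup_induction' with
  | mem i x hx =>
    by_cases h : i = j
    · subst h
      lift x to A.grading i using hx
      rw [component_same]
      exact congrArg Subtype.val (A.component_same ⟨A.d x, A.d_mem i x x.2⟩)
    · rw [A.component_of_ne h hx, A.component_of_ne (by omega) (A.d_mem i x hx)]
      exact A.d_zero.symm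
  | zero => simp
  | add x y _ _ hx hy =>
    rw [map_add, A.d_lin.map_add, map_add, Submodule.coe_add, hx, hy, Submodule.coe_add,
      A.d_lin.map_add]

theorem mem_coboundaries {j : ℤ} {x : A.carrier} :
    x ∈ A.coboundaries j ↔ ∃ z ∈ A.grading (j - 1), A.d z = x := by
  constructor
  · rintro ⟨hx, z, rfl⟩
    refine ⟨A.component (j - 1) z, Subtype.prop _, ?_⟩
    rw [← component_d]
    have h : ∀ k, k = j → (A.component k (A.d z) : A.carrier) = A.d z := by
      rintro k rfl
      exact congrArg Subtype.val (A.component_same ⟨A.d z, hx⟩)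
    exact h _ (by ring)
  · rintro ⟨z, hz, rfl⟩
    have := A.d_mem _ z hz
    rw [sub_add_cancel] at this
    exact ⟨this, z, rfl⟩

variable {A} in
theorem d_mem_of_eq {i j : ℤ} (hij : i + 1 = j) {x : A.carrier} (hx : x ∈ A.grading i) :
    A.d x ∈ A.grading j := by
  subst hij; exact A.d_mem i x hx

variable {A} in
theorem d_mem_coboundaries {i j : ℤ} (hij : i + 1 = j) {x : A.carrier}
    (hx : x ∈ A.grading i) : A.d x ∈ A.coboundaries j :=
  A.mem_coboundaries.2 ⟨x, by rwa [← hij, add_sub_cancel_right], rfl⟩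

variable (N : ℤ → Submodule K A.carrier)

theorem isInternal_comap_subtype (hN : ∀ i, N i ≤ A.grading i) :
    DirectSum.IsInternal fun i => (N i).comap (⨆ i, N i).subtype := by
  rw [DirectSum.isInternal_submodule_iff_iSupIndep_and_iSup_eq_top]
  have hle (i : ℤ) : N i ≤ LinearMap.range (⨆ i, N i).subtype := by
    rw [Submodule.range_subtype]; exact le_iSup N i
  have hmap (i : ℤ) : ((N i).comap (⨆ i, N i).subtype).map (⨆ i, N i).subtype = N i := by
    rw [Submodule.map_comap_eq, inf_eq_right]; exact hle i
  constructor
  · have hind : iSupIndep N := A.iSupIndep_grading.mono hN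
    rw [iSupIndep_def] at hind ⊢
    intro i
    rw [Submodule.disjoint_def]
    intro x hx hx'
    have h := Submodule.mem_map_of_mem (f := (⨆ i, N i).subtype) hx'
    simp only [Submodule.map_iSup, hmap] at h
    exact Subtype.ext (Submodule.disjoint_def.1 (hind i) x hx h)
  · apply Submodule.map_injective_of_injective (⨆ i, N i).injective_subtype
    simp only [Submodule.map_iSup, hmap, Submodule.map_top, Submodule.range_subtype]

/-- The DG-Lie subalgebra spanned by a graded subspace closed under the differential and the
bracket. -/
def sub (hN : ∀ i, N i ≤ A.grading i) (hd : ∀ i, ∀ x ∈ N i, A.d x ∈ N (i + 1))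
    (hbr : ∀ i j, ∀ x ∈ N i, ∀ y ∈ N j, A.br x y ∈ N (i + j)) : DGLA K where
  carrier := ↥(⨆ i, N i)
  grading i := (N i).comap (⨆ i, N i).subtype
  internal := A.isInternal_comap_subtype N hN
  d := A.dHom.restrict (p := ⨆ i, N i) (q := ⨆ i, N i) fun x hx => by
    induction hx using Submodule.iSup_induction' with
    | mem i x hx => exact Submodule.mem_iSup_of_mem (i + 1) (hd i x hx)
    | zero => simp
    | add x y _ _ hx hy => rw [map_add]; exact add_mem hx hy
  d_lin := LinearMap.isLinear _
  d_mem i x hx := hd i x hx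
  d_sq x := Subtype.ext (A.d_sq x)
  br x y := ⟨A.br x y, by
    obtain ⟨x, hx⟩ := x
    obtain ⟨y, hy⟩ := y
    change A.brHom x y ∈ _
    induction hx using Submodule.iSup_induction' with
    | mem i x hx =>
      induction hy using Submodule.iSup_induction' with
      | mem j y hy => exact Submodule.mem_iSup_of_mem (i + j) (hbr i j x hx y hy)
      | zero => simp
      | add y y' _ _ hy hy' => rw [map_add]; exact add_mem hy hy'
    | zero => simp
    | add x x' _ _ hx hx' => rw [map_add]; exact add_mem hx hx'⟩
  br_lin₁ y := ⟨fun x x' => Subtype.ext ((A.br_lin₁ y).map_add x x'),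
    fun c x => Subtype.ext ((A.br_lin₁ y).map_smul c x)⟩
  br_lin₂ x := ⟨fun y y' => Subtype.ext ((A.br_lin₂ x).map_add y y'),
    fun c y => Subtype.ext ((A.br_lin₂ x).map_smul c y)⟩
  br_mem i j x hx y hy := hbr i j x hx y hy
  skew i j x hx y hy := Subtype.ext (A.skew i j x (hN i hx) y (hN j hy))
  jacobi i j x hx y hy z := Subtype.ext (A.jacobi i j x (hN i hx) y (hN j hy) z)
  leibniz i x hx y := Subtype.ext (A.leibniz i x (hN i hx) y)

end DGLA

namespace GradedSplitting

variable {A : DGLA K} (S : GradedSplitting A)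

theorem exists_decomp {i j : ℤ} (hij : i + 1 = j) {x : A.carrier} (hx : x ∈ A.grading j) :
    ∃ a ∈ S.H j, ∃ k ∈ S.Kc i, ∃ k' ∈ S.Kc j, a + A.d k + k' = x := by
  obtain rfl : i = j - 1 := by omega
  rw [← S.decomp j] at hx
  obtain ⟨a, ha, z, hz, rfl⟩ := Submodule.mem_sup.1 hx
  obtain ⟨-, ⟨k, hk, rfl⟩, k', hk', rfl⟩ := Submodule.mem_sup.1 hz
  exact ⟨a, ha, k, hk, k', hk', add_assoc _ _ _⟩

theorem decomp_eq_zero {i j : ℤ} (hij : i + 1 = j) {a k k' : A.carrier} (ha : a ∈ S.H j)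
    (hk : k ∈ S.Kc i) (hk' : k' ∈ S.Kc j) (h : a + A.d k + k' = 0) : a = 0 ∧ k = 0 ∧ k' = 0 := by
  obtain rfl : i = j - 1 := by omega
  have hdk : A.d k ∈ (S.Kc (j - 1)).map A.dHom := ⟨k, hk, rfl⟩
  have h1 : a = 0 := Submodule.disjoint_def.1 (S.disj₁ j) a ha (by
    rw [show a = -(A.d k + k') by linear_combination (norm := abel) h]
    exact neg_mem (Submodule.add_mem_sup hdk hk'))
  have h2 : k' = 0 := Submodule.disjoint_def.1 (S.disj₂ j) k' (by
    rw [show k' = -A.d k by rw [h1] at h; linear_combination (norm := abel) h]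
    exact neg_mem hdk) hk'
  refine ⟨h1, S.d_Kc_inj _ k hk ?_, h2⟩
  rw [h1, h2] at h
  simpa using h

theorem mem_H_of_mem_sup {i : ℤ} {x : A.carrier} (hx : x ∈ S.H i ⊔ S.Kc i) (hd : A.d x = 0) :
    x ∈ S.H i := by
  obtain ⟨a, ha, k, hk, rfl⟩ := Submodule.mem_sup.1 hx
  rw [A.d_lin.map_add, S.d_H i a ha, zero_add] at hd
  rw [S.d_Kc_inj i k hk hd, add_zero]
  exact ha

theorem exists_decomp_of_mem_cocycles {i j : ℤ} (hij : i + 1 = j) {x : A.carrier}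
    (hx : x ∈ A.cocycles j) : ∃ a ∈ S.H j, ∃ k ∈ S.Kc i, a + A.d k = x := by
  obtain ⟨a, ha, k, hk, k', hk', rfl⟩ := S.exists_decomp hij hx.1
  have hd : A.d (a + A.d k + k') = 0 := hx.2
  rw [A.d_lin.map_add, A.d_lin.map_add, S.d_H j a ha, A.d_sq, add_zero, zero_add] at hd
  exact ⟨a, ha, k, hk, by rw [S.d_Kc_inj j k' hk' hd, add_zero]⟩

theorem exists_eq_d_of_mem_coboundaries {i j : ℤ} (hij : i + 1 = j) {x : A.carrier}
    (hx : x ∈ A.coboundaries j) : ∃ k ∈ S.Kc i, A.d k = x := by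
  obtain ⟨z, hz, rfl⟩ := A.mem_coboundaries.1 hx
  obtain rfl : i = j - 1 := by omega
  obtain ⟨a, ha, k, hk, k', hk', rfl⟩ := S.exists_decomp (sub_add_cancel (j - 1) 1) hz
  refine ⟨k', hk', ?_⟩
  rw [A.d_lin.map_add, A.d_lin.map_add, S.d_H _ a ha, A.d_sq, add_zero, zero_add]

theorem H_le_cocycles (j : ℤ) : S.H j ≤ A.cocycles j := fun x hx => ⟨S.H_le j hx, S.d_H j x hx⟩

theorem eq_zero_of_mem_coboundaries {j : ℤ} {x : A.carrier} (hx : x ∈ S.H j)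
    (hx' : x ∈ A.coboundaries j) : x = 0 := by
  obtain ⟨k, hk, hkx⟩ := S.exists_eq_d_of_mem_coboundaries (sub_add_cancel j 1) hx'
  refine (S.decomp_eq_zero (sub_add_cancel j 1) hx (neg_mem hk) (zero_mem _) ?_).1
  rw [A.d_lin.map_neg, hkx, add_zero, add_neg_cancel]

/-- The sum map `H^j × K^i × K^j → L^j`, where `i + 1 = j`. -/
def sumMap {i j : ℤ} (hij : i + 1 = j) : (S.H j × S.Kc i × S.Kc j) →ₗ[K] A.grading j :=
  LinearMap.codRestrict _
    (((S.H j).subtype).coprod ((A.dHom ∘ₗ (S.Kc i).subtype).coprod (S.Kc j).subtype)) fun p =>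
      add_mem (S.H_le j p.1.2) (add_mem (A.d_mem_of_eq hij (S.Kc_le i p.2.1.2))
        (S.Kc_le j p.2.2.2))

theorem sumMap_bijective {i j : ℤ} (hij : i + 1 = j) : Function.Bijective (S.sumMap hij) := by
  constructor
  · rw [← LinearMap.ker_eq_bot, LinearMap.ker_eq_bot']
    rintro ⟨⟨a, ha⟩, ⟨k, hk⟩, ⟨k', hk'⟩⟩ h
    have h' : a + (A.d k + k') = 0 := congrArg Subtype.val h
    obtain ⟨rfl, rfl, rfl⟩ := S.decomp_eq_zero hij ha hk hk' ((add_assoc _ _ _).trans h')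
    rfl
  · rintro ⟨x, hx⟩
    obtain ⟨a, ha, k, hk, k', hk', rfl⟩ := S.exists_decomp hij hx
    exact ⟨(⟨a, ha⟩, ⟨k, hk⟩, ⟨k', hk'⟩), Subtype.ext (add_assoc _ _ _).symm⟩

/-- The components of the degree `j` part with respect to the splitting. -/
noncomputable def proj {i j : ℤ} (hij : i + 1 = j) :
    A.carrier →ₗ[K] (S.H j × S.Kc i × S.Kc j) :=
  (LinearEquiv.ofBijective _ (S.sumMap_bijective hij)).symm.toLinearMap ∘ₗ A.component j

theorem proj_of_ne {i j l : ℤ} (hij : i + 1 = j) (hl : l ≠ j) {x : A.carrier}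
    (hx : x ∈ A.grading l) : S.proj hij x = 0 := by
  rw [proj, LinearMap.comp_apply, A.component_of_ne hl hx, map_zero]

theorem proj_eq {i j : ℤ} (hij : i + 1 = j) (a : S.H j) (k : S.Kc i) (k' : S.Kc j) :
    S.proj hij (a + A.d k + k') = (a, k, k') := by
  have h : (a + A.d k + k' : A.carrier) = (S.sumMap hij (a, k, k') : A.carrier) :=
    add_assoc _ _ _
  rw [h, proj, LinearMap.comp_apply, A.component_same, LinearEquiv.coe_coe,
    LinearEquiv.symm_apply_eq, LinearEquiv.ofBijective_apply]

theorem proj_H {i j : ℤ} (hij : i + 1 = j) (a : S.H j) : S.proj hij a = (a, 0, 0) := by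
  simpa using S.proj_eq hij a 0 0

theorem proj_Kc {i j : ℤ} (hij : i + 1 = j) (k : S.Kc j) : S.proj hij k = (0, 0, k) := by
  simpa using S.proj_eq hij 0 0 k

theorem proj_d {i j : ℤ} (hij : i + 1 = j) (k : S.Kc i) : S.proj hij (A.d k) = (0, k, 0) := by
  simpa using S.proj_eq hij 0 k 0

theorem finiteDimensional_H (j : ℤ) [FiniteDimensional K (A.cohomology j)] :
    FiniteDimensional K (S.H j) := by
  refine FiniteDimensional.of_injective
    (((A.coboundaries j).comap (A.cocycles j).subtype).mkQ ∘ₗ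
      Submodule.inclusion (S.H_le_cocycles j)) ?_
  rw [← LinearMap.ker_eq_bot, LinearMap.ker_eq_bot']
  intro x hx
  exact Subtype.ext
    (S.eq_zero_of_mem_coboundaries x.2 (Submodule.mem_comap.1
      ((Submodule.Quotient.mk_eq_zero ((A.coboundaries j).comap (A.cocycles j).subtype)).1 hx)))

end GradedSplitting

namespace GradedSplitting

variable {A : DGLA K} (S : GradedSplitting A)

open Classical in
/-- The pieces of the subalgebra `H⁰ ⊕ (H¹ ⊕ K¹) ⊕ L^{≥ 2}`. -/
def truncPiece (i : ℤ) : Submodule K A.carrier :=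
  if i < 0 then ⊥ else if i = 0 then S.H 0 else if i = 1 then S.H 1 ⊔ S.Kc 1 else A.grading i

theorem truncPiece_neg {i : ℤ} (hi : i < 0) : S.truncPiece i = ⊥ := if_pos hi

@[simp] theorem truncPiece_zero : S.truncPiece 0 = S.H 0 := by simp [truncPiece]

@[simp] theorem truncPiece_one : S.truncPiece 1 = S.H 1 ⊔ S.Kc 1 := by simp [truncPiece]

theorem truncPiece_of_two_le {i : ℤ} (hi : 2 ≤ i) : S.truncPiece i = A.grading i := by
  simp [truncPiece, show ¬ i < 0 by omega, show i ≠ 0 by omega, show i ≠ 1 by omega]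

theorem truncPiece_le (i : ℤ) : S.truncPiece i ≤ A.grading i := by
  unfold truncPiece
  split_ifs with h h' h''
  · exact bot_le
  · exact h' ▸ S.H_le i
  · subst h''; exact sup_le (S.H_le 1) (S.Kc_le 1)
  · exact le_rfl

theorem d_mem_truncPiece {i : ℤ} {x : A.carrier} (hx : x ∈ S.truncPiece i) :
    A.d x ∈ S.truncPiece (i + 1) := by
  rcases lt_trichotomy i 0 with hi | rfl | hi
  · rw [S.truncPiece_neg hi, Submodule.mem_bot] at hx
    simp [hx]
  · rw [truncPiece_zero] at hx
    simp [S.d_H 0 x hx]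
  · rw [S.truncPiece_of_two_le (by omega)]
    exact A.d_mem i x (S.truncPiece_le i hx)

theorem br_mem_swap {T : Submodule K A.carrier} {i j : ℤ} {x y : A.carrier}
    (hx : x ∈ A.grading i) (hy : y ∈ A.grading j) (h : A.br y x ∈ T) : A.br x y ∈ T := by
  rw [A.skew i j x hx y hy]
  exact neg_mem (T.smul_mem _ h)

theorem br_mem_truncPiece_of_le
    (h2 : ∀ x ∈ S.H 0, ∀ y ∈ S.H 0, A.br x y ∈ S.H 0)
    (hH : ∀ g ∈ S.H 0, ∀ x ∈ S.H 1, A.br g x ∈ S.H 1)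
    (hK : ∀ g ∈ S.H 0, ∀ x ∈ S.Kc 1, A.br g x ∈ S.Kc 1) {i j : ℤ} (hij : i ≤ j)
    {x y : A.carrier} (hx : x ∈ S.truncPiece i) (hy : y ∈ S.truncPiece j) :
    A.br x y ∈ S.truncPiece (i + j) := by
  rcases lt_or_ge i 0 with hi | hi
  · rw [S.truncPiece_neg hi, Submodule.mem_bot] at hx
    simp [hx]
  rcases le_or_gt 2 (i + j) with h | h
  · rw [S.truncPiece_of_two_le h]
    exact A.br_mem i j x (S.truncPiece_le i hx) y (S.truncPiece_le j hy)
  obtain rfl : i = 0 := by omega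
  obtain rfl | rfl : j = 0 ∨ j = 1 := by omega
  · rw [truncPiece_zero] at hx hy
    simpa using h2 x hx y hy
  · rw [truncPiece_zero] at hx
    rw [truncPiece_one] at hy
    rw [zero_add, truncPiece_one]
    obtain ⟨a, ha, k, hk, rfl⟩ := Submodule.mem_sup.1 hy
    rw [(A.br_lin₂ x).map_add]
    exact Submodule.add_mem_sup (hH x hx a ha) (hK x hx k hk)

/-- The subalgebra `H⁰ ⊕ (H¹ ⊕ K¹) ⊕ L^{≥ 2}`. -/
def trunc (h2 : ∀ x ∈ S.H 0, ∀ y ∈ S.H 0, A.br x y ∈ S.H 0)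
    (hH : ∀ g ∈ S.H 0, ∀ x ∈ S.H 1, A.br g x ∈ S.H 1)
    (hK : ∀ g ∈ S.H 0, ∀ x ∈ S.Kc 1, A.br g x ∈ S.Kc 1) : DGLA K :=
  A.sub S.truncPiece S.truncPiece_le (fun _ _ => S.d_mem_truncPiece) fun i j x hx y hy => by
    rcases le_total i j with h | h
    · exact S.br_mem_truncPiece_of_le h2 hH hK h hx hy
    · refine br_mem_swap (S.truncPiece_le i hx) (S.truncPiece_le j hy) ?_
      rw [add_comm i j]
      exact S.br_mem_truncPiece_of_le h2 hH hK h hy hx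

theorem H_le_truncPiece (h1 : ∀ i < 0, S.H i = ⊥) (i : ℤ) : S.H i ≤ S.truncPiece i := by
  unfold truncPiece
  split_ifs with h h' h''
  · exact (h1 i h).le
  · rw [h']
  · subst h''; exact le_sup_left
  · exact S.H_le i

theorem truncPiece_le_H_of_d_eq_zero {i : ℤ} (hi : i < 2) {x : A.carrier}
    (hx : x ∈ S.truncPiece i) (hd : A.d x = 0) : x ∈ S.H i := by
  rcases lt_or_ge i 0 with h | h
  · rw [S.truncPiece_neg h, Submodule.mem_bot] at hx
    exact hx ▸ zero_mem _
  obtain rfl | rfl : i = 0 ∨ i = 1 := by omega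
  · rwa [truncPiece_zero] at hx
  · rw [truncPiece_one] at hx
    exact S.mem_H_of_mem_sup hx hd

theorem truncPiece_le_iSup (i : ℤ) : S.truncPiece i ≤ ⨆ i, S.truncPiece i :=
  le_iSup S.truncPiece i

theorem exists_d_eq_of_mem_truncPiece {i j : ℤ} (hij : i + 1 = j) {x : A.carrier}
    (hx : x ∈ S.truncPiece j) (hx' : x ∈ A.coboundaries j) :
    ∃ z ∈ S.truncPiece i, A.d z = x := by
  rcases lt_or_ge j 2 with hj | hj
  · have hd : A.d x = 0 := by
      obtain ⟨z, -, rfl⟩ := A.mem_coboundaries.1 hx'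
      exact A.d_sq z
    exact ⟨0, zero_mem _, by
      rw [S.eq_zero_of_mem_coboundaries (S.truncPiece_le_H_of_d_eq_zero hj hx hd) hx', A.d_zero]⟩
  · obtain ⟨k, hk, rfl⟩ := S.exists_eq_d_of_mem_coboundaries hij hx'
    refine ⟨k, ?_, rfl⟩
    rcases eq_or_ne i 1 with rfl | hi
    · rw [truncPiece_one]; exact Submodule.mem_sup_right hk
    · rw [S.truncPiece_of_two_le (by omega)]; exact S.Kc_le i hk

theorem qIso_trunc (h1 : ∀ i < 0, S.H i = ⊥) (h2 hH hK) : QIso (S.trunc h2 hH hK) A := by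
  refine ⟨⟨Subtype.val, LinearMap.isLinear (⨆ i, S.truncPiece i).subtype,
    fun i x hx => S.truncPiece_le i hx, fun _ => rfl, fun _ _ => rfl⟩, fun i => ⟨?_, ?_⟩⟩
  · intro x hx hx'
    obtain ⟨z, hz, hzx⟩ := S.exists_d_eq_of_mem_truncPiece (sub_add_cancel i 1) hx.1 hx'
    exact DGLA.mem_coboundaries _ |>.2
      ⟨⟨z, S.truncPiece_le_iSup _ hz⟩, hz, Subtype.ext hzx⟩
  · intro y hy
    obtain ⟨a, ha, k, hk, rfl⟩ := S.exists_decomp_of_mem_cocycles (sub_add_cancel i 1) hy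
    have ha' := S.H_le_truncPiece h1 i ha
    refine ⟨⟨a, S.truncPiece_le_iSup i ha'⟩, ⟨ha', Subtype.ext (S.d_H i a ha)⟩, ?_⟩
    have := neg_mem (DGLA.d_mem_coboundaries (sub_add_cancel i 1) (S.Kc_le _ hk))
    simpa using this

section ToFourTerm

variable (F : FourTermLie K) (f₀ : A.carrier →ₗ[K] F.M₀) (f₁ : A.carrier →ₗ[K] F.M₁)
  (f₂ : A.carrier →ₗ[K] F.M₂)

/-- The map into a four-term presentation with the given components. -/
def toTotal : A.carrier →ₗ[K] F.Total := f₀.prod (f₁.prod (f₂.prod 0))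

variable {F f₀ f₁ f₂}

theorem toTotal_mem (v₀ : ∀ i ≠ 0, ∀ x ∈ A.grading i, f₀ x = 0)
    (v₁ : ∀ i ≠ 1, ∀ x ∈ A.grading i, f₁ x = 0) (v₂ : ∀ i ≠ 2, ∀ x ∈ A.grading i, f₂ x = 0)
    {i : ℤ} {x : A.carrier} (hx : x ∈ A.grading i) : toTotal F f₀ f₁ f₂ x ∈ F.piece i :=
  FourTermLie.mem_piece.2 ⟨fun h => v₀ i h x hx, fun h => v₁ i h x hx, fun h => v₂ i h x hx,
    fun _ => rfl⟩

theorem eq_zero_of_mem_piece [Subsingleton F.M₃] {i : ℤ} (hi : 3 ≤ i) {x : F.Total}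
    (hx : x ∈ F.piece i) : x = 0 := by
  obtain ⟨h0, h1, h2, -⟩ := FourTermLie.mem_piece.1 hx
  exact Prod.ext (h0 (by omega)) (Prod.ext (h1 (by omega)) (Prod.ext (h2 (by omega))
    (Subsingleton.elim _ _)))

theorem toTotal_br_of_le [Subsingleton F.M₃] (v₀ : ∀ i ≠ 0, ∀ x ∈ A.grading i, f₀ x = 0)
    (v₁ : ∀ i ≠ 1, ∀ x ∈ A.grading i, f₁ x = 0) (v₂ : ∀ i ≠ 2, ∀ x ∈ A.grading i, f₂ x = 0)
    (map_b₀₀ : ∀ x ∈ S.H 0, ∀ y ∈ S.H 0, f₀ (A.br x y) = F.b₀₀ (f₀ x) (f₀ y))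
    (map_b₀₁ : ∀ x ∈ S.H 0, ∀ y ∈ S.H 1 ⊔ S.Kc 1, f₁ (A.br x y) = F.b₀₁ (f₀ x) (f₁ y))
    (map_b₀₂ : ∀ x ∈ S.H 0, ∀ y ∈ A.grading 2, f₂ (A.br x y) = F.b₀₂ (f₀ x) (f₂ y))
    (map_b₁₁ : ∀ x ∈ S.H 1 ⊔ S.Kc 1, ∀ y ∈ S.H 1 ⊔ S.Kc 1,
      f₂ (A.br x y) = F.b₁₁ (f₁ x) (f₁ y))
    {i j : ℤ} (hij : i ≤ j) {x y : A.carrier} (hx : x ∈ S.truncPiece i)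
    (hy : y ∈ S.truncPiece j) :
    toTotal F f₀ f₁ f₂ (A.br x y) = F.bracket (toTotal F f₀ f₁ f₂ x) (toTotal F f₀ f₁ f₂ y) := by
  rcases lt_or_ge i 0 with hi | hi
  · rw [S.truncPiece_neg hi, Submodule.mem_bot] at hx
    rw [hx, A.br_zero_left, map_zero]
    exact (F.toDGLA.br_zero_left _).symm
  have hx' := S.truncPiece_le i hx
  have hy' := S.truncPiece_le j hy
  have hxy := A.br_mem i j x hx' y hy'
  have mx := toTotal_mem v₀ v₁ v₂ hx'
  have my := toTotal_mem v₀ v₁ v₂ hy'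
  have m := toTotal_mem v₀ v₁ v₂ hxy
  have m' := F.toDGLA.br_mem i j _ mx _ my
  rcases le_or_gt 3 (i + j) with h | h
  · rw [eq_zero_of_mem_piece h m]
    exact (eq_zero_of_mem_piece h m').symm
  have e3 : ∀ a b : F.M₃, a = b := fun a b => Subsingleton.elim a b
  obtain ⟨m0, m1, m2, -⟩ := FourTermLie.mem_piece.1 m
  obtain ⟨n0, n1, n2, -⟩ := FourTermLie.mem_piece.1 m'
  obtain ⟨rfl, rfl⟩ | ⟨rfl, rfl⟩ | ⟨rfl, rfl⟩ | ⟨rfl, rfl⟩ :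
      i = 0 ∧ j = 0 ∨ i = 0 ∧ j = 1 ∨ i = 0 ∧ j = 2 ∨ i = 1 ∧ j = 1 := by omega
  · rw [truncPiece_zero] at hx hy
    exact Prod.ext (map_b₀₀ x hx y hy) (Prod.ext ((m1 (by decide)).trans (n1 (by decide)).symm)
      (Prod.ext ((m2 (by decide)).trans (n2 (by decide)).symm) (e3 _ _)))
  · rw [truncPiece_zero] at hx
    rw [truncPiece_one] at hy
    refine Prod.ext ((m0 (by decide)).trans (n0 (by decide)).symm) (Prod.ext ?_
      (Prod.ext ((m2 (by decide)).trans (n2 (by decide)).symm) (e3 _ _)))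
    refine (map_b₀₁ x hx y hy).trans ?_
    simp [FourTermLie.bracket, toTotal, v₀ 1 (by decide) y hy']
  · rw [truncPiece_zero] at hx
    rw [S.truncPiece_of_two_le le_rfl] at hy
    refine Prod.ext ((m0 (by decide)).trans (n0 (by decide)).symm) (Prod.ext
      ((m1 (by decide)).trans (n1 (by decide)).symm) (Prod.ext ?_ (e3 _ _)))
    refine (map_b₀₂ x hx y hy).trans ?_
    simp [FourTermLie.bracket, toTotal, v₀ 2 (by decide) y hy', v₁ 2 (by decide) y hy']
  · rw [truncPiece_one] at hx hy
    refine Prod.ext ((m0 (by decide)).trans (n0 (by decide)).symm) (Prod.ext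
      ((m1 (by decide)).trans (n1 (by decide)).symm) (Prod.ext ?_ (e3 _ _)))
    refine (map_b₁₁ x hx y hy).trans ?_
    simp [FourTermLie.bracket, toTotal, v₀ 1 (by decide) x hx', v₀ 1 (by decide) y hy']

theorem toTotal_d (v₀ : ∀ i ≠ 0, ∀ x ∈ A.grading i, f₀ x = 0)
    (v₁ : ∀ i ≠ 1, ∀ x ∈ A.grading i, f₁ x = 0) (v₂ : ∀ i ≠ 2, ∀ x ∈ A.grading i, f₂ x = 0)
    [Subsingleton F.M₃] (map_d₁ : ∀ x ∈ S.H 1 ⊔ S.Kc 1, f₂ (A.d x) = F.d₁ (f₁ x))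
    {i : ℤ} {x : A.carrier} (hx : x ∈ S.truncPiece i) :
    toTotal F f₀ f₁ f₂ (A.d x) = F.diff (toTotal F f₀ f₁ f₂ x) := by
  have hx' := S.truncPiece_le i hx
  have m := toTotal_mem v₀ v₁ v₂ (A.d_mem i x hx')
  have m' := F.toDGLA.d_mem i _ (toTotal_mem v₀ v₁ v₂ hx')
  obtain ⟨m0, m1, m2, -⟩ := FourTermLie.mem_piece.1 m
  obtain ⟨n0, n1, n2, -⟩ := FourTermLie.mem_piece.1 m'
  rcases eq_or_ne i 1 with rfl | hi
  · rw [truncPiece_one] at hx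
    exact Prod.ext (m0 (by decide)) (Prod.ext (m1 (by decide)) (Prod.ext (map_d₁ x hx)
      (Subsingleton.elim _ _)))
  rcases lt_trichotomy i 0 with hi' | rfl | hi'
  · rw [S.truncPiece_neg hi', Submodule.mem_bot] at hx
    rw [hx, A.d_zero, map_zero]
    exact F.toDGLA.d_zero.symm
  · rw [truncPiece_zero] at hx
    rw [S.d_H 0 x hx, map_zero]
    refine Prod.ext rfl (Prod.ext rfl (Prod.ext (n2 (by decide)).symm (Subsingleton.elim _ _)))
  · rw [eq_zero_of_mem_piece (by omega) m]
    exact (eq_zero_of_mem_piece (by omega) m').symm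

theorem qIso_of_components [Subsingleton F.M₃] (h1 : ∀ i < 0, S.H i = ⊥)
    (h4 : ∀ i, 3 ≤ i → S.H i = ⊥) (h2 hH hK)
    (v₀ : ∀ i ≠ 0, ∀ x ∈ A.grading i, f₀ x = 0)
    (v₁ : ∀ i ≠ 1, ∀ x ∈ A.grading i, f₁ x = 0) (v₂ : ∀ i ≠ 2, ∀ x ∈ A.grading i, f₂ x = 0)
    (map_b₀₀ : ∀ x ∈ S.H 0, ∀ y ∈ S.H 0, f₀ (A.br x y) = F.b₀₀ (f₀ x) (f₀ y))
    (map_b₀₁ : ∀ x ∈ S.H 0, ∀ y ∈ S.H 1 ⊔ S.Kc 1, f₁ (A.br x y) = F.b₀₁ (f₀ x) (f₁ y))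
    (map_b₀₂ : ∀ x ∈ S.H 0, ∀ y ∈ A.grading 2, f₂ (A.br x y) = F.b₀₂ (f₀ x) (f₂ y))
    (map_b₁₁ : ∀ x ∈ S.H 1 ⊔ S.Kc 1, ∀ y ∈ S.H 1 ⊔ S.Kc 1,
      f₂ (A.br x y) = F.b₁₁ (f₁ x) (f₁ y))
    (map_d₁ : ∀ x ∈ S.H 1 ⊔ S.Kc 1, f₂ (A.d x) = F.d₁ (f₁ x))
    (inj₀ : ∀ x ∈ S.H 0, f₀ x = 0 → x = 0) (surj₀ : ∀ y, ∃ x ∈ S.H 0, f₀ x = y)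
    (inj₁ : ∀ x ∈ S.H 1, f₁ x = 0 → x = 0)
    (surj₁ : ∀ v, F.d₁ v = 0 → ∃ x ∈ S.H 1, f₁ x = v)
    (inj₂ : ∀ x ∈ S.H 2, f₂ x ∈ LinearMap.range F.d₁ → x = 0)
    (surj₂ : ∀ w, ∃ x ∈ S.H 2, f₂ x - w ∈ LinearMap.range F.d₁) :
    QIso (S.trunc h2 hH hK) F.toDGLA := by
  let f := toTotal F f₀ f₁ f₂
  have hbr : ∀ i j, ∀ x ∈ S.truncPiece i, ∀ y ∈ S.truncPiece j,
      f (A.br x y) = F.bracket (f x) (f y) := by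
    intro i j x hx y hy
    rcases le_total i j with h | h
    · exact S.toTotal_br_of_le v₀ v₁ v₂ map_b₀₀ map_b₀₁ map_b₀₂ map_b₁₁ h hx hy
    · have hx' := S.truncPiece_le i hx
      have hy' := S.truncPiece_le j hy
      have e := S.toTotal_br_of_le v₀ v₁ v₂ map_b₀₀ map_b₀₁ map_b₀₂ map_b₁₁ h hy hx
      have e' := F.toDGLA.skew i j _ (toTotal_mem v₀ v₁ v₂ hx') _ (toTotal_mem v₀ v₁ v₂ hy')
      rw [A.skew i j x hx' y hy', map_neg, map_smul]
      exact (congrArg (fun z => -((-1 : K) ^ (i * j) • z)) e).trans e'.symm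
  let φ : DGLAHom (S.trunc h2 hH hK) F.toDGLA :=
    { toFun := fun x => f x.1
      lin := LinearMap.isLinear (f ∘ₗ (⨆ i, S.truncPiece i).subtype)
      map_grading := fun i x hx => toTotal_mem v₀ v₁ v₂ (S.truncPiece_le i hx)
      map_d := by
        rintro ⟨x, hx⟩
        change f (A.dHom x) = F.toDGLA.dHom (f x)
        induction hx using Submodule.iSup_induction' with
        | mem i x hx => exact S.toTotal_d v₀ v₁ v₂ map_d₁ hx
        | zero => rw [map_zero, map_zero]; exact (map_zero F.toDGLA.dHom).symm
        | add x y _ _ hx hy =>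
          rw [map_add, map_add, hx, hy, map_add]
          exact (map_add F.toDGLA.dHom _ _).symm
      map_br := by
        rintro ⟨x, hx⟩ ⟨y, hy⟩
        change f (A.brHom x y) = F.toDGLA.brHom (f x) (f y)
        induction hx using Submodule.iSup_induction' with
        | mem i x hx =>
          induction hy using Submodule.iSup_induction' with
          | mem j y hy => exact hbr i j x hx y hy
          | zero => rw [map_zero, map_zero]; exact (map_zero (F.toDGLA.brHom (f x))).symm
          | add y y' _ _ hy hy' =>
            rw [map_add, map_add, hy, hy', map_add]
            exact (map_add (F.toDGLA.brHom (f x)) _ _).symm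
        | zero =>
          rw [map_zero, LinearMap.zero_apply, map_zero]
          exact (F.toDGLA.br_zero_left _).symm
        | add x x' _ _ hx hx' =>
          rw [map_add, LinearMap.add_apply, map_add, hx, hx', map_add]
          exact ((F.toDGLA.br_lin₁ (f y)).map_add _ _).symm }
  refine ⟨φ, fun i => ⟨?_, ?_⟩⟩
  · rintro ⟨x, hx0⟩ ⟨hx, hdx⟩ hfx
    have hx : x ∈ S.truncPiece i := hx
    have hdx : A.d x = 0 := congrArg Subtype.val hdx
    have hfx : f x ∈ F.toDGLA.coboundaries i := hfx
    suffices h : x ∈ A.coboundaries i by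
      obtain ⟨z, hz, hzx⟩ := S.exists_d_eq_of_mem_truncPiece (sub_add_cancel i 1) hx h
      exact DGLA.mem_coboundaries _ |>.2
        ⟨⟨z, S.truncPiece_le_iSup _ hz⟩, hz, Subtype.ext hzx⟩
    obtain ⟨-, k0, k1, k2, -⟩ := FourTermLie.mem_coboundaries.1 hfx
    rcases lt_or_ge i 2 with hi | hi
    · have hxH := S.truncPiece_le_H_of_d_eq_zero hi hx hdx
      suffices h : x = 0 by rw [h]; exact zero_mem _
      rcases lt_or_ge i 0 with hi' | hi'
      · rwa [h1 i hi', Submodule.mem_bot] at hxH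
      obtain rfl | rfl : i = 0 ∨ i = 1 := by omega
      · exact inj₀ x hxH k0
      · exact inj₁ x hxH k1
    obtain ⟨a, ha, k, hk, rfl⟩ := S.exists_decomp_of_mem_cocycles (sub_add_cancel i 1)
      ⟨S.truncPiece_le i hx, hdx⟩
    suffices h : a = 0 by
      rw [h, zero_add]
      exact DGLA.d_mem_coboundaries (sub_add_cancel i 1) (S.Kc_le _ hk)
    rcases eq_or_ne i 2 with rfl | hi'
    · refine inj₂ a ha ?_
      have h : f₂ (a + A.d k) ∈ LinearMap.range F.d₁ := k2
      rw [map_add, map_d₁ k (Submodule.mem_sup_right hk)] at h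
      exact (Submodule.add_mem_iff_left _ (LinearMap.mem_range_self F.d₁ _)).1 h
    · rwa [h4 i (by omega), Submodule.mem_bot] at ha
  · intro y hy
    change F.Total at y
    suffices h : ∃ a ∈ S.H i, f a - y ∈ F.toDGLA.coboundaries i by
      obtain ⟨a, ha, hay⟩ := h
      have ha' := S.H_le_truncPiece h1 i ha
      exact ⟨⟨a, S.truncPiece_le_iSup i ha'⟩, ⟨ha', Subtype.ext (S.d_H i a ha)⟩, hay⟩
    suffices h : ∃ a ∈ S.H i, f₀ a = y.1 ∧ f₁ a = y.2.1 ∧ f₂ a - y.2.2.1 ∈ LinearMap.range F.d₁ by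
      obtain ⟨a, ha, e0, e1, e2⟩ := h
      exact ⟨a, ha, FourTermLie.mem_coboundaries.2
        ⟨sub_mem (toTotal_mem v₀ v₁ v₂ (S.H_le i ha)) hy.1, sub_eq_zero.2 e0, sub_eq_zero.2 e1,
          e2, 0, Subsingleton.elim _ _⟩⟩
    obtain ⟨hyi, hdy, -⟩ := FourTermLie.mem_cocycles.1 hy
    clear hy
    revert hdy
    revert i y
    refine FourTermLie.piece_cases ?_ ?_ ?_ ?_ ?_
    · intro i _
      exact ⟨0, zero_mem _, by simp, by simp, by simp⟩
    · intro y _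
      obtain ⟨a, ha, e⟩ := surj₀ y
      exact ⟨a, ha, e, v₁ 0 (by decide) a (S.H_le 0 ha), by
        simp [v₂ 0 (by decide) a (S.H_le 0 ha)]⟩
    · intro v hv
      obtain ⟨a, ha, e⟩ := surj₁ v hv
      exact ⟨a, ha, v₀ 1 (by decide) a (S.H_le 1 ha), e, by
        simp [v₂ 1 (by decide) a (S.H_le 1 ha)]⟩
    · intro w _
      obtain ⟨a, ha, e⟩ := surj₂ w
      exact ⟨a, ha, v₀ 2 (by decide) a (S.H_le 2 ha), v₁ 2 (by decide) a (S.H_le 2 ha), e⟩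
    · intro b _
      exact ⟨0, zero_mem _, by simp, by simp, by simp⟩

end ToFourTerm

end GradedSplitting

namespace DGLA

variable {A : DGLA K}

theorem br_comm_of_deg_one {x y : A.carrier} (hx : x ∈ A.grading 1) (hy : y ∈ A.grading 1) :
    A.br x y = A.br y x := by
  simpa using A.skew 1 1 x hx y hy

theorem br_skew_of_deg_zero {x y : A.carrier} {i : ℤ} (hx : x ∈ A.grading 0)
    (hy : y ∈ A.grading i) : A.br x y = -A.br y x := by
  simpa using A.skew 0 i x hx y hy

theorem br_skew_of_deg_zero' {x y : A.carrier} {i : ℤ} (hx : x ∈ A.grading i)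
    (hy : y ∈ A.grading 0) : A.br x y = -A.br y x := by
  simpa using A.skew i 0 x hx y hy

theorem jacobi_of_deg_zero {x y : A.carrier} {i : ℤ} (hx : x ∈ A.grading 0)
    (hy : y ∈ A.grading i) (z : A.carrier) :
    A.br x (A.br y z) = A.br (A.br x y) z + A.br y (A.br x z) := by
  simpa using A.jacobi 0 i x hx y hy z

/-- The action of a subspace on a stable subspace. -/
def restrictBr (g T : Submodule K A.carrier) (hT : ∀ y ∈ g, ∀ x ∈ T, A.br y x ∈ T) :
    g →ₗ[K] T →ₗ[K] T :=
  LinearMap.mk₂ K (fun y x => ⟨A.br y x, hT y y.2 x x.2⟩)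
    (fun x x' y => Subtype.ext ((A.br_lin₁ y).map_add x x'))
    (fun c x y => Subtype.ext ((A.br_lin₁ y).map_smul c x))
    (fun x y y' => Subtype.ext ((A.br_lin₂ x).map_add y y'))
    fun c x y => Subtype.ext ((A.br_lin₂ x).map_smul c y)

@[simp] theorem coe_restrictBr {g T : Submodule K A.carrier}
    (hT : ∀ y ∈ g, ∀ x ∈ T, A.br y x ∈ T) (y : g) (x : T) :
    (restrictBr g T hT y x : A.carrier) = A.br y x := rfl

theorem restrictBr_lie {g T : Submodule K A.carrier} (hg0 : g ≤ A.grading 0)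
    (hg : ∀ y ∈ g, ∀ x ∈ g, A.br y x ∈ g) (hT : ∀ y ∈ g, ∀ x ∈ T, A.br y x ∈ T) (x y : g)
    (z : T) : restrictBr g T hT x (restrictBr g T hT y z) =
      restrictBr g T hT (restrictBr g g hg x y) z + restrictBr g T hT y (restrictBr g T hT x z) :=
  Subtype.ext (jacobi_of_deg_zero (hg0 x.2) (hg0 y.2) _)

theorem restrictBr_skew {g : Submodule K A.carrier} (hg0 : g ≤ A.grading 0)
    (hg : ∀ y ∈ g, ∀ x ∈ g, A.br y x ∈ g) (x y : g) :
    restrictBr g g hg x y = -restrictBr g g hg y x :=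
  Subtype.ext (br_skew_of_deg_zero (hg0 x.2) (hg0 y.2))

end DGLA

namespace GradedSplitting

variable {A : DGLA K} (S : GradedSplitting A)

theorem d_br {y : A.carrier} (hy : y ∈ S.H 0) (x : A.carrier) :
    A.d (A.br y x) = A.br y (A.d x) := by
  simpa [S.d_H 0 y hy] using A.leibniz 0 y (S.H_le 0 hy) x

theorem proj_add {i j : ℤ} (hij : i + 1 = j) (a : S.H j) (k : S.Kc j) :
    S.proj hij (a + k : A.carrier) = (a, 0, k) := by
  rw [map_add, proj_H, proj_Kc]; simp

theorem proj_br {i j : ℤ} (hij : i + 1 = j) (hH : ∀ y ∈ S.H 0, ∀ x ∈ S.H j, A.br y x ∈ S.H j)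
    (hK : ∀ y ∈ S.H 0, ∀ x ∈ S.Kc i, A.br y x ∈ S.Kc i)
    (hK' : ∀ y ∈ S.H 0, ∀ x ∈ S.Kc j, A.br y x ∈ S.Kc j) (y : S.H 0) {x : A.carrier}
    (hx : x ∈ A.grading j) :
    (S.proj hij (A.br y x)).2.1 =
      DGLA.restrictBr (S.H 0) (S.Kc i) hK y (S.proj hij x).2.1 := by
  obtain ⟨a, ha, k, hk, k', hk', rfl⟩ := S.exists_decomp hij hx
  lift a to S.H j using ha
  lift k to S.Kc i using hk
  lift k' to S.Kc j using hk'
  rw [(A.br_lin₂ y).map_add, (A.br_lin₂ y).map_add, ← S.d_br y.2, S.proj_eq hij a k k']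
  exact congrArg (fun p => p.2.1) (S.proj_eq hij (DGLA.restrictBr _ _ hH y a)
    (DGLA.restrictBr _ _ hK y k) (DGLA.restrictBr _ _ hK' y k'))

end GradedSplitting

namespace QCyclicDGLA

variable {n : ℤ} (A : QCyclicDGLA K n)

/-- The pairing bundled as a bilinear map. -/
def formHom : A.carrier →ₗ[K] A.carrier →ₗ[K] K :=
  LinearMap.mk₂ K A.form (fun x x' y => (A.form_lin₁ y).map_add x x')
    (fun c x y => (A.form_lin₁ y).map_smul c x) (fun x => (A.form_lin₂ x).map_add)
    fun c x y => (A.form_lin₂ x).map_smul c y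

variable {A}

theorem form_d_right {i : ℤ} {x : A.carrier} (hx : x ∈ A.grading i) (hd : A.d x = 0)
    (y : A.carrier) : A.form x (A.d y) = 0 := by
  have h := A.form_d i x hx y
  rw [hd] at h
  have h0 : A.form 0 y = 0 := (A.form_lin₁ y).map_zero
  rw [h0] at h
  exact (mul_eq_zero.1 h.symm).resolve_left (zpow_ne_zero _ (by simp))

theorem form_d_left {i : ℤ} {x y : A.carrier} (hx : x ∈ A.grading i) (hd : A.d y = 0) :
    A.form (A.d x) y = 0 := by
  rw [A.form_d i x hx y, hd, (A.form_lin₂ x).map_zero, mul_zero]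

theorem form_symm_eq_zero {i j : ℤ} {x y : A.carrier} (hx : x ∈ A.grading i)
    (hy : y ∈ A.grading j) (h : A.form x y = 0) : A.form y x = 0 := by
  rw [A.form_symm j i y hy x hx, h, mul_zero]

theorem form_skew {x y : A.carrier} (hx : x ∈ A.grading 1) (hy : y ∈ A.grading 1) :
    A.form x y = -A.form y x := by
  simpa using A.form_symm 1 1 x hx y hy

theorem form_inv {i : ℤ} {y v : A.carrier} (hy : y ∈ A.grading 0) (hv : v ∈ A.grading i)
    (w : A.carrier) : A.form (A.br y v) w = -A.form v (A.br y w) := by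
  rw [A.toDGLA.br_skew_of_deg_zero hy hv, (A.form_lin₁ w).map_neg, A.form_cyclic]

variable (S : GradedSplitting A.toDGLA)

theorem eq_zero_of_form_eq_zero {i j : ℤ} (hij : i + j = n) {x : A.carrier} (hx : x ∈ S.H i)
    (h : ∀ y ∈ S.H j, A.form x y = 0) : x = 0 := by
  obtain rfl : j = n - i := by omega
  refine S.eq_zero_of_mem_coboundaries hx (A.nondeg i x (S.H_le_cocycles i hx) fun y hy => ?_)
  obtain ⟨a, ha, k, -, rfl⟩ := S.exists_decomp_of_mem_cocycles (sub_add_cancel _ 1) hy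
  rw [(A.form_lin₂ x).map_add, h a ha, form_d_right (S.H_le i hx) (S.d_H i x hx), add_zero]

/-- The pairing between the harmonic subspaces of degrees `i` and `j`. -/
def pairing (i j : ℤ) : S.H i →ₗ[K] S.H j →ₗ[K] K := A.formHom.domRestrict₁₂ (S.H i) (S.H j)

@[simp] theorem pairing_apply {i j : ℤ} (x : S.H i) (y : S.H j) :
    pairing S i j x y = A.form x y := rfl

theorem pairing_injective {i j : ℤ} (hij : i + j = n) :
    Function.Injective (pairing S i j) := by
  rw [← LinearMap.ker_eq_bot, LinearMap.ker_eq_bot']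
  intro x hx
  exact Subtype.ext (eq_zero_of_form_eq_zero S hij x.2 fun y hy =>
    LinearMap.congr_fun hx (⟨y, hy⟩ : S.H j))

theorem pairing_flip_injective {i j : ℤ} (hij : i + j = n) :
    Function.Injective (pairing S i j).flip := by
  rw [← LinearMap.ker_eq_bot, LinearMap.ker_eq_bot']
  intro x hx
  refine Subtype.ext (eq_zero_of_form_eq_zero S (j := i) (by omega) x.2 fun y hy => ?_)
  exact form_symm_eq_zero (S.H_le i hy) (S.H_le j x.2)
    (LinearMap.congr_fun hx (⟨y, hy⟩ : S.H i))

theorem pairing_bijective {i j : ℤ} (hij : i + j = n) :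
    Function.Bijective (pairing S i j) := by
  have := A.findim i
  have := S.finiteDimensional_H i
  exact (LinearMap.IsPerfPair.of_injective (pairing_injective S hij)
    (pairing_flip_injective S hij)).bijective_left

theorem H_eq_bot (h1 : ∀ i < 0, S.H i = ⊥) {i : ℤ} (hi : n < i) : S.H i = ⊥ := by
  refine (Submodule.eq_bot_iff _).2 fun x hx =>
    eq_zero_of_form_eq_zero S (j := n - i) (by omega) hx fun y hy => ?_
  rw [h1 _ (by omega), Submodule.mem_bot] at hy
  rw [hy, (A.form_lin₂ x).map_zero]

end QCyclicDGLA

namespace GradedSplitting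

variable {A : DGLA K} (S : GradedSplitting A)

/-- The graded Lie algebra `H⁰ ⊕ H¹`. -/
def lowDegree (h2 : ∀ x ∈ S.H 0, ∀ y ∈ S.H 0, A.br x y ∈ S.H 0)
    (hH : ∀ g ∈ S.H 0, ∀ x ∈ S.H 1, A.br g x ∈ S.H 1) : FourTermLie K where
  M₀ := S.H 0
  M₁ := S.H 1
  M₂ := PUnit
  M₃ := PUnit
  b₀₀ := DGLA.restrictBr (S.H 0) (S.H 0) h2
  b₀₁ := DGLA.restrictBr (S.H 0) (S.H 1) hH
  b₀₂ := 0
  b₀₃ := 0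
  b₁₁ := 0
  b₁₂ := 0
  d₁ := 0
  d₂ := 0
  skew₀₀ := DGLA.restrictBr_skew (S.H_le 0) h2
  symm₁₁ _ _ := rfl
  jacobi₀₀₀ := DGLA.restrictBr_lie (S.H_le 0) h2 h2
  jacobi₀₀₁ := DGLA.restrictBr_lie (S.H_le 0) h2 hH
  jacobi₀₀₂ _ _ _ := rfl
  jacobi₀₀₃ _ _ _ := rfl
  jacobi₀₁₁ _ _ _ := rfl
  jacobi₀₁₂ _ _ _ := rfl
  jacobi₁₁₁ _ _ _ := rfl
  d₁_b₀₁ _ _ := rfl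
  d₂_b₀₂ _ _ := rfl
  d₂_b₁₁ _ _ := rfl
  d₂_d₁ _ := rfl

/-- The projection onto the harmonic subspace of degree `j`. -/
noncomputable def projH (j : ℤ) : A.carrier →ₗ[K] S.H j :=
  LinearMap.fst K _ _ ∘ₗ S.proj (sub_add_cancel j 1)

theorem projH_of_ne (j : ℤ) : ∀ i ≠ j, ∀ x ∈ A.grading i, S.projH j x = 0 :=
  fun _ hi _ hx => congrArg Prod.fst (S.proj_of_ne _ hi hx)

@[simp] theorem projH_coe {j : ℤ} (a : S.H j) : S.projH j a = a :=
  congrArg Prod.fst (S.proj_H _ a)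

theorem projH_add {j : ℤ} (a : S.H j) (k : S.Kc j) : S.projH j (a + k : A.carrier) = a :=
  congrArg Prod.fst (S.proj_add _ a k)

theorem projH_br_zero (h2 : ∀ x ∈ S.H 0, ∀ y ∈ S.H 0, A.br x y ∈ S.H 0) {x y : A.carrier}
    (hx : x ∈ S.H 0) (hy : y ∈ S.H 0) : S.projH 0 (A.br x y) =
      DGLA.restrictBr (S.H 0) (S.H 0) h2 (S.projH 0 x) (S.projH 0 y) := by
  lift x to S.H 0 using hx
  lift y to S.H 0 using hy
  rw [projH_coe, projH_coe]
  exact S.projH_coe (DGLA.restrictBr (S.H 0) (S.H 0) h2 x y)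

theorem projH_br_one (hH : ∀ g ∈ S.H 0, ∀ x ∈ S.H 1, A.br g x ∈ S.H 1)
    (hK : ∀ g ∈ S.H 0, ∀ x ∈ S.Kc 1, A.br g x ∈ S.Kc 1) {x y : A.carrier}
    (hx : x ∈ S.H 0) (hy : y ∈ S.H 1 ⊔ S.Kc 1) : S.projH 1 (A.br x y) =
      DGLA.restrictBr (S.H 0) (S.H 1) hH (S.projH 0 x) (S.projH 1 y) := by
  obtain ⟨a, ha, k, hk, rfl⟩ := Submodule.mem_sup.1 hy
  lift x to S.H 0 using hx
  lift a to S.H 1 using ha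
  lift k to S.Kc 1 using hk
  rw [projH_coe, projH_add, (A.br_lin₂ x).map_add]
  exact S.projH_add (DGLA.restrictBr (S.H 0) (S.H 1) hH x a)
    (DGLA.restrictBr (S.H 0) (S.Kc 1) hK x k)

theorem isFormal_of_H_eq_bot (h1 : ∀ i < 0, S.H i = ⊥) (h4 : ∀ i, 2 ≤ i → S.H i = ⊥)
    (h2 : ∀ x ∈ S.H 0, ∀ y ∈ S.H 0, A.br x y ∈ S.H 0)
    (hH : ∀ g ∈ S.H 0, ∀ x ∈ S.H 1, A.br g x ∈ S.H 1)
    (hK : ∀ g ∈ S.H 0, ∀ x ∈ S.Kc 1, A.br g x ∈ S.Kc 1) : A.IsFormal := by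
  refine ⟨(S.lowDegree h2 hH).toDGLA, fun _ => rfl,
    .trans (.symm (.of (S.qIso_trunc h1 h2 hH hK))) (.of ?_)⟩
  have : Subsingleton (S.lowDegree h2 hH).M₃ := inferInstanceAs (Subsingleton PUnit)
  have hs : ∀ a b : (S.lowDegree h2 hH).M₂, a = b :=
    (inferInstance : Subsingleton PUnit).allEq
  refine S.qIso_of_components (F := S.lowDegree h2 hH) (f₀ := S.projH 0) (f₁ := S.projH 1)
    (f₂ := 0) h1 (fun i hi => h4 i (by omega)) h2 hH hK (S.projH_of_ne 0) (S.projH_of_ne 1)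
    (fun _ _ _ _ => rfl) ?_ ?_ (fun _ _ _ _ => hs _ _) (fun _ _ _ _ => hs _ _)
    (fun _ _ => hs _ _) ?_ ?_ ?_ ?_ ?_ ?_
  · exact fun x hx y hy => S.projH_br_zero h2 hx hy
  · exact fun x hx y hy => S.projH_br_one hH hK hx hy
  · intro x hx h
    exact congrArg Subtype.val ((S.projH_coe ⟨x, hx⟩).symm.trans h)
  · exact fun y => ⟨y.1, y.2, S.projH_coe y⟩
  · intro x hx h
    exact congrArg Subtype.val ((S.projH_coe ⟨x, hx⟩).symm.trans h)
  · exact fun y _ => ⟨y.1, y.2, S.projH_coe y⟩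
  · intro x hx _
    rwa [h4 2 le_rfl, Submodule.mem_bot] at hx
  · exact fun w => ⟨0, zero_mem _, 0, hs _ _⟩

end GradedSplitting

namespace QCyclicDGLA

variable {A : QCyclicDGLA K 2} (S : GradedSplitting A.toDGLA)

theorem exists_correction : ∃ τ : S.Kc 1 →ₗ[K] S.H 1,
    ∀ (k : S.Kc 1) (x : S.H 1), A.form (τ k) x = A.form k x := by
  let e := LinearEquiv.ofBijective _ (pairing_bijective S (one_add_one_eq_two))
  refine ⟨e.symm.toLinearMap ∘ₗ A.formHom.domRestrict₁₂ (S.Kc 1) (S.H 1), fun k x => ?_⟩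
  exact LinearMap.congr_fun (e.apply_symm_apply (A.formHom.domRestrict₁₂ (S.Kc 1) (S.H 1) k)) x

variable {S} (τ : S.Kc 1 →ₗ[K] S.H 1)

/-- The isomorphism of `H¹ × K¹` with `H¹ ⊕ K¹` which shears `K¹` into the orthogonal complement
of `H¹`. -/
def shear : (S.H 1 × S.Kc 1) →ₗ[K] A.carrier :=
  (S.H 1).subtype.coprod ((S.Kc 1).subtype - (S.H 1).subtype ∘ₗ τ)

theorem shear_apply (v : S.H 1 × S.Kc 1) : shear τ v = v.1 + (v.2 - τ v.2) := rfl

theorem shear_mem (v : S.H 1 × S.Kc 1) : shear τ v ∈ A.grading 1 :=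
  add_mem (S.H_le 1 v.1.2) (sub_mem (S.Kc_le 1 v.2.2) (S.H_le 1 (τ v.2).2))

/-- The inverse of `shear`, extended by zero. -/
noncomputable def unshear : A.carrier →ₗ[K] (S.H 1 × S.Kc 1) :=
  ((LinearMap.fst K _ _).prod (LinearMap.snd K _ _ ∘ₗ LinearMap.snd K _ _) +
    (τ ∘ₗ LinearMap.snd K _ _ ∘ₗ LinearMap.snd K _ _).prod 0) ∘ₗ S.proj (sub_add_cancel 1 1)

theorem unshear_of_ne : ∀ i ≠ 1, ∀ x ∈ A.grading i, unshear τ x = 0 := by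
  intro i hi x hx
  rw [unshear, LinearMap.comp_apply, S.proj_of_ne _ hi hx, map_zero]

theorem unshear_add (a : S.H 1) (k : S.Kc 1) : unshear τ (a + k : A.carrier) = (a + τ k, k) := by
  rw [unshear, LinearMap.comp_apply, S.proj_add]
  simp

theorem unshear_coe (a : S.H 1) : unshear τ a = (a, 0) := by
  simpa using unshear_add τ a 0

theorem unshear_shear (v : S.H 1 × S.Kc 1) : unshear τ (shear τ v) = v := by
  have h : shear τ v = ((v.1 - τ v.2 : S.H 1) + v.2 : A.carrier) := by
    rw [shear_apply, Submodule.coe_sub]; abel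
  rw [h, unshear_add, sub_add_cancel]

theorem shear_unshear {x : A.carrier} (hx : x ∈ S.H 1 ⊔ S.Kc 1) : shear τ (unshear τ x) = x := by
  obtain ⟨a, ha, k, hk, rfl⟩ := Submodule.mem_sup.1 hx
  rw [unshear_add τ ⟨a, ha⟩ ⟨k, hk⟩, shear_apply, Submodule.coe_add]
  abel

/-- The `K¹`-component of the exact part of an element of degree two. -/
noncomputable def exactPart : A.carrier →ₗ[K] S.Kc 1 :=
  LinearMap.fst K _ _ ∘ₗ LinearMap.snd K _ _ ∘ₗ S.proj one_add_one_eq_two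

variable {hH : ∀ g ∈ S.H 0, ∀ x ∈ S.H 1, A.br g x ∈ S.H 1}
  {hK : ∀ g ∈ S.H 0, ∀ x ∈ S.Kc 1, A.br g x ∈ S.Kc 1}
  {τ : S.Kc 1 →ₗ[K] S.H 1}

theorem correction_br (hτ : ∀ (k : S.Kc 1) (x : S.H 1), A.form (τ k) x = A.form k x) (y : S.H 0)
    (k : S.Kc 1) :
    τ (DGLA.restrictBr _ _ hK y k) = DGLA.restrictBr _ _ hH y (τ k) := by
  refine (pairing_bijective S one_add_one_eq_two).1 (LinearMap.ext fun x => ?_)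
  rw [pairing_apply, pairing_apply, hτ, DGLA.coe_restrictBr, DGLA.coe_restrictBr,
    form_inv (S.H_le 0 y.2) (S.Kc_le 1 k.2), form_inv (S.H_le 0 y.2) (S.H_le 1 (τ k).2)]
  exact congrArg Neg.neg (hτ k (DGLA.restrictBr _ _ hH y x)).symm

theorem shear_br (hτ : ∀ (k : S.Kc 1) (x : S.H 1), A.form (τ k) x = A.form k x) (y : S.H 0)
    (v : S.H 1 × S.Kc 1) :
    shear τ (DGLA.restrictBr _ _ hH y v.1, DGLA.restrictBr _ _ hK y v.2) =
      A.br y (shear τ v) := by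
  rw [shear_apply, shear_apply, correction_br (hH := hH) hτ, (A.br_lin₂ y).map_add,
    (A.br_lin₂ y).map_sub]
  rfl

/-- The form induced on `K¹` by its projection to the orthogonal complement of `H¹`. -/
def orthForm (τ : S.Kc 1 →ₗ[K] S.H 1) : S.Kc 1 →ₗ[K] S.Kc 1 →ₗ[K] K :=
  A.formHom.compl₁₂ (shear τ ∘ₗ LinearMap.inr K _ _) (shear τ ∘ₗ LinearMap.inr K _ _)

theorem orthForm_apply (k k' : S.Kc 1) :
    orthForm τ k k' = A.form (shear τ (0, k)) (shear τ (0, k')) := rfl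

theorem form_shear_inr (hτ : ∀ (k : S.Kc 1) (x : S.H 1), A.form (τ k) x = A.form k x)
    (k : S.Kc 1) (x : S.H 1) : A.form (shear τ (0, k)) x = 0 := by
  rw [shear_apply, Submodule.coe_zero, zero_add, (A.form_lin₁ x).map_sub, hτ, sub_self]

theorem form_shear (hτ : ∀ (k : S.Kc 1) (x : S.H 1), A.form (τ k) x = A.form k x)
    (v w : S.H 1 × S.Kc 1) : A.form (shear τ v) (shear τ w) =
      pairing S 1 1 v.1 w.1 + orthForm τ v.2 w.2 := by
  have h (v : S.H 1 × S.Kc 1) : shear τ v = v.1 + shear τ (0, v.2) := by simp [shear_apply]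
  have h0 := form_shear_inr hτ v.2 w.1
  have h1 := form_symm_eq_zero (shear_mem τ (0, w.2)) (S.H_le 1 v.1.2)
    (form_shear_inr hτ w.2 v.1)
  rw [h v, h w, (A.form_lin₁ _).map_add, (A.form_lin₂ _).map_add, (A.form_lin₂ _).map_add, h0, h1,
    add_zero, zero_add]
  rfl

/-- The symplectic model of a quasi-cyclic DG-Lie algebra of degree two. -/
noncomputable def symplecticModel (h2 : ∀ x ∈ S.H 0, ∀ y ∈ S.H 0, A.br x y ∈ S.H 0)
    (hH : ∀ g ∈ S.H 0, ∀ x ∈ S.H 1, A.br g x ∈ S.H 1)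
    (hK : ∀ g ∈ S.H 0, ∀ x ∈ S.Kc 1, A.br g x ∈ S.Kc 1)
    (hH' : ∀ g ∈ S.H 0, ∀ x ∈ S.H 2, A.br g x ∈ S.H 2)
    (hK' : ∀ g ∈ S.H 0, ∀ x ∈ S.Kc 2, A.br g x ∈ S.Kc 2)
    (τ : S.Kc 1 →ₗ[K] S.H 1)
    (hτ : ∀ (k : S.Kc 1) (x : S.H 1), A.form (τ k) x = A.form k x) : SymplecticModel K where
  g := S.H 0
  X := S.H 1
  E := S.Kc 1
  brg := DGLA.restrictBr (S.H 0) (S.H 0) h2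
  ρX := DGLA.restrictBr (S.H 0) (S.H 1) hH
  ρE := DGLA.restrictBr (S.H 0) (S.Kc 1) hK
  ωX := pairing S 1 1
  ωE := orthForm τ
  γ := (A.brHom.compl₁₂ (shear τ) (shear τ)).compr₂ exactPart
  brg_skew := DGLA.restrictBr_skew (S.H_le 0) h2
  brg_jacobi := DGLA.restrictBr_lie (S.H_le 0) h2 h2
  ρX_lie := DGLA.restrictBr_lie (S.H_le 0) h2 hH
  ρE_lie := DGLA.restrictBr_lie (S.H_le 0) h2 hK
  ωX_skew x y := form_skew (S.H_le 1 x.2) (S.H_le 1 y.2)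
  ωE_skew x y := form_skew (shear_mem τ (0, x)) (shear_mem τ (0, y))
  ωX_inv y v w := by
    rw [pairing_apply, pairing_apply, DGLA.coe_restrictBr,
      form_inv (S.H_le 0 y.2) (S.H_le 1 v.2)]
    exact neg_add_cancel _
  ωE_inv y v w := by
    have h (k : S.Kc 1) : shear τ (0, DGLA.restrictBr _ _ hK y k) = A.br y (shear τ (0, k)) := by
      simpa using shear_br (hH := hH) (hK := hK) hτ y (0, k)
    rw [orthForm_apply, orthForm_apply, h, h, form_inv (S.H_le 0 y.2) (shear_mem τ (0, v))]
    exact neg_add_cancel _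
  ωX_bij := pairing_bijective S one_add_one_eq_two
  γ_symm v w := congrArg exactPart (DGLA.br_comm_of_deg_one (shear_mem τ v) (shear_mem τ w))
  γ_inv y v w := by
    have hvw : A.br (shear τ v) (shear τ w) ∈ A.grading 2 :=
      A.br_mem 1 1 _ (shear_mem τ v) _ (shear_mem τ w)
    refine (S.proj_br one_add_one_eq_two hH' hK hK' y hvw).symm.trans ?_
    rw [DGLA.jacobi_of_deg_zero (S.H_le 0 y.2) (shear_mem τ v), ← shear_br (hH := hH) (hK := hK) hτ,
      ← shear_br (hH := hH) (hK := hK) hτ]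
    exact map_add exactPart _ _

/-- The degree two component of the map to the symplectic model. -/
noncomputable def toModelTwo : A.carrier →ₗ[K] (Module.Dual K (S.H 0) × S.Kc 1) :=
  ((Submodule.dualRestrict (S.H 0)) ∘ₗ A.formHom).prod exactPart

theorem toModelTwo_of_ne : ∀ i ≠ 2, ∀ x ∈ A.grading i, toModelTwo (S := S) x = 0 := by
  intro i hi x hx
  refine Prod.ext (LinearMap.ext fun y => ?_) ?_
  · exact A.form_degree i 0 (by omega) x hx y (S.H_le 0 y.2)
  · exact congrArg (fun p => p.2.1) (S.proj_of_ne one_add_one_eq_two hi hx)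

theorem toModelTwo_d {x : A.carrier} (hx : x ∈ S.H 1 ⊔ S.Kc 1) :
    toModelTwo (S := S) (A.d x) = (0, (unshear τ x).2) := by
  obtain ⟨a, ha, k, hk, rfl⟩ := Submodule.mem_sup.1 hx
  lift a to S.H 1 using ha
  lift k to S.Kc 1 using hk
  rw [unshear_add, A.d_lin.map_add, S.d_H 1 a a.2, zero_add]
  refine Prod.ext (LinearMap.ext fun y => ?_) ?_
  · exact form_d_left (S.Kc_le 1 k.2) (S.d_H 0 y y.2)
  · exact congrArg (fun p => p.2.1) (S.proj_d one_add_one_eq_two k)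

theorem unshear_br (hH : ∀ g ∈ S.H 0, ∀ x ∈ S.H 1, A.br g x ∈ S.H 1)
    (hK : ∀ g ∈ S.H 0, ∀ x ∈ S.Kc 1, A.br g x ∈ S.Kc 1)
    (hτ : ∀ (k : S.Kc 1) (x : S.H 1), A.form (τ k) x = A.form k x) (y : S.H 0) {x : A.carrier}
    (hx : x ∈ S.H 1 ⊔ S.Kc 1) : unshear τ (A.br y x) =
      (DGLA.restrictBr _ _ hH y (unshear τ x).1, DGLA.restrictBr _ _ hK y (unshear τ x).2) := by
  conv_lhs => rw [← shear_unshear τ hx, ← shear_br (hH := hH) (hK := hK) hτ, unshear_shear]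

theorem isFormal_of_degree_two [CharZero K] (h1 : ∀ i < 0, S.H i = ⊥)
    (h2 : ∀ x ∈ S.H 0, ∀ y ∈ S.H 0, A.br x y ∈ S.H 0)
    (hH : ∀ g ∈ S.H 0, ∀ x ∈ S.H 1, A.br g x ∈ S.H 1)
    (hK : ∀ g ∈ S.H 0, ∀ x ∈ S.Kc 1, A.br g x ∈ S.Kc 1)
    (hH' : ∀ g ∈ S.H 0, ∀ x ∈ S.H 2, A.br g x ∈ S.H 2)
    (hK' : ∀ g ∈ S.H 0, ∀ x ∈ S.Kc 2, A.br g x ∈ S.Kc 2) : A.toDGLA.IsFormal := by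
  obtain ⟨τ, hτ⟩ := exists_correction S
  let M := symplecticModel h2 hH hK hH' hK' τ hτ
  have := A.findim 1
  have : FiniteDimensional K M.X := S.finiteDimensional_H 1
  obtain ⟨B, hB, hz⟩ := M.isFormal_model
  refine ⟨B, hB, .trans (.trans (.symm (.of (S.qIso_trunc h1 h2 hH hK))) (.of ?_)) hz⟩
  have : Subsingleton M.model.M₃ := (inferInstance : Subsingleton PUnit)
  refine S.qIso_of_components (F := M.model) (f₀ := S.projH 0) (f₁ := unshear τ)
    (f₂ := toModelTwo) h1 (fun i hi => H_eq_bot S h1 (by omega)) h2 hH hK (S.projH_of_ne 0)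
    (unshear_of_ne τ) toModelTwo_of_ne (fun x hx y hy => S.projH_br_zero h2 hx hy)
    ?_ ?_ ?_ (fun x hx => toModelTwo_d hx) ?_
    (fun y => ⟨y.1, y.2, S.projH_coe y⟩) ?_ ?_ ?_ ?_
  · intro x hx v hv
    exact (unshear_br hH hK hτ ⟨x, hx⟩ hv).trans
      (congrArg (fun y => M.ρ y (unshear τ v)) (S.projH_coe ⟨x, hx⟩).symm)
  · intro x hx w hw
    refine Eq.trans (b := M.ρ₂ (⟨x, hx⟩ : S.H 0) (toModelTwo w))
      (Prod.ext (LinearMap.ext fun (y : S.H 0) => ?_) ?_)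
      (congrArg (fun y => M.ρ₂ y (toModelTwo w)) (S.projH_coe ⟨x, hx⟩).symm)
    · exact form_inv (S.H_le 0 hx) hw y
    · exact S.proj_br one_add_one_eq_two hH' hK hK' ⟨x, hx⟩ hw
  · intro v hv w hw
    have ev := shear_unshear τ hv
    have ew := shear_unshear τ hw
    have hv' := shear_mem τ (unshear τ v)
    have hw' := shear_mem τ (unshear τ w)
    refine Prod.ext (LinearMap.ext fun (y : S.H 0) => ?_) ?_
    · refine Eq.trans ?_ (congrArg Neg.neg (form_shear hτ (unshear τ v)
        (DGLA.restrictBr _ _ hH y (unshear τ w).1, DGLA.restrictBr _ _ hK y (unshear τ w).2)))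
      rw [shear_br hτ, ev, ew]
      rw [ew] at hw'
      change A.form (A.br v w) y = _
      rw [A.form_cyclic, DGLA.br_skew_of_deg_zero' hw' (S.H_le 0 y.2), (A.form_lin₂ v).map_neg]
    · change exactPart (A.br v w) = exactPart (A.br (shear τ (unshear τ v)) (shear τ (unshear τ w)))
      rw [ev, ew]
  · intro x hx h
    exact congrArg Subtype.val ((S.projH_coe ⟨x, hx⟩).symm.trans h)
  · intro x hx h
    exact congrArg Subtype.val (congrArg Prod.fst ((unshear_coe τ ⟨x, hx⟩).symm.trans h))
  · rintro ⟨x, k⟩ h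
    have hk : (0 : S.Kc 1) = k := (congrArg Prod.snd h).symm
    exact ⟨x.1, x.2, (unshear_coe τ x).trans (congrArg (Prod.mk x) hk)⟩
  · rintro x hx ⟨v, hv⟩
    exact eq_zero_of_form_eq_zero S (add_zero 2) hx fun y hy =>
      (LinearMap.congr_fun (congrArg Prod.fst hv) (⟨y, hy⟩ : S.H 0)).symm
  · rintro ⟨u, e⟩
    change S.Kc 1 at e
    obtain ⟨x, hx⟩ := (pairing_bijective S (add_zero 2)).2 u
    refine ⟨x, x.2, (0, -e), Prod.ext (sub_eq_zero.2 hx).symm ?_⟩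
    have h0 : exactPart (S := S) (x : A.carrier) = 0 :=
      congrArg (fun p => p.2.1) (S.proj_H one_add_one_eq_two x)
    change -e = exactPart (S := S) (x : A.carrier) - e
    rw [h0, zero_sub]

end QCyclicDGLA

/-- **Theorem (Bandiera–Manetti–Meazzini).**
Let `(L, d, [-,-], (-,-))` be a quasi-cyclic DG-Lie algebra of degree `n ≤ 2` over a
field of characteristic `0`.  Assume there is a splitting `L = H ⊕ d(K) ⊕ K` such that
`H^i = 0` for `i < 0`, `H^0` is closed under the bracket, and `H^i`, `K^i` are
`H^0`-submodules for the adjoint action for all `i > 0`.  Then `L` is formal. -/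
theorem formality_of_quasiCyclic_degree_le_two
    {K : Type} [Field K] [CharZero K] {n : ℤ} (hn : n ≤ 2)
    (A : QCyclicDGLA K n) (S : GradedSplitting A.toDGLA)
    (h1 : ∀ i : ℤ, i < 0 → S.H i = ⊥)
    (h2 : ∀ x ∈ S.H 0, ∀ y ∈ S.H 0, A.br x y ∈ S.H 0)
    (h3H : ∀ i : ℤ, 0 < i → ∀ g ∈ S.H 0, ∀ x ∈ S.H i, A.br g x ∈ S.H i)
    (h3K : ∀ i : ℤ, 0 < i → ∀ g ∈ S.H 0, ∀ x ∈ S.Kc i, A.br g x ∈ S.Kc i) :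
    A.toDGLA.IsFormal := by
  rcases hn.eq_or_lt with rfl | hn
  · exact QCyclicDGLA.isFormal_of_degree_two (S := S) h1 h2 (h3H 1 one_pos) (h3K 1 one_pos)
      (h3H 2 two_pos) (h3K 2 two_pos)
  · exact S.isFormal_of_H_eq_bot h1 (fun i hi => QCyclicDGLA.H_eq_bot S h1 (by omega)) h2
      (h3H 1 one_pos) (h3K 1 one_pos)
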